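/- arXiv:1201.1089 — 5 statements merged into one kernel-verified Lean document; each statement's English description precedes it below -/
import Mathlib

section
/- Fix α ∈ (0,1] and p ≥ 2 and let U be the Burkholder-type special function. Then U is of class C¹ on its domain and there exists an absolute constant K such that for all x ≥ 0, y ∈ ℝ, z > 0: U(x,y,z) ≤ K·(x+|y|+z)^p, and the partial derivatives satisfy U_x(x,y,z) ≤ K·(x+|y|+z)^{p−1} and |U_y(x,y,z)| ≤ K·(x+|y|+z)^{p−1}. -/
/-- gluing lemma -/
theorem glue_fderiv {Q : Type*} [NormedAddCommGroup Q] [NormedSpace ℝ Q]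
    {F : Q → ℝ} {L : Q →L[ℝ] ℝ} {S : Set Q} {T : Q → Q} {q : Q}
    (hF : HasFDerivWithinAt F L S (T q)) (hT : Set.MapsTo T S S)
    (hlip : ∀ q', ‖T q' - T q‖ ≤ ‖q' - q‖)
    (hL : ∀ᶠ q' in nhds q, L (T q' - T q) = L (q' - q)) :
    HasFDerivWithinAt (fun q => F (T q)) L S q := by
  have hcont : ContinuousAt T q := by
    rw [ContinuousAt, tendsto_iff_norm_sub_tendsto_zero]
    have h0 : Filter.Tendsto (fun q' => ‖q' - q‖) (nhds q) (nhds 0) := by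
      have : Continuous (fun q' => ‖q' - q‖) := by fun_prop
      simpa using this.tendsto q
    exact squeeze_zero (fun _ => norm_nonneg _) hlip h0
  have ht : Filter.Tendsto T (nhdsWithin q S) (nhdsWithin (T q) S) :=
    hcont.continuousWithinAt.tendsto_nhdsWithin hT
  rw [hasFDerivWithinAt_iff_isLittleO] at hF ⊢
  have h1 := hF.comp_tendsto ht
  have h2 : ((fun x' => x' - T q) ∘ T) =O[nhdsWithin q S] (fun q' => q' - q) :=
    Asymptotics.IsBigO.of_bound 1 (Filter.Eventually.of_forall fun q' => by simpa using hlip q')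
  have h3 := h1.trans_isBigO h2
  refine h3.congr' ?_ Filter.EventuallyEq.rfl
  filter_upwards [nhdsWithin_le_nhds hL] with q' hq'
  simp only [Function.comp]
  rw [hq']

/-- phi -/
noncomputable def phiF (p x k : ℝ) : ℝ := k ^ (p-1) * (p * x - (p-1) * k)

theorem rpow_split {p k : ℝ} (hp : 2 ≤ p) (hk : 0 ≤ k) : k ^ (p-1) = k ^ (p-2) * k := by
  have : p - 1 = (p - 2) + 1 := by ring
  rw [this, Real.rpow_add_one' hk (by linarith)]

theorem rpow_split2 {p k : ℝ} (hp : 2 ≤ p) (hk : 0 ≤ k) : k ^ p = k ^ (p-1) * k := by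
  have : p = (p - 1) + 1 := by ring
  conv_lhs => rw [this]
  rw [Real.rpow_add_one' hk (by linarith)]

/-- linear functional on the plane -/
noncomputable def lin2 (A B : ℝ) : ℝ × ℝ →L[ℝ] ℝ :=
  A • ContinuousLinearMap.fst ℝ ℝ ℝ + B • ContinuousLinearMap.snd ℝ ℝ ℝ

/-- linear functional on space -/
noncomputable def lin3 (A B C : ℝ) : ℝ × ℝ × ℝ →L[ℝ] ℝ :=
  A • ContinuousLinearMap.fst ℝ ℝ (ℝ × ℝ) +
  B • (ContinuousLinearMap.fst ℝ ℝ ℝ).comp (ContinuousLinearMap.snd ℝ ℝ (ℝ × ℝ)) +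
  C • (ContinuousLinearMap.snd ℝ ℝ ℝ).comp (ContinuousLinearMap.snd ℝ ℝ (ℝ × ℝ))

@[simp] theorem lin2_apply (A B : ℝ) (v : ℝ × ℝ) : lin2 A B v = A * v.1 + B * v.2 := by
  simp [lin2]

@[simp] theorem lin3_apply (A B C : ℝ) (v : ℝ × ℝ × ℝ) :
    lin3 A B C v = A * v.1 + B * v.2.1 + C * v.2.2 := by
  simp [lin3]

theorem phi_hasFDeriv {p : ℝ} (hp : 2 ≤ p) (x k : ℝ) (hk : 0 ≤ k) :
    HasFDerivAt (fun q : ℝ × ℝ => phiF p q.1 q.2)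
      (lin2 (p * k ^ (p-1)) (p * (p-1) * k ^ (p-2) * (x - k))) (x, k) := by
  have hf : HasFDerivAt (fun q : ℝ × ℝ => q.1) (ContinuousLinearMap.fst ℝ ℝ ℝ) (x, k) :=
    hasFDerivAt_fst
  have hs : HasFDerivAt (fun q : ℝ × ℝ => q.2) (ContinuousLinearMap.snd ℝ ℝ ℝ) (x, k) :=
    hasFDerivAt_snd
  have h1 : HasDerivAt (fun k : ℝ => k ^ (p-1)) ((p-1) * k ^ (p-1-1)) k :=
    Real.hasDerivAt_rpow_const (Or.inr (by linarith))
  have h2 := h1.comp_hasFDerivAt (x, k) hs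
  have h3 := h2.mul ((hf.const_mul p).sub (hs.const_mul (p-1)))
  refine h3.congr_fderiv ?_
  have e : p - 1 - 1 = p - 2 := by ring
  ext <;> simp [e, rpow_split hp hk] <;> ring

theorem psi_hasFDeriv {p : ℝ} (hp : 2 ≤ p) (x k : ℝ) (hx : 0 ≤ x) :
    HasFDerivWithinAt (fun q : ℝ × ℝ => phiF p q.1 (max q.1 q.2))
      (lin2 (p * (max x k) ^ (p-1)) (p * (p-1) * (max x k) ^ (p-2) * (x - max x k)))
      (Set.Ici 0 ×ˢ Set.univ) (x, k) := by
  refine glue_fderiv (F := fun q : ℝ × ℝ => phiF p q.1 q.2) (T := fun q => (q.1, max q.1 q.2))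
    (q := (x,k)) ((phi_hasFDeriv hp x _ (le_max_of_le_left hx)).hasFDerivWithinAt) ?_ ?_ ?_
  · intro q hq; simpa using hq
  · rintro ⟨x', k'⟩
    simp only [Prod.norm_def, Prod.fst_sub, Prod.snd_sub, Real.norm_eq_abs]
    exact max_le (le_max_left _ _) (abs_max_sub_max_le_max _ _ _ _)
  · rcases lt_or_ge x k with h | h
    · have : ∀ᶠ q : ℝ × ℝ in nhds (x, k), q.1 < q.2 :=
        (isOpen_lt continuous_fst continuous_snd).mem_nhds h
      filter_upwards [this] with q hq
      simp [max_eq_right hq.le, max_eq_right h.le]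
    · refine Filter.Eventually.of_forall fun q => ?_
      simp [max_eq_left h]

/-- The three partials of the extended function. -/
noncomputable def muF (g : ℝ → ℝ) (q : ℝ × ℝ × ℝ) : ℝ :=
  max q.1 (q.2.2 * g ((q.1 + q.2.1) / q.2.2))
noncomputable def psK (p : ℝ) (g : ℝ → ℝ) (q : ℝ × ℝ × ℝ) : ℝ :=
  p * (p-1) * (muF g q) ^ (p-2) * (q.1 - muF g q)
noncomputable def PhiF (p A : ℝ) (g : ℝ → ℝ) (q : ℝ × ℝ × ℝ) : ℝ :=
  q.2.2 ^ p - A * phiF p q.1 (muF g q)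
noncomputable def PhiD (p A : ℝ) (g g' : ℝ → ℝ) (q : ℝ × ℝ × ℝ) : ℝ × ℝ × ℝ →L[ℝ] ℝ :=
  lin3 (-A * (p * (muF g q) ^ (p-1) + psK p g q * g' ((q.1 + q.2.1) / q.2.2)))
    (-A * (psK p g q * g' ((q.1 + q.2.1) / q.2.2)))
    (p * q.2.2 ^ (p-1) - A * (psK p g q * (g ((q.1 + q.2.1) / q.2.2) -
      (q.1 + q.2.1) / q.2.2 * g' ((q.1 + q.2.1) / q.2.2))))

def dom3 : Set (ℝ × ℝ × ℝ) := Set.Ici (0:ℝ) ×ˢ (Set.univ ×ˢ Set.Ioi (0:ℝ))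

theorem Phi_hasFDeriv {p A : ℝ} (hp : 2 ≤ p) {g g' : ℝ → ℝ} (hg : ∀ t, HasDerivAt g (g' t) t)
    {q : ℝ × ℝ × ℝ} (hq : q ∈ dom3) :
    HasFDerivWithinAt (PhiF p A g) (PhiD p A g g' q) dom3 q := by
  obtain ⟨x, y, m⟩ := q
  have hx : 0 ≤ x := hq.1
  have hm : 0 < m := hq.2.2
  have h1 : HasFDerivAt (fun q : ℝ × ℝ × ℝ => q.1) (lin3 1 0 0) (x, y, m) :=
    hasFDerivAt_fst.congr_fderiv (by ext <;> simp)
  have h2 : HasFDerivAt (fun q : ℝ × ℝ × ℝ => q.2.1) (lin3 0 1 0) (x, y, m) :=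
    (hasFDerivAt_fst.comp (x, y, m) hasFDerivAt_snd).congr_fderiv (by ext <;> simp)
  have h3 : HasFDerivAt (fun q : ℝ × ℝ × ℝ => q.2.2) (lin3 0 0 1) (x, y, m) :=
    (hasFDerivAt_snd.comp (x, y, m) hasFDerivAt_snd).congr_fderiv (by ext <;> simp)
  have hinv := (hasDerivAt_inv hm.ne').comp_hasFDerivAt (x, y, m) h3
  have hT := (h1.add h2).mul hinv
  have hgT := (hg ((x + y) * m⁻¹)).comp_hasFDerivAt (x, y, m) hT
  have hk := h3.mul hgT
  have hpair := h1.prodMk hk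
  have hψ := (psi_hasFDeriv hp x (m * g ((x + y) * m⁻¹)) hx).comp (x, y, m)
    (hpair.hasFDerivWithinAt (s := dom3)) (by intro q hq; exact ⟨hq.1, trivial⟩)
  have hpow := ((Real.hasDerivAt_rpow_const (x := m) (p := p) (Or.inl hm.ne')).comp_hasFDerivAt
    (x, y, m) h3).hasFDerivWithinAt (s := dom3)
  have hfin := hpow.sub (hψ.const_mul A)
  refine hfin.congr_fderiv ?_
  clear hfin hpow hψ hpair hk hgT hT hinv h1 h2 h3
  refine ContinuousLinearMap.ext fun v => ?_
  simp only [PhiD, psK, muF, div_eq_mul_inv, lin3_apply, lin2_apply,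
    add_apply, sub_apply, smul_apply,
    ContinuousLinearMap.comp_apply, ContinuousLinearMap.prod_apply, Pi.add_apply, Pi.mul_apply,
    Function.comp, smul_eq_mul]
  generalize max x (m * g ((x + y) * m⁻¹)) = μ
  generalize g ((x + y) * m⁻¹) = k
  generalize g' ((x + y) * m⁻¹) = d
  generalize μ ^ (p-1) = r1
  generalize μ ^ (p-2) = r2
  generalize m ^ (p-1) = r3
  field_simp
  ring

theorem lin3_cont {S : Set (ℝ × ℝ × ℝ)} {A B C : ℝ × ℝ × ℝ → ℝ} (hA : ContinuousOn A S)
    (hB : ContinuousOn B S) (hC : ContinuousOn C S) :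
    ContinuousOn (fun q => lin3 (A q) (B q) (C q)) S := by
  unfold lin3
  exact ((hA.smul continuousOn_const).add (hB.smul continuousOn_const)).add
    (hC.smul continuousOn_const)

theorem PhiD_cont {p A : ℝ} (hp : 2 ≤ p) {g g' : ℝ → ℝ} (hg : Continuous g)
    (hg' : Continuous g') : ContinuousOn (PhiD p A g g') dom3 := by
  have hT : ContinuousOn (fun q : ℝ × ℝ × ℝ => (q.1 + q.2.1) / q.2.2) dom3 :=
    ContinuousOn.div (by fun_prop) (by fun_prop) (fun q hq => (ne_of_gt hq.2.2))
  have hgT : ContinuousOn (fun q : ℝ × ℝ × ℝ => g ((q.1 + q.2.1) / q.2.2)) dom3 :=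
    hg.comp_continuousOn hT
  have hgT' : ContinuousOn (fun q : ℝ × ℝ × ℝ => g' ((q.1 + q.2.1) / q.2.2)) dom3 :=
    hg'.comp_continuousOn hT
  have hmu : ContinuousOn (fun q => muF g q) dom3 := by
    have h1 : ContinuousOn (fun q : ℝ × ℝ × ℝ => q.1) dom3 := by fun_prop
    have h2 : ContinuousOn (fun q : ℝ × ℝ × ℝ => q.2.2) dom3 := by fun_prop
    exact ContinuousOn.sup h1 (h2.mul hgT)
  have hmu1 : ContinuousOn (fun q => (muF g q) ^ (p-1)) dom3 :=
    (Real.continuous_rpow_const (q := p - 1) (by linarith)).comp_continuousOn hmu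
  have hmu2 : ContinuousOn (fun q => (muF g q) ^ (p-2)) dom3 :=
    (Real.continuous_rpow_const (q := p - 2) (by linarith)).comp_continuousOn hmu
  have hm1 : ContinuousOn (fun q : ℝ × ℝ × ℝ => q.2.2 ^ (p-1)) dom3 := by
    have h2 : ContinuousOn (fun q : ℝ × ℝ × ℝ => q.2.2) dom3 := by fun_prop
    exact (Real.continuous_rpow_const (q := p - 1) (by linarith)).comp_continuousOn h2
  have hps : ContinuousOn (fun q => psK p g q) dom3 := by
    unfold psK
    have h1 : ContinuousOn (fun q : ℝ × ℝ × ℝ => q.1) dom3 := by fun_prop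
    exact (continuousOn_const.mul hmu2).mul (h1.sub hmu)
  have e : PhiD p A g g' = fun q => PhiD p A g g' q := rfl
  rw [e]
  unfold PhiD
  refine lin3_cont ?_ ?_ ?_
  · exact continuousOn_const.mul ((continuousOn_const.mul hmu1).add (hps.mul hgT'))
  · exact continuousOn_const.mul (hps.mul hgT')
  · exact (continuousOn_const.mul hm1).sub (continuousOn_const.mul (hps.mul (hgT.sub (hT.mul hgT'))))

def Tmax (q : ℝ × ℝ × ℝ) : ℝ × ℝ × ℝ := (q.1, q.2.1, max q.2.1 q.2.2)

theorem Tmax_maps : Set.MapsTo Tmax dom3 dom3 :=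
  fun q hq => ⟨hq.1, trivial, show 0 < max q.2.1 q.2.2 from lt_max_of_lt_right hq.2.2⟩

/-- key identity -/
def KeyId (p A : ℝ) (g g' : ℝ → ℝ) : Prop := ∀ t, 1 ≤ t → 0 ≤ g t ∧ t - 1 ≤ g t ∧
  1 + A * (p-1) * (g t) ^ (p-2) * (g t - (t-1)) * (g t - t * g' t) = 0

theorem PhiD_zero {p A : ℝ} (hp : 2 ≤ p) {g g' : ℝ → ℝ} (hkey : KeyId p A g g')
    {x y : ℝ} (hx : 0 ≤ x) (hy : 0 < y) : PhiD p A g g' (x, y, y) (0, 0, 1) = 0 := by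
  have hT : (x + y) / y = x / y + 1 := by field_simp
  obtain ⟨h0, h1, h2⟩ := hkey (x / y + 1) (by have := div_nonneg hx hy.le; linarith)
  simp only [add_sub_cancel_right] at h1 h2
  have hmu : muF g (x, y, y) = y * g (x / y + 1) := by
    simp only [muF, hT]
    apply max_eq_right
    rw [div_le_iff₀ hy] at h1
    linarith
  simp only [PhiD, lin3_apply, psK, hmu, hT]
  set k := g (x / y + 1)
  set d := g' (x / y + 1)
  rw [Real.mul_rpow (z := p - 2) hy.le h0, rpow_split hp hy.le]
  have hxy : x = y * (x / y) := by field_simp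
  set r := x / y
  rw [hxy]
  linear_combination p * y ^ (p-2) * y * h2

theorem G_hasFDeriv {p A : ℝ} (hp : 2 ≤ p) {g g' : ℝ → ℝ} (hg : ∀ t, HasDerivAt g (g' t) t)
    (hkey : KeyId p A g g') {q : ℝ × ℝ × ℝ} (hq : q ∈ dom3) :
    HasFDerivWithinAt (fun q => PhiF p A g (Tmax q)) (PhiD p A g g' (Tmax q)) dom3 q := by
  refine glue_fderiv (T := Tmax) (Phi_hasFDeriv hp hg (Tmax_maps hq)) Tmax_maps ?_ ?_
  · intro q'
    simp only [Tmax, Prod.norm_def, Prod.fst_sub, Prod.snd_sub, Real.norm_eq_abs]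
    have := abs_max_sub_max_le_max q'.2.1 q'.2.2 q.2.1 q.2.2
    exact max_le_max le_rfl (max_le (le_max_left _ _) this)
  · obtain ⟨x, y, z⟩ := q
    have hx : 0 ≤ x := hq.1
    have hz : 0 < z := hq.2.2
    rcases lt_or_ge y z with h | h
    · have : ∀ᶠ q : ℝ × ℝ × ℝ in nhds (x, y, z), q.2.1 < q.2.2 :=
        (isOpen_lt (f := fun q : ℝ × ℝ × ℝ => q.2.1) (g := fun q : ℝ × ℝ × ℝ => q.2.2)
          (by fun_prop) (by fun_prop)).mem_nhds h
      filter_upwards [this] with q' hq'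
      simp [Tmax, max_eq_right hq'.le, max_eq_right h.le]
    · refine Filter.Eventually.of_forall fun q' => ?_
      have h0 := PhiD_zero (A := A) hp hkey hx (lt_of_lt_of_le hz h)
      have hTm : Tmax (x, y, z) = (x, y, y) := by simp [Tmax, max_eq_left h]
      rw [hTm]
      simp only [PhiD, lin3_apply, Tmax] at h0 ⊢
      simp only [mul_zero, zero_add, mul_one] at h0
      rw [h0]
      simp

theorem g_exists {α p : ℝ} (hα0 : 0 < α) (hp : 2 ≤ p) {γ h : ℝ → ℝ}
    (hγlin : ∀ x : ℝ, 0 ≤ x → x < ((α+1)*p)⁻¹ → γ x = ((p-1)*(α+1)-1)*x + 1/p)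
    (hγode : ∀ x : ℝ, ((α+1)*p)⁻¹ < x →
      HasDerivAt γ
        ((-1 + ((α+1)*p)^p * (p-1) * (1 - γ x) * γ x * x^(p-2)) /
          (1 + ((α+1)*p)^p * (p-1) * (1 - γ x) * x^(p-1))) x)
    (hγinit : γ (((α+1)*p)⁻¹) = 1 - ((α+1)*p)⁻¹)
    (hγmono : MonotoneOn γ (Set.Ici (0:ℝ)))
    (hγlt : ∀ x : ℝ, 0 ≤ x → γ x < 1)
    (hh1 : ∀ x : ℝ, ((α+1)*p)⁻¹ ≤ x → h (x + γ x) = x)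
    (hh2 : ∀ y : ℝ, 1 ≤ y → h y + γ (h y) = y)
    (hh3 : ∀ y : ℝ, 1 ≤ y → ((α+1)*p)⁻¹ ≤ h y) :
    ∃ g g' : ℝ → ℝ, (∀ t, HasDerivAt g (g' t) t) ∧ Continuous g' ∧ (∀ t, |g' t| ≤ 1) ∧
      KeyId p (((α+1)*p)^p) g g' ∧ Monotone g ∧ (∀ t, 0 ≤ t → g t ≤ t) ∧
      (∀ X, 0 ≤ X → g (X + γ X) = X) ∧
      (∀ t, t ≤ 1 → g t = (t - 1/p) / ((p-1)*(α+1))) ∧ (∀ t, 1 ≤ t → g t = h t) := by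
  have hp0 : 0 < p := by linarith
  have hα : 0 < α + 1 := by linarith
  have hc1 : 1 ≤ (p-1)*(α+1) := by nlinarith
  have hc0 : 0 < (p-1)*(α+1) := by linarith
  have ha : 0 < (α+1)*p := by positivity
  have hx0 : 0 < ((α+1)*p)⁻¹ := by positivity
  have hlin1 : (1 - 1/p) / ((p-1)*(α+1)) = ((α+1)*p)⁻¹ := by
    have : p - 1 ≠ 0 := by linarith
    field_simp
  have hh1' : h 1 = ((α+1)*p)⁻¹ := by
    have := hh1 _ le_rfl
    rwa [hγinit, add_sub_cancel] at this
  set c := (p-1)*(α+1) with hc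
  set a := (α+1)*p with hadef
  let g : ℝ → ℝ := fun t => if t ≤ 1 then (t - 1/p) / c else h t
  have hgl : ∀ t, t ≤ 1 → g t = (t - 1/p) / c := fun t ht => by simp only [g, if_pos ht]
  have hgh : ∀ t, 1 ≤ t → g t = h t := fun t ht => by
    rcases ht.eq_or_lt with rfl | ht
    · rw [hgl 1 le_rfl, hlin1, hh1']
    · simp only [g, if_neg (not_le.mpr ht)]
  -- Lipschitz and monotone
  have hLh : ∀ s t, 1 ≤ s → s ≤ t → 0 ≤ g t - g s ∧ g t - g s ≤ t - s := by
    intro s t hs hst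
    rw [hgh s hs, hgh t (hs.trans hst)]
    have es := hh2 s hs
    have et := hh2 t (hs.trans hst)
    have ps := hx0.le.trans (hh3 s hs)
    have pt := hx0.le.trans (hh3 t (hs.trans hst))
    have hm : h s ≤ h t := by
      by_contra hcon
      push Not at hcon
      have := hγmono pt ps hcon.le
      linarith
    have := hγmono ps pt hm
    constructor <;> linarith
  have hLl : ∀ s t, t ≤ 1 → s ≤ t → 0 ≤ g t - g s ∧ g t - g s ≤ t - s := by
    intro s t ht hst
    rw [hgl s (hst.trans ht), hgl t ht, ← sub_div]
    constructor
    · apply div_nonneg _ hc0.le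
      linarith
    · rw [div_le_iff₀ hc0]
      nlinarith
  have hL : ∀ s t, s ≤ t → 0 ≤ g t - g s ∧ g t - g s ≤ t - s := by
    intro s t hst
    rcases le_total t 1 with ht | ht
    · exact hLl s t ht hst
    rcases le_total 1 s with hs | hs
    · exact hLh s t hs hst
    have h1 := hLl s 1 le_rfl hs
    have h2 := hLh 1 t le_rfl ht
    constructor <;> linarith [h1.1, h1.2, h2.1, h2.2]
  have hmono : Monotone g := fun s t hst => by linarith [(hL s t hst).1]
  have hlip : LipschitzWith 1 g := by
    apply LipschitzWith.of_dist_le_mul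
    intro s t
    simp only [Real.dist_eq, NNReal.coe_one, one_mul]
    rcases le_total s t with hst | hst
    · have := hL s t hst
      rw [abs_sub_comm, abs_sub_comm s, abs_of_nonneg this.1, abs_of_nonneg (by linarith)]
      exact this.2
    · have := hL t s hst
      rw [abs_of_nonneg this.1, abs_of_nonneg (by linarith)]
      exact this.2
  have hgc : Continuous g := hlip.continuous
  have hA : 0 < a ^ p := Real.rpow_pos_of_pos ha p
  have hp1 : 0 < p - 1 := by linarith
  -- facts for t ≥ 1
  have hpos : ∀ t, 1 ≤ t → 0 < g t ∧ 0 < 1 - t + g t := by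
    intro t ht
    rw [hgh t ht]
    have h3 := lt_of_lt_of_le hx0 (hh3 t ht)
    have := hγlt _ h3.le
    have := hh2 t ht
    exact ⟨h3, by linarith⟩
  let R : ℝ → ℝ := fun s => (1 + a^p * (p-1) * (1 - s + g s) * (g s)^(p-1)) /
    (a^p * (p-1) * (g s)^(p-2) * (1 - s + g s) * s)
  have hden : ∀ s, 1 ≤ s → 0 < a^p * (p-1) * (g s)^(p-2) * (1 - s + g s) * s := by
    intro s hs
    obtain ⟨h1, h2⟩ := hpos s hs
    have := Real.rpow_pos_of_pos h1 (p-2)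
    positivity
  let g' : ℝ → ℝ := fun t => R (max t 1)
  have hg'c : Continuous g' := by
    have hm : Continuous (fun t : ℝ => max t 1) := by fun_prop
    have hgm : Continuous (fun t : ℝ => g (max t 1)) := hgc.comp hm
    have h1 := (Real.continuous_rpow_const (q := p - 1) (by linarith)).comp hgm
    have h2 := (Real.continuous_rpow_const (q := p - 2) (by linarith)).comp hgm
    have hs : Continuous (fun t : ℝ => 1 - max t 1 + g (max t 1)) :=
      (continuous_const.sub hm).add hgm
    exact (continuous_const.add ((continuous_const.mul hs).mul h1)).div
      (((continuous_const.mul h2).mul hs).mul hm) (fun t => (hden _ (le_max_right _ _)).ne')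
  have hg1 : g 1 = a⁻¹ := by rw [hgl 1 le_rfl, hlin1]
  have hR1 : R 1 = 1 / c := by
    have e1 : a^p * (a⁻¹)^(p-1) = a := by
      rw [Real.inv_rpow ha.le, rpow_split2 hp ha.le]
      have := (Real.rpow_pos_of_pos ha (p-1)).ne'
      field_simp
    have e2 : (a⁻¹)^(p-1) = (a⁻¹)^(p-2) * a⁻¹ := rpow_split hp hx0.le
    have e3 : a^p * (a⁻¹)^(p-2) * a⁻¹ = a := by rw [mul_assoc, ← e2, e1]
    have n : 1 + a^p * (p-1) * (1 - 1 + a⁻¹) * (a⁻¹)^(p-1) = p := by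
      have : a * a⁻¹ = 1 := mul_inv_cancel₀ ha.ne'
      linear_combination (p-1) * a⁻¹ * e1 + (p-1) * this
    have d : a^p * (p-1) * (a⁻¹)^(p-2) * (1 - 1 + a⁻¹) * 1 = (p-1) * a := by
      linear_combination (p-1) * e3
    simp only [R, hg1]
    rw [n, d, hc, hadef]
    field_simp
  have hder : ∀ t, HasDerivAt g (g' t) t := by
    apply hasDerivAt_of_hasDerivAt_of_ne' (x := 1) _ hgc.continuousAt hg'c.continuousAt
    intro t ht
    rcases lt_or_gt_of_ne ht with ht | ht
    · have e : g' t = 1 / c := by simp only [g', max_eq_right ht.le, hR1]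
      rw [e]
      have h1 : HasDerivAt (fun t : ℝ => (t - 1/p) / c) (1 / c) t :=
        ((hasDerivAt_id t).sub_const _).div_const _
      refine h1.congr_of_eventuallyEq ?_
      filter_upwards [eventually_lt_nhds ht] with s hs
      exact hgl s hs.le
    · obtain ⟨hk, hk'⟩ := hpos t ht.le
      have hgt : g t + γ (g t) = t := by rw [hgh t ht.le]; exact hh2 t ht.le
      have hgx : a⁻¹ < g t := by
        have h3 := hh3 t ht.le
        rw [← hgh t ht.le] at h3
        rcases h3.lt_or_eq with h3 | h3
        · exact h3
        · rw [← h3, hγinit] at hgt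
          linarith
      have hf := (hasDerivAt_id (g t)).add (hγode (g t) hgx)
      have hγe : γ (g t) = t - g t := by linarith
      have hd := hden t ht.le
      have hn : 0 < 1 + a^p * (p-1) * (1 - t + g t) * (g t)^(p-1) := by
        have := Real.rpow_pos_of_pos hk (p-1)
        positivity
      have e : (1 + (-1 + a ^ p * (p - 1) * (1 - γ (g t)) * γ (g t) * g t ^ (p - 2)) /
          (1 + a ^ p * (p - 1) * (1 - γ (g t)) * g t ^ (p - 1))) = (R t)⁻¹ := by
        simp only [R]
        rw [inv_div, hγe]
        have : 1 - (t - g t) = 1 - t + g t := by ring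
        rw [this, eq_div_iff hn.ne', add_mul, div_mul_cancel₀ _ hn.ne', rpow_split hp hk.le]
        ring
      rw [e] at hf
      have hRt : 0 < R t := div_pos hn hd
      have := HasDerivAt.of_local_left_inverse (f := id + γ) (g := g) hgc.continuousAt hf
        (inv_ne_zero hRt.ne') (by
          filter_upwards [eventually_gt_nhds ht] with s hs
          simp only [Pi.add_apply, id]
          rw [hgh s hs.le]
          exact hh2 s hs.le)
      rw [inv_inv] at this
      simpa only [g', max_eq_left ht.le] using this
  refine ⟨g, g', hder, hg'c, ?_, ?_, hmono, ?_, ?_, hgl, hgh⟩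
  · intro t
    simpa using (hder t).le_of_lipschitz hlip
  · intro t ht
    obtain ⟨h1, h2⟩ := hpos t ht
    refine ⟨h1.le, by linarith, ?_⟩
    have hd := hden t ht
    have e : g' t * (a^p * (p-1) * (g t)^(p-2) * (1 - t + g t) * t) =
        1 + a^p * (p-1) * (1 - t + g t) * (g t)^(p-1) := by
      simp only [g', max_eq_left ht, R]
      rw [div_mul_cancel₀ _ hd.ne']
    rw [rpow_split hp h1.le] at e
    linear_combination -e
  · intro t ht
    have h0 : g 0 ≤ 0 := by
      rw [hgl 0 zero_le_one]
      apply div_nonpos_of_nonpos_of_nonneg _ hc0.le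
      simp [hp0.le]
    linarith [(hL 0 t ht).2]
  · intro X hX
    rcases lt_or_ge X a⁻¹ with hXa | hXa
    · have e := hγlin X hX hXa
      have e2 : X + γ X = c * X + 1 / p := by rw [e]; ring
      have e3 : c * a⁻¹ + 1/p = 1 := by rw [← hlin1]; field_simp; ring
      have : X + γ X ≤ 1 := by rw [e2]; nlinarith
      rw [hgl _ this, e2]
      field_simp
      ring
    · have := hγmono (show (0:ℝ) ≤ a⁻¹ from hx0.le) (show (0:ℝ) ≤ X from hX) hXa
      rw [hγinit] at this
      rw [hgh _ (by linarith), hh1 X hXa]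

theorem phiF_hom {p M X ν : ℝ} (hp : 2 ≤ p) (hM : 0 < M) (hν : 0 ≤ ν) :
    phiF p (M * X) (M * ν) = M ^ p * phiF p X ν := by
  unfold phiF
  rw [Real.mul_rpow hM.le hν, rpow_split2 hp hM.le]
  ring

theorem phiF_diag {p X : ℝ} (hp : 2 ≤ p) (hX : 0 ≤ X) : phiF p X X = X ^ p := by
  unfold phiF
  rw [rpow_split2 hp hX]
  ring

theorem bound_aux {p A : ℝ} (hp : 2 ≤ p) (hA : 0 < A) {g g' : ℝ → ℝ}
    (hg' : ∀ t, |g' t| ≤ 1) (hgt : ∀ t, 0 ≤ t → g t ≤ t) {x y z : ℝ} (hx : 0 ≤ x) (hy : 0 ≤ y)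
    (hz : 0 < z) :
    PhiF p A g (Tmax (x, y, z)) ≤ (1 + A * p * (p-1)) * (x + y + z) ^ p ∧
    PhiD p A g g' (Tmax (x, y, z)) (1, 0, 0) ≤ (1 + A * p * (p-1)) * (x + y + z) ^ (p-1) ∧
    |PhiD p A g g' (Tmax (x, y, z)) (0, 1, 0)| ≤ (1 + A * p * (p-1)) * (x + y + z) ^ (p-1) := by
  set R := x + y + z with hR
  have hM : 0 < max y z := lt_max_of_lt_right hz
  have hMR : max y z ≤ R := max_le (by linarith) (by linarith)
  have hT : 0 ≤ (x + y) / max y z := by positivity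
  have hR0 : 0 < R := by positivity
  have hp1 : 0 < p - 1 := by linarith
  set q := Tmax (x, y, z) with hq
  have hq1 : q.1 = x := rfl
  have hq2 : q.2.2 = max y z := rfl
  have hmx : x ≤ muF g q := le_max_left _ _
  have hm0 : 0 ≤ muF g q := hx.trans hmx
  have hmR : muF g q ≤ R := by
    refine max_le (by linarith [hq1]) ?_
    have h1 := mul_le_mul_of_nonneg_left (hgt _ hT) hM.le
    rw [mul_div_cancel₀ _ hM.ne'] at h1
    exact h1.trans (by linarith)
  set μ := muF g q with hμ
  have r2 : μ ^ (p-2) ≤ R ^ (p-2) := Real.rpow_le_rpow hm0 hmR (by linarith)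
  have r1 : μ ^ (p-1) ≤ R ^ (p-1) := Real.rpow_le_rpow hm0 hmR (by linarith)
  have n1 : 0 ≤ μ ^ (p-1) := Real.rpow_nonneg hm0 _
  have n2 : 0 ≤ μ ^ (p-2) := Real.rpow_nonneg hm0 _
  have N1 : 0 ≤ R ^ (p-1) := Real.rpow_nonneg hR0.le _
  have rp : μ ^ p ≤ R ^ p := Real.rpow_le_rpow hm0 hmR (by linarith)
  have np : 0 ≤ R ^ p := Real.rpow_nonneg hR0.le _
  have hps : |psK p g q| ≤ p * (p-1) * R ^ (p-1) := by
    unfold psK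
    rw [← hμ, hq1, rpow_split hp hR0.le, abs_mul, abs_of_nonneg (a := p * (p-1) * μ ^ (p-2))
      (by positivity), abs_sub_comm, abs_of_nonneg (sub_nonneg.2 hmx), mul_assoc]
    apply mul_le_mul_of_nonneg_left _ (by positivity)
    exact mul_le_mul r2 (by linarith) (by linarith) (n2.trans r2)
  set d := g' ((q.1 + q.2.1) / q.2.2) with hd
  have hpd : |psK p g q * d| ≤ p * (p-1) * R ^ (p-1) := by
    rw [abs_mul]
    calc |psK p g q| * |d| ≤ |psK p g q| * 1 :=
          mul_le_mul_of_nonneg_left (hg' _) (abs_nonneg _)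
      _ ≤ _ := by rw [mul_one]; exact hps
  have hApd := mul_le_mul_of_nonneg_left hpd hA.le
  refine ⟨?_, ?_, ?_⟩
  · have e : PhiF p A g q = (max y z) ^ p - A * (p * (x * μ ^ (p-1)) - (p-1) * μ ^ p) := by
      unfold PhiF phiF
      rw [← hμ, hq1, hq2, rpow_split2 hp hm0]
      ring
    rw [e]
    have hMp : (max y z) ^ p ≤ R ^ p := Real.rpow_le_rpow hM.le hMR (by linarith)
    have h1 : 0 ≤ A * (p * (x * μ ^ (p-1))) := by positivity
    have h2 : A * (p-1) * μ ^ p ≤ A * (p-1) * R ^ p :=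
      mul_le_mul_of_nonneg_left rp (by positivity)
    have h3 : A * (p-1) * R ^ p ≤ A * p * (p-1) * R ^ p := by
      have : 0 ≤ A * (p-1) * R ^ p := by positivity
      nlinarith
    linarith
  · simp only [PhiD, lin3_apply]
    rw [← hd, ← hμ]
    have := neg_abs_le (psK p g q * d)
    have h1 : 0 ≤ A * (p * μ ^ (p-1)) := by positivity
    have h2 := mul_le_mul_of_nonneg_left this hA.le
    linarith
  · simp only [PhiD, lin3_apply]
    rw [← hd]
    simp only [mul_zero, mul_one, zero_add, add_zero]
    rw [abs_mul, abs_neg, abs_of_pos hA]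
    linarith

theorem dom3_unique : UniqueDiffOn ℝ dom3 :=
  (uniqueDiffOn_Ici 0).prod (uniqueDiffOn_univ.prod (uniqueDiffOn_Ioi 0))

theorem G_contDiff {p A : ℝ} (hp : 2 ≤ p) {g g' : ℝ → ℝ} (hg : ∀ t, HasDerivAt g (g' t) t)
    (hg' : Continuous g') (hkey : KeyId p A g g') :
    ContDiffOn ℝ 1 (fun q => PhiF p A g (Tmax q)) dom3 := by
  have hgc : Continuous g := continuous_iff_continuousAt.2 fun t => (hg t).continuousAt
  have hTc : Continuous Tmax := by unfold Tmax; fun_prop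
  have := (contDiffOn_succ_iff_hasFDerivWithinAt_of_uniqueDiffOn (𝕜 := ℝ) (n := 0)
    (f := fun q => PhiF p A g (Tmax q)) dom3_unique).2 ⟨by simp, fun q => PhiD p A g g' (Tmax q),
      contDiffOn_zero.2 ((PhiD_cont hp hgc hg').comp hTc.continuousOn Tmax_maps),
      fun q hq => G_hasFDeriv hp hg hkey hq⟩
  simpa using this

theorem special_function_regularity_and_bounds
    {α p : ℝ} (hα0 : 0 < α) (hα1 : α ≤ 1) (hp : 2 ≤ p)
    {γ h : ℝ → ℝ} {u : ℝ → ℝ → ℝ} {U : ℝ → ℝ → ℝ → ℝ}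
    (hγlin : ∀ x : ℝ, 0 ≤ x → x < ((α+1)*p)⁻¹ → γ x = ((p-1)*(α+1)-1)*x + 1/p)
    (hγode : ∀ x : ℝ, ((α+1)*p)⁻¹ < x →
      HasDerivAt γ
        ((-1 + ((α+1)*p)^p * (p-1) * (1 - γ x) * γ x * x^(p-2)) /
          (1 + ((α+1)*p)^p * (p-1) * (1 - γ x) * x^(p-1))) x)
    (hγinit : γ (((α+1)*p)⁻¹) = 1 - ((α+1)*p)⁻¹)
    (hγdiff : DifferentiableOn ℝ γ (Set.Ici (0:ℝ)))
    (hγmono : MonotoneOn γ (Set.Ici (0:ℝ)))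
    (hγconc : ConcaveOn ℝ (Set.Ici (0:ℝ)) γ)
    (hγlt : ∀ x : ℝ, 0 ≤ x → γ x < 1)
    (hh1 : ∀ x : ℝ, ((α+1)*p)⁻¹ ≤ x → h (x + γ x) = x)
    (hh2 : ∀ y : ℝ, 1 ≤ y → h y + γ (h y) = y)
    (hh3 : ∀ y : ℝ, 1 ≤ y → ((α+1)*p)⁻¹ ≤ h y)
    (hu0 : ∀ x y : ℝ, 0 ≤ x → |y| ≤ 1 → |y| ≤ γ x →
      u x y = 1 - ((α+1)*p)^p * x^p)
    (hu1 : ∀ x y : ℝ, 0 ≤ x → |y| ≤ 1 → γ x < |y| → x + |y| ≤ 1 →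
      u x y = 1 - ((p*x + p*|y| - 1)/(p-1))^(p-1) * (p*(p*(α+1)-1)*x - p*|y| + 1))
    (hu2 : ∀ x y : ℝ, 0 ≤ x → |y| ≤ 1 → γ x < |y| → 1 < x + |y| →
      u x y = 1 - ((α+1)*p)^p * (h (x+|y|))^(p-1) * (p*x - (p-1) * h (x+|y|)))
    (hU : ∀ x y z : ℝ, 0 ≤ x → 0 < z →
      U x y z = (max |y| z)^p * u (x / max |y| z) (y / max |y| z))
    :
    ContDiffOn ℝ 1 (fun q : ℝ × ℝ × ℝ => U q.1 q.2.1 q.2.2)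
      (Set.Ici (0:ℝ) ×ˢ (Set.univ ×ˢ Set.Ioi (0:ℝ))) ∧
    ∃ K : ℝ, ∀ x y z : ℝ, 0 ≤ x → 0 < z →
      U x y z ≤ K * (x + |y| + z)^p ∧
      derivWithin (fun t => U t y z) (Set.Ici (0:ℝ)) x ≤ K * (x + |y| + z)^(p-1) ∧
      |deriv (fun t => U x t z) y| ≤ K * (x + |y| + z)^(p-1) := by
  obtain ⟨g, g', hg, hg'c, hg'b, hkey, hmono, hgt, hgγ, hgl, hgh⟩ :=
    g_exists hα0 hp hγlin hγode hγinit hγmono hγlt hh1 hh2 hh3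
  have hp0 : 0 < p := by linarith
  have hp1 : 0 < p - 1 := by linarith
  have hα : 0 < α + 1 := by linarith
  have ha : 0 < (α+1)*p := by positivity
  have hx0 : 0 < ((α+1)*p)⁻¹ := by positivity
  have hA : 0 < ((α+1)*p)^p := Real.rpow_pos_of_pos ha p
  have hγ0 : γ 0 = 1 / p := by rw [hγlin 0 le_rfl hx0]; ring
  have hγp : ∀ X, 0 ≤ X → 1 / p ≤ γ X := fun X hX => by
    rw [← hγ0]; exact hγmono (show (0:ℝ) ≤ 0 from le_rfl) (show (0:ℝ) ≤ X from hX) hX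
  -- unified formula for u
  have huf : ∀ X Y : ℝ, 0 ≤ X → |Y| ≤ 1 →
      u X Y = 1 - ((α+1)*p)^p * phiF p X (max X (g (X + |Y|))) := by
    intro X Y hX hY
    rcases le_or_gt |Y| (γ X) with h0 | h0
    · have : g (X + |Y|) ≤ X := by
        conv_rhs => rw [← hgγ X hX]
        exact hmono (by linarith)
      rw [hu0 X Y hX hY h0, max_eq_left this, phiF_diag hp hX]
    · have hXg : X ≤ g (X + |Y|) := by
        conv_lhs => rw [← hgγ X hX]
        exact hmono (by linarith)
      rw [max_eq_right hXg]
      rcases le_or_gt (X + |Y|) 1 with h1 | h1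
      · rw [hu1 X Y hX hY h0 h1]
        have e1 : (p * X + p * |Y| - 1) / (p-1) = ((α+1)*p) * g (X + |Y|) := by
          rw [hgl _ h1]
          field_simp
        have e2 : p*(p*(α+1)-1)*X - p*|Y| + 1 =
            ((α+1)*p) * (p * X - (p-1) * g (X + |Y|)) := by
          have : (p-1) * (((α+1)*p) * g (X + |Y|)) = p * X + p * |Y| - 1 := by
            rw [← e1]; field_simp
          linear_combination this
        rw [e1, e2, Real.mul_rpow ha.le (hX.trans hXg), rpow_split2 hp ha.le]
        unfold phiF
        ring
      · rw [hu2 X Y hX hY h0 h1, hgh _ h1.le]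
        unfold phiF
        ring
  have hUf : ∀ x y z : ℝ, 0 ≤ x → 0 < z →
      U x y z = PhiF p (((α+1)*p)^p) g (Tmax (x, |y|, z)) := by
    intro x y z hx hz
    rw [hU x y z hx hz]
    have hM : 0 < max |y| z := lt_max_of_lt_right hz
    simp only [PhiF, muF, Tmax]
    set M := max |y| z with hMd
    have hX : 0 ≤ x / M := by positivity
    have hY : |y / M| = |y| / M := by rw [abs_div, abs_of_pos hM]
    rw [huf (x / M) (y / M) hX (by rw [hY, div_le_one hM]; exact le_max_left _ _), hY, ← add_div]
    have e : max x (M * g ((x + |y|) / M)) = M * max (x / M) (g ((x + |y|) / M)) := by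
      rw [mul_max_of_nonneg _ _ hM.le, mul_div_cancel₀ _ hM.ne']
    rw [e]
    have := phiF_hom (X := x / M) hp hM (le_max_of_le_left hX : 0 ≤ max (x / M) (g ((x + |y|) / M)))
    rw [mul_div_cancel₀ _ hM.ne'] at this
    rw [this]
    ring
  have hsmall : ∀ x y z : ℝ, 0 ≤ x → 0 < z → y < z / p → muF g (x, y, z) = x := by
    intro x y z hx hz hy
    apply max_eq_left
    have hX : 0 ≤ x / z := by positivity
    have h1 : g ((x + y) / z) ≤ x / z := by
      conv_rhs => rw [← hgγ _ hX]
      apply hmono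
      rw [add_div]
      have h2 : y / z ≤ 1 / p := by
        rw [div_le_iff₀ hz]
        have : 1 / p * z = z / p := by ring
        linarith
      linarith [hγp _ hX]
    have := mul_le_mul_of_nonneg_left h1 hz.le
    rwa [mul_div_cancel₀ _ hz.ne'] at this
  have hUG : ∀ x y z : ℝ, 0 ≤ x → 0 < z → -(z / p) < y →
      U x y z = PhiF p (((α+1)*p)^p) g (Tmax (x, y, z)) := by
    intro x y z hx hz hy
    rw [hUf x y z hx hz]
    rcases le_or_gt 0 y with h0 | h0
    · rw [abs_of_nonneg h0]
    · have hzp : z / p < z := by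
        rw [div_lt_iff₀ hp0]; nlinarith
      have hab : |y| < z / p := by rw [abs_of_neg h0]; linarith
      have e1 : Tmax (x, |y|, z) = (x, |y|, z) := by
        simp only [Tmax]; rw [max_eq_right (by linarith)]
      have e2 : Tmax (x, y, z) = (x, y, z) := by
        simp only [Tmax]; rw [max_eq_right (by linarith)]
      rw [e1, e2]
      unfold PhiF
      rw [hsmall x _ z hx hz hab, hsmall x y z hx hz (by linarith [div_pos hz hp0])]
  have hUneg : ∀ x y z : ℝ, 0 ≤ x → 0 < z → U x (-y) z = U x y z := by
    intro x y z hx hz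
    rw [hUf x _ z hx hz, hUf x _ z hx hz, abs_neg]
  set A := ((α+1)*p)^p with hAd
  have hGC := G_contDiff hp hg hg'c hkey
  have hev : ∀ q : ℝ × ℝ × ℝ, q ∈ dom3 → 0 ≤ q.2.1 →
      (fun q : ℝ × ℝ × ℝ => U q.1 q.2.1 q.2.2) =ᶠ[nhdsWithin q dom3]
        fun q => PhiF p A g (Tmax q) := by
    intro q hq hy
    have ho : ∀ᶠ q' : ℝ × ℝ × ℝ in nhds q, -(q'.2.2 / p) < q'.2.1 := by
      refine (isOpen_lt (f := fun q : ℝ × ℝ × ℝ => -(q.2.2 / p))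
        (g := fun q : ℝ × ℝ × ℝ => q.2.1) (by fun_prop) (by fun_prop)).mem_nhds ?_
      have : 0 < q.2.2 / p := div_pos hq.2.2 hp0
      show -(q.2.2 / p) < q.2.1
      linarith
    filter_upwards [nhdsWithin_le_nhds ho, self_mem_nhdsWithin] with q' h1 h2
    exact hUG _ _ _ h2.1 h2.2.2 h1
  have hpos : ∀ q : ℝ × ℝ × ℝ, q ∈ dom3 → 0 ≤ q.2.1 →
      ContDiffWithinAt ℝ 1 (fun q : ℝ × ℝ × ℝ => U q.1 q.2.1 q.2.2) dom3 q := by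
    intro q hq hy
    exact (hGC q hq).congr_of_eventuallyEq_of_mem (hev q hq hy) hq
  refine ⟨?_, 1 + A * p * (p-1), ?_⟩
  · intro q hq
    rcases le_or_gt 0 q.2.1 with hy | hy
    · exact hpos q hq hy
    · have h1 := hpos (q.1, -q.2.1, q.2.2) ⟨hq.1, trivial, hq.2.2⟩ (by simpa using hy.le)
      have h2 : ContDiffWithinAt ℝ 1 (fun q : ℝ × ℝ × ℝ => (q.1, -q.2.1, q.2.2)) dom3 q := by
        fun_prop
      have h3 := ContDiffWithinAt.comp q h1 h2
        (fun q' hq' => (⟨hq'.1, trivial, hq'.2.2⟩ : (q'.1, -q'.2.1, q'.2.2) ∈ dom3))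
      refine h3.congr_of_mem ?_ hq
      intro q' hq'
      exact (hUneg _ _ _ hq'.1 hq'.2.2).symm
  · have main : ∀ x y z : ℝ, 0 ≤ x → 0 ≤ y → 0 < z →
      U x y z ≤ (1 + A * p * (p-1)) * (x + y + z)^p ∧
      derivWithin (fun t => U t y z) (Set.Ici (0:ℝ)) x ≤
        (1 + A * p * (p-1)) * (x + y + z)^(p-1) ∧
      |deriv (fun t => U x t z) y| ≤ (1 + A * p * (p-1)) * (x + y + z)^(p-1) := by
      intro x y z hx hy hz
      have hq : (x, y, z) ∈ dom3 := ⟨hx, trivial, hz⟩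
      have hD : HasFDerivWithinAt (fun q : ℝ × ℝ × ℝ => U q.1 q.2.1 q.2.2)
          (PhiD p A g g' (Tmax (x, y, z))) dom3 (x, y, z) :=
        HasFDerivWithinAt.congr_of_eventuallyEq (G_hasFDeriv hp hg hkey hq) (hev _ hq hy)
          ((hev _ hq hy).self_of_nhdsWithin hq)
      obtain ⟨b1, b2, b3⟩ := bound_aux hp hA hg'b hgt hx hy hz
      have c1 : HasDerivWithinAt (fun t : ℝ => ((t, y, z) : ℝ × ℝ × ℝ)) (1, 0, 0)
          (Set.Ici (0:ℝ)) x :=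
        (hasDerivWithinAt_id x _).prodMk
          ((hasDerivWithinAt_const x _ y).prodMk (hasDerivWithinAt_const x _ z))
      have d1 : HasDerivWithinAt (fun t => U t y z) (PhiD p A g g' (Tmax (x, y, z)) (1, 0, 0))
          (Set.Ici (0:ℝ)) x :=
        HasFDerivWithinAt.comp_hasDerivWithinAt
          (l := fun q : ℝ × ℝ × ℝ => U q.1 q.2.1 q.2.2) (t := dom3) x hD c1 (fun t ht => ⟨ht, trivial, hz⟩)
      have c2 : HasDerivWithinAt (fun t : ℝ => ((x, t, z) : ℝ × ℝ × ℝ)) (0, 1, 0) Set.univ y :=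
        (hasDerivWithinAt_const y _ x).prodMk
          ((hasDerivWithinAt_id y _).prodMk (hasDerivWithinAt_const y _ z))
      have d2 : HasDerivWithinAt (fun t => U x t z) (PhiD p A g g' (Tmax (x, y, z)) (0, 1, 0))
          Set.univ y :=
        HasFDerivWithinAt.comp_hasDerivWithinAt
          (l := fun q : ℝ × ℝ × ℝ => U q.1 q.2.1 q.2.2) (t := dom3) y hD c2 (fun t _ => ⟨hx, trivial, hz⟩)
      rw [hasDerivWithinAt_univ] at d2
      rw [d1.derivWithin (uniqueDiffOn_Ici 0 x hx), d2.deriv, hUG x y z hx hz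
        (by linarith [div_pos hz hp0])]
      exact ⟨b1, b2, b3⟩
    intro x y z hx hz
    rcases le_or_gt 0 y with hy | hy
    · rw [abs_of_nonneg hy]; exact main x y z hx hy hz
    · obtain ⟨b1, b2, b3⟩ := main x (-y) z hx (by linarith) hz
      rw [abs_of_neg hy]
      refine ⟨?_, ?_, ?_⟩
      · rwa [hUneg x y z hx hz] at b1
      · rwa [derivWithin_congr (s := Set.Ici (0:ℝ)) (f := fun t => U t (-y) z)
          (f₁ := fun t => U t y z) (fun t ht => (hUneg t y z ht hz).symm) (hUneg x y z hx hz).symm]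
      · have e : (fun t => U x t z) = fun t => (fun s => U x s z) (-t) := by
          funext t; exact (hUneg x t z hx hz).symm
        rw [e, deriv_comp_neg (fun s => U x s z), abs_neg]
        exact b3
end

section
/- Fix α ∈ (0,1] and p ≥ 2 and let U be the Burkholder-type special function. Then for all x ≥ 0, y ∈ ℝ, z > 0: U(x,y,z) ≥ (|y| ∨ z)^p − ((α+1)p)^p·x^p. -/
theorem aux_young {p X s : ℝ} (hp : 2 ≤ p) (hX : 0 ≤ X) (hs : 0 < s) :
    s^(p-1) * (p*X - (p-1)*s) ≤ X^p := by
  have h1 : 1 + p * (X/s - 1) ≤ (1 + (X/s - 1))^p :=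
    one_add_mul_self_le_rpow_one_add (by have := div_nonneg hX hs.le; linarith) (by linarith)
  have e : 1 + (X/s - 1) = X/s := by ring
  rw [e, Real.div_rpow hX hs.le, le_div_iff₀ (Real.rpow_pos_of_pos hs p)] at h1
  have e2 : s^p = s^(p-1) * s := by
    rw [Real.rpow_sub_one hs.ne']; field_simp
  have e3 : (1 + p * (X/s - 1)) * s^p = s^(p-1) * (p*X - (p-1)*s) := by
    rw [e2]; field_simp; ring
  linarith

/-- The majorization property of the Burkholder-type special function:
`U(x,y,z) ≥ (|y| ∨ z)^p - ((α+1)p)^p x^p`. -/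
theorem special_function_majorization
    {α p : ℝ} (hα0 : 0 < α) (hα1 : α ≤ 1) (hp : 2 ≤ p)
    {γ h : ℝ → ℝ} {u : ℝ → ℝ → ℝ} {U : ℝ → ℝ → ℝ → ℝ}
    (hγlin : ∀ x : ℝ, 0 ≤ x → x < ((α+1)*p)⁻¹ → γ x = ((p-1)*(α+1)-1)*x + 1/p)
    (hγode : ∀ x : ℝ, ((α+1)*p)⁻¹ < x →
      HasDerivAt γ
        ((-1 + ((α+1)*p)^p * (p-1) * (1 - γ x) * γ x * x^(p-2)) /
          (1 + ((α+1)*p)^p * (p-1) * (1 - γ x) * x^(p-1))) x)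
    (hγinit : γ (((α+1)*p)⁻¹) = 1 - ((α+1)*p)⁻¹)
    (hγdiff : DifferentiableOn ℝ γ (Set.Ici (0:ℝ)))
    (hγmono : MonotoneOn γ (Set.Ici (0:ℝ)))
    (hγconc : ConcaveOn ℝ (Set.Ici (0:ℝ)) γ)
    (hγlt : ∀ x : ℝ, 0 ≤ x → γ x < 1)
    (hh1 : ∀ x : ℝ, ((α+1)*p)⁻¹ ≤ x → h (x + γ x) = x)
    (hh2 : ∀ y : ℝ, 1 ≤ y → h y + γ (h y) = y)
    (hh3 : ∀ y : ℝ, 1 ≤ y → ((α+1)*p)⁻¹ ≤ h y)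
    (hu0 : ∀ x y : ℝ, 0 ≤ x → |y| ≤ 1 → |y| ≤ γ x →
      u x y = 1 - ((α+1)*p)^p * x^p)
    (hu1 : ∀ x y : ℝ, 0 ≤ x → |y| ≤ 1 → γ x < |y| → x + |y| ≤ 1 →
      u x y = 1 - ((p*x + p*|y| - 1)/(p-1))^(p-1) * (p*(p*(α+1)-1)*x - p*|y| + 1))
    (hu2 : ∀ x y : ℝ, 0 ≤ x → |y| ≤ 1 → γ x < |y| → 1 < x + |y| →
      u x y = 1 - ((α+1)*p)^p * (h (x+|y|))^(p-1) * (p*x - (p-1) * h (x+|y|)))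
    (hU : ∀ x y z : ℝ, 0 ≤ x → 0 < z →
      U x y z = (max |y| z)^p * u (x / max |y| z) (y / max |y| z))
    :
    ∀ x y z : ℝ, 0 ≤ x → 0 < z →
      (max |y| z)^p - ((α+1)*p)^p * x^p ≤ U x y z := by
  have hp0 : 0 < p := by linarith
  have hc : 0 < (α+1)*p := by positivity
  have hci : 0 < ((α+1)*p)⁻¹ := by positivity
  have key : ∀ x y : ℝ, 0 ≤ x → |y| ≤ 1 → 1 - ((α+1)*p)^p * x^p ≤ u x y := by
    intro x y hx hy
    rcases le_or_gt |y| (γ x) with h0 | h0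
    · exact (hu0 x y hx hy h0).ge
    rcases le_or_gt (x + |y|) 1 with h1 | h1
    · rw [hu1 x y hx hy h0 h1]
      have g0 : γ 0 = 1/p := by rw [hγlin 0 le_rfl hci]; ring
      have g1 : γ 0 ≤ γ x := hγmono (Set.mem_Ici.2 le_rfl) (Set.mem_Ici.2 hx) hx
      have g2 : 1/p < |y| := by linarith
      have g3 : 1 < p * |y| := by rwa [div_lt_iff₀' hp0] at g2
      have hpx : 0 ≤ p * x := by positivity
      have hp1 : 0 < p - 1 := by linarith
      have hs : 0 < (p*x + p*|y| - 1)/(p-1) := div_pos (by linarith) hp1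
      have hY := aux_young hp (mul_nonneg hc.le hx) hs
      rw [Real.mul_rpow hc.le hx] at hY
      have e : p*(p*(α+1)-1)*x - p*|y| + 1
          = p*((α+1)*p*x) - (p-1)*((p*x + p*|y| - 1)/(p-1)) := by
        rw [mul_div_cancel₀ _ hp1.ne']; ring
      rw [e]; linarith
    · rw [hu2 x y hx hy h0 h1]
      have hs : 0 < h (x+|y|) := lt_of_lt_of_le hci (hh3 _ h1.le)
      have hY := mul_le_mul_of_nonneg_left (aux_young hp hx hs) (Real.rpow_nonneg hc.le p)
      rw [← mul_assoc] at hY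
      linarith
  intro x y z hx hz
  have hm : 0 < max |y| z := lt_max_of_lt_right hz
  rw [hU x y z hx hz]
  have hk := key (x / max |y| z) (y / max |y| z) (by positivity) (by
    rw [abs_div, abs_of_pos hm, div_le_one hm]; exact le_max_left _ _)
  have hmp := Real.rpow_pos_of_pos hm p
  have := mul_le_mul_of_nonneg_left hk hmp.le
  rw [Real.div_rpow hx hm.le] at this
  refine le_trans (le_of_eq ?_) this
  field_simp
end

section
/- Fix α ∈ (0,1] and p ≥ 2 and let U be the Burkholder-type special function. Then for every fixed y ∈ ℝ and z > 0 with |y| ≤ z, and every a ∈ [−1,1], the function Φ : [0,∞) → ℝ defined by Φ(t) = U(t, y + a·t, z) is concave. -/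
lemma sf_tangent {p X m : ℝ} (hp : 1 ≤ p) (hX : 0 ≤ X) (hm : 0 < m) :
    m^(p-1) * (p*X - (p-1)*m) ≤ X^p := by
  have h := one_add_mul_self_le_rpow_one_add (s := X/m - 1) (by have := div_nonneg hX hm.le; linarith) hp
  rw [show 1 + (X/m - 1) = X/m by ring, Real.div_rpow hX hm.le] at h
  have hmp : 0 < m^p := Real.rpow_pos_of_pos hm p
  rw [le_div_iff₀ hmp] at h
  have e : m^p = m^(p-1) * m := by
    rw [← Real.rpow_add_one hm.ne']; ring_nf
  refine le_trans (le_of_eq ?_) h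
  rw [e]; field_simp; ring

lemma sf_local_super {f : ℝ → ℝ} (hf : ContinuousOn f (Set.Ici 0))
    (hs : ∀ t0, 0 < t0 → ∃ m, ∀ᶠ t in nhds t0, f t ≤ f t0 + m * (t - t0)) :
    ConcaveOn ℝ (Set.Ici 0) f := by
  refine LinearOrder.concaveOn_of_lt (convex_Ici 0) ?_
  intro x hx y hy hxy a b ha hb hab
  simp only [smul_eq_mul]
  by_contra hcon
  push Not at hcon
  set k := (f y - f x)/(y - x) with hk
  have hyx : 0 < y - x := by linarith
  have hkk : k * (y - x) = f y - f x := by rw [hk]; field_simp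
  let F : ℝ → ℝ := fun t => f t - (f x + k * (t - x))
  have hx0 : (0:ℝ) ≤ x := hx
  have hF : ContinuousOn F (Set.Icc x y) := by
    refine ContinuousOn.sub (hf.mono ?_) (by fun_prop)
    intro t ht; exact le_trans hx0 ht.1
  have hc : a * x + b * y ∈ Set.Icc x y := by
    have : a = 1 - b := by linarith
    subst this
    constructor <;> nlinarith
  have hFc : F (a*x+b*y) < 0 := by
    have : a = 1 - b := by linarith
    subst this
    simp only [F]
    have : k * ((1-b)*x+b*y - x) = b * (f y - f x) := by rw [← hkk]; ring
    rw [this]; linarith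
  obtain ⟨t1, ht1, hmin⟩ := isCompact_Icc.exists_isMinOn ⟨_, hc⟩ hF
  have hFx : F x = 0 := by simp [F]
  have hFy : F y = 0 := by simp only [F]; linarith
  have h1 : F t1 < 0 := lt_of_le_of_lt (hmin hc) hFc
  let M := Set.Icc x y ∩ F ⁻¹' {F t1}
  have hMc : IsCompact M := by
    have := hF.preimage_isClosed_of_isClosed isClosed_Icc (isClosed_singleton (x := F t1))
    exact isCompact_Icc.of_isClosed_subset this Set.inter_subset_left
  have hMn : M.Nonempty := ⟨t1, ht1, rfl⟩
  obtain ⟨t2, ht2, hlow⟩ := hMc.exists_isLeast hMn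
  have hF2 : F t2 = F t1 := ht2.2
  have hxt : x < t2 := by
    rcases lt_or_eq_of_le ht2.1.1 with h | h
    · exact h
    · rw [← h, hFx] at hF2; linarith
  have hty : t2 < y := by
    rcases lt_or_eq_of_le ht2.1.2 with h | h
    · exact h
    · rw [h, hFy] at hF2; linarith
  obtain ⟨m, hm⟩ := hs t2 (by linarith)
  have hn : ∀ᶠ t in nhds t2, t ∈ Set.Ioo x y := Ioo_mem_nhds hxt hty
  obtain ⟨ε, hε, hball⟩ := Metric.eventually_nhds_iff.1 (hm.and hn)
  have hl := hball (y := t2 - ε/2) (by rw [Real.dist_eq, abs_lt]; constructor <;> linarith)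
  have hr := hball (y := t2 + ε/2) (by rw [Real.dist_eq, abs_lt]; constructor <;> linarith)
  have hl1 : F t1 < F (t2 - ε/2) := by
    refine lt_of_le_of_ne (hmin (Set.Ioo_subset_Icc_self hl.2)) ?_
    intro h
    have := hlow (a := t2 - ε/2) ⟨Set.Ioo_subset_Icc_self hl.2, h.symm⟩
    linarith
  have hr1 : F t1 ≤ F (t2 + ε/2) := hmin (Set.Ioo_subset_Icc_self hr.2)
  rw [← hF2] at hl1 hr1
  simp only [F] at hl1 hr1
  have a1 := hl.1
  have a2 := hr.1
  nlinarith

lemma sf_antitone {D : ℝ → ℝ} {S : Set ℝ} (hS : Convex ℝ S) (c : ℝ)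
    (hD : ContinuousOn D S) (hd : ∀ s ∈ S, s ≠ c → ∃ d ≤ 0, HasDerivAt D d s) : AntitoneOn D S := by
  have key : ∀ u ∈ S, ∀ v ∈ S, u < v → c ∉ Set.Ioo u v → D v ≤ D u := by
    intro u hu v hv huv hc
    have hsub : Set.Icc u v ⊆ S := hS.ordConnected.out hu hv
    obtain ⟨x, hx, he⟩ := exists_deriv_eq_slope D huv (hD.mono hsub) (by
      intro x hx
      obtain ⟨d, _, h⟩ := hd x (hsub (Set.Ioo_subset_Icc_self hx)) (by rintro rfl; exact hc hx)
      exact h.differentiableAt.differentiableWithinAt)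
    obtain ⟨d, h0, h⟩ := hd x (hsub (Set.Ioo_subset_Icc_self hx)) (by rintro rfl; exact hc hx)
    rw [h.deriv, eq_div_iff (by linarith)] at he
    nlinarith
  intro u hu v hv huv
  rcases eq_or_lt_of_le huv with rfl | huv
  · exact le_rfl
  by_cases hc : c ∈ Set.Ioo u v
  · have hcS : c ∈ S := hS.ordConnected.out hu hv (Set.Ioo_subset_Icc_self hc)
    have h1 := key u hu c hcS hc.1 (by simp)
    have h2 := key c hcS v hv hc.2 (by simp)
    linarith
  · exact key u hu v hv huv hc

lemma sf_super {g D : ℝ → ℝ} {S : Set ℝ} (hS : Convex ℝ S) (c : ℝ)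
    (hg : ∀ s ∈ S, HasDerivAt g (D s) s)
    (hD : ContinuousOn D S) (hd : ∀ s ∈ S, s ≠ c → ∃ d ≤ 0, HasDerivAt D d s)
    {u v : ℝ} (hu : u ∈ S) (hv : v ∈ S) : g v ≤ g u + D u * (v - u) := by
  have ha := sf_antitone hS c hD hd
  have hgc : ContinuousOn g S := fun s hs => (hg s hs).continuousAt.continuousWithinAt
  rcases lt_trichotomy u v with h | h | h
  · have hsub : Set.Icc u v ⊆ S := hS.ordConnected.out hu hv
    obtain ⟨x, hx, he⟩ := exists_hasDerivAt_eq_slope g D h (hgc.mono hsub)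
      (fun x hx => hg x (hsub (Set.Ioo_subset_Icc_self hx)))
    have := ha hu (hsub (Set.Ioo_subset_Icc_self hx)) hx.1.le
    rw [eq_div_iff (by linarith)] at he
    nlinarith
  · subst h; simp
  · have hsub : Set.Icc v u ⊆ S := hS.ordConnected.out hv hu
    obtain ⟨x, hx, he⟩ := exists_hasDerivAt_eq_slope g D h (hgc.mono hsub)
      (fun x hx => hg x (hsub (Set.Ioo_subset_Icc_self hx)))
    have := ha (hsub (Set.Ioo_subset_Icc_self hx)) hu hx.2.le
    rw [eq_div_iff (by linarith)] at he
    nlinarith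

lemma sf_inside {p K : ℝ} (hp : 2 ≤ p) (hK : 0 < K) {η e : ℝ → ℝ}
    (hη : ∀ s, HasDerivAt η (e s) s) (hpos : ∀ s, 1/p < s → 0 < η s) (hec : Continuous e)
    (he0 : ∀ s, 0 < e s)
    (hB : ∀ s, 1/p < s → s ≠ 1 → ∃ e2, HasDerivAt e e2 s ∧ ∀ X, 0 ≤ X → s - X ≤ 1 →
      ((p-2)*(e s)^2/η s + e2)*(η s - X) ≤ e s - e s^2)
    {x Y a t : ℝ} (ha1 : -1 ≤ a) (ha2 : a ≤ 1) (hx : 0 ≤ x) (hxt : 0 ≤ x + t)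
    (hs : 1/p < x + Y) (hst : 1/p < x + t + (Y + a*t)) (hY : Y ≤ 1) (hYt : Y + a*t ≤ 1) :
    1 - K*(η (x+t+(Y+a*t))^(p-1)*(p*(x+t)-(p-1)*η (x+t+(Y+a*t)))) ≤
      1 - K*(η (x+Y)^(p-1)*(p*x-(p-1)*η (x+Y))) +
      (-K*(p*η (x+Y)^(p-1) + (1+a)*(p*(p-1)*(η (x+Y)^(p-2)*e (x+Y)))*(x-η (x+Y)))) * t := by
  let σ : ℝ → ℝ := fun τ => x+τ+(Y+a*τ)
  let g : ℝ → ℝ := fun τ => 1 - K*(η (σ τ)^(p-1)*(p*(x+τ)-(p-1)*η (σ τ)))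
  let D : ℝ → ℝ := fun τ =>
    -K*(p*η (σ τ)^(p-1) + (1+a)*(p*(p-1)*(η (σ τ)^(p-2)*e (σ τ)))*(x+τ-η (σ τ)))
  let S : Set ℝ := {τ | 0 ≤ x + τ ∧ 1/p < σ τ ∧ Y + a*τ ≤ 1}
  have hσ : ∀ τ, HasDerivAt σ (1+a) τ := by
    intro τ
    have := ((hasDerivAt_id τ).const_add x).add (((hasDerivAt_id τ).const_mul a).const_add Y)
    refine (this.congr_deriv (by simp)).congr_of_eventuallyEq (Filter.Eventually.of_forall fun v => ?_)
    simp [σ]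
  have hS : Convex ℝ S := by
    intro u hu v hv c d hc hd hcd
    obtain ⟨h1, h2, h3⟩ := hu
    obtain ⟨h4, h5, h6⟩ := hv
    have : d = 1 - c := by linarith
    subst this
    simp only [S, σ, Set.mem_ofPred_eq, smul_eq_mul] at *
    refine ⟨by nlinarith, ?_, by nlinarith⟩
    rcases eq_or_lt_of_le hc with rfl | hc'
    · linarith
    · nlinarith [mul_lt_mul_of_pos_left h2 hc', mul_le_mul_of_nonneg_left h5.le hd]
  have hησ : ∀ τ, HasDerivAt (fun τ => η (σ τ)) (e (σ τ) * (1+a)) τ := fun τ =>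
    (hη (σ τ)).comp τ (hσ τ)
  have hg : ∀ τ ∈ S, HasDerivAt g (D τ) τ := by
    intro τ hτ
    have hp0 := hpos _ hτ.2.1
    have h1 := (hησ τ).rpow_const (p := p-1) (Or.inl hp0.ne')
    have h2 := (((hasDerivAt_id τ).const_add x).const_mul p).sub ((hησ τ).const_mul (p-1))
    have h3 := ((h1.mul h2).const_mul K).const_sub 1
    refine h3.congr_deriv ?_
    have e1 : η (σ τ)^(p-1) = η (σ τ)^(p-2) * η (σ τ) := by
      rw [← Real.rpow_add_one hp0.ne']; ring_nf
    simp only [D, id, Pi.sub_apply, show p-1-1 = p-2 by ring, e1]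
    ring
  have hDc : ContinuousOn D S := by
    intro τ hτ
    have hp0 := hpos _ hτ.2.1
    apply ContinuousAt.continuousWithinAt
    have c1 : ContinuousAt (fun τ => η (σ τ)) τ := (hησ τ).continuousAt
    have c2 : ContinuousAt (fun τ => e (σ τ)) τ := hec.continuousAt.comp (hσ τ).continuousAt
    have c3 := c1.rpow_const (p := p-1) (Or.inl hp0.ne')
    have c4 := c1.rpow_const (p := p-2) (Or.inl hp0.ne')
    have c5 : ContinuousAt (fun τ => x + τ) τ := by fun_prop
    exact continuousAt_const.mul ((continuousAt_const.mul c3).add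
      ((continuousAt_const.mul (continuousAt_const.mul (c4.mul c2))).mul (c5.sub c1)))
  have hd : ∀ s ∈ S, s ≠ (1 - (x+Y))/(1+a) → ∃ d ≤ 0, HasDerivAt D d s := by
    intro τ hτ hne
    have hp0 := hpos _ hτ.2.1
    rcases eq_or_lt_of_le ha1 with rfl | ha
    · refine ⟨0, le_rfl, ?_⟩
      have : D = fun _ => D τ := by
        funext v
        simp only [D, σ]
        ring_nf
      rw [this]; exact hasDerivAt_const _ _
    have hs1 : σ τ ≠ 1 := by
      intro h
      apply hne
      rw [eq_div_iff (by linarith)]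
      simp only [σ] at h
      linarith
    obtain ⟨e2, he2, hb⟩ := hB _ hτ.2.1 hs1
    have hb := hb (x+τ) hτ.1 (by have := hτ.2.2; simp only [σ]; linarith)
    have h1 := (hησ τ).rpow_const (p := p-1) (Or.inl hp0.ne')
    have h2 := (hησ τ).rpow_const (p := p-2) (Or.inl hp0.ne')
    have h3 : HasDerivAt (fun τ => e (σ τ)) (e2 * (1+a)) τ := he2.comp τ (hσ τ)
    have h4 := ((hasDerivAt_id τ).const_add x).sub (hησ τ)
    have h5 := ((h1.const_mul p).add (((((h2.mul h3).const_mul (p*(p-1))).const_mul (1+a))).mul h4)).const_mul (-K)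
    refine ⟨_, ?_, h5⟩
    have e1 : η (σ τ)^(p-2-1) = η (σ τ)^(p-2) / η (σ τ) := by
      rw [Real.rpow_sub_one hp0.ne']
    have hA : 0 < η (σ τ)^(p-2) := Real.rpow_pos_of_pos hp0 _
    have hee := he0 (σ τ)
    simp only [id, e1, show p-1-1 = p-2 by ring]
    set A := η (σ τ)^(p-2)
    set E := e (σ τ)
    set n := η (σ τ)
    set X := x + τ
    have key : 0 ≤ K * p * (p-1) * A * (1+a) *
       (2*E - (1+a)*E^2 - (1+a)*(((p-2)*E^2/n + e2)*(n - X))) := by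
      have : 0 ≤ K * p * (p-1) * A * (1+a) := by
        have : 0 ≤ p - 1 := by linarith
        have : 0 ≤ 1 + a := by linarith
        positivity
      refine mul_nonneg this ?_
      have := mul_le_mul_of_nonneg_left hb (show 0 ≤ 1 + a by linarith)
      nlinarith
    refine le_trans (le_of_eq ?_) (neg_nonpos.2 key)
    simp only [Pi.mul_apply, Pi.sub_apply]
    field_simp
    ring
  have h0 : (0:ℝ) ∈ S := by
    refine ⟨by linarith, ?_, by linarith⟩
    simp only [σ]; linarith
  have ht : t ∈ S := ⟨hxt, hst, hYt⟩
  have := sf_super hS _ hg hDc hd h0 ht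
  simpa [g, D, σ] using this


lemma sf_alg1 {p K a A B E N R y : ℝ} (hR : 1 + R ≠ 0) (hy : y ≠ 0)
    (ho : K*(p-1)*(N-R)*A*E*(1+R) = 1+K*(p-1)*(N-R)*(A*N)) :
    a*p*B*(1-K*((A*N)*(p*R-(p-1)*N))) + B*y*-(K*(E*((1-a*R)/y)*(p-1)*A*(p*R-(p-1)*N)
      + A*N*(p*((1-a*R)/y)-(p-1)*(E*((1-a*R)/y)))))
    = B*((1+a)*(p*(1+K*(p-1)*(N-R)*(A*N))/(1+R)) - K*p*(A*N)) := by
  have hψ : p*(1+K*(p-1)*(N-R)*(A*N))/(1+R) = p*(K*(p-1)*(N-R)*A*E) := by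
    rw [← ho]; field_simp
  rw [hψ]
  have h1 : ∀ z, B*y*-(K*(E*((1-a*R)/y)*(p-1)*A*z
      + A*N*(p*((1-a*R)/y)-(p-1)*(E*((1-a*R)/y))))) =
      -B*(K*(E*(1-a*R)*(p-1)*A*z + A*N*(p*(1-a*R)-(p-1)*(E*(1-a*R))))) := by
    intro z; field_simp
  rw [h1]
  linear_combination (-(a*p*B))*ho

lemma sf_alg2 {p K a A B E N R y : ℝ} (hp : 2 ≤ p) (hK : 0 < K) (ha0 : 0 ≤ a) (ha1 : a ≤ 1)
    (hR : 0 < 1 + R) (hy : y ≠ 0) (hA : 0 < A) (hB : 0 < B) (hE : 0 < E)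
    (hw1 : N - R ≤ 1/p) (hw0 : 0 < N - R)
    (hst : (p-2)*(N-R)*E ≤ (1-E)*N) (hra : a^2*R ≤ 1 + 2*a)
    (ho : K*(p-1)*(N-R)*A*E*(1+R) = 1+K*(p-1)*(N-R)*(A*N)) :
    a*(p-1)*B*((1+a)*(p*(1+K*(p-1)*(N-R)*(A*N))/(1+R)) - K*p*(A*N))
      + B*y*((1+a)*((p*(K*(p-1)*(E*((1-a*R)/y)-(1-a*R)/y)*(A*N)
        + K*(p-1)*(N-R)*(E*((1-a*R)/y)*(p-1)*A))*(1+R)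
         - p*(1+K*(p-1)*(N-R)*(A*N))*((1-a*R)/y))/(1+R)^2) - K*p*(E*((1-a*R)/y)*(p-1)*A)) ≤ 0 := by
  have key : B*p*K*(p-1)*A*(E*((p-1)*a^2*(N-R)-1)
     - ((1-E)*N-(p-2)*(N-R)*E)*(1+2*a-a^2*R)/(1+R)) ≤ 0 := by
    have h1 : 0 ≤ B*p*K*(p-1)*A := by
      have : 0 ≤ p - 1 := by linarith
      positivity
    refine mul_nonpos_of_nonneg_of_nonpos h1 ?_
    have h2 : 0 ≤ ((1-E)*N-(p-2)*(N-R)*E)*(1+2*a-a^2*R)/(1+R) :=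
      div_nonneg (mul_nonneg (by linarith) (by linarith)) hR.le
    have h3 : (p-1)*a^2*(N-R) ≤ 1 := by
      rw [le_div_iff₀ (by linarith)] at hw1
      have : a^2 ≤ 1 := by nlinarith
      have h4 : (p-1)*(N-R)*a^2 ≤ (p-1)*(N-R)*1 :=
        mul_le_mul_of_nonneg_left this (mul_nonneg (by linarith) hw0.le)
      nlinarith
    nlinarith
  refine le_trans (le_of_eq ?_) key
  rw [← ho]
  field_simp
  ring
lemma sf_outside {p K : ℝ} (hp : 2 ≤ p) (hK : 0 < K) {η e : ℝ → ℝ}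
    (hη : ∀ s, HasDerivAt η (e s) s) (hpos : ∀ s, 1 < s → 0 < η s)
    (hw : ∀ s, 1 < s → 0 < η s - (s-1)) (hw2 : ∀ s, 1 < s → η s - (s-1) ≤ 1/p)
    (he0 : ∀ s, 0 < e s)
    (hode : ∀ s, 1 < s → K*(p-1)*(η s - (s-1))*η s^(p-2)*e s * s
      = 1 + K*(p-1)*(η s - (s-1))*η s^(p-1))
    (hstar : ∀ s, 1 < s → (p-2)*(η s - (s-1))*e s ≤ (1 - e s)*η s)
    {x Y a t : ℝ} (ha1 : 0 ≤ a) (ha2 : a ≤ 1) (hx : 0 < x) (hxt : 0 < x + t)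
    (hY : 0 < Y) (hYt : 0 < Y + a*t) (hc : a^2*x ≤ (1+2*a)*Y)
    (hct : a^2*(x+t) ≤ (1+2*a)*(Y+a*t)) :
    (Y+a*t)^p*(1 - K*(η (1+(x+t)/(Y+a*t))^(p-1)*(p*((x+t)/(Y+a*t))-(p-1)*η (1+(x+t)/(Y+a*t))))) ≤
      Y^p*(1 - K*(η (1+x/Y)^(p-1)*(p*(x/Y)-(p-1)*η (1+x/Y)))) +
      (Y^(p-1)*((1+a)*(p*(1+K*(p-1)*(η (1+x/Y) - x/Y)*η (1+x/Y)^(p-1))/(1+x/Y))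
        - K*p*η (1+x/Y)^(p-1))) * t := by
  let r : ℝ → ℝ := fun τ => (x+τ)/(Y+a*τ)
  let n : ℝ → ℝ := fun τ => η (1+r τ)
  let g : ℝ → ℝ := fun τ => (Y+a*τ)^p*(1 - K*(n τ^(p-1)*(p*r τ-(p-1)*n τ)))
  let D : ℝ → ℝ := fun τ => (Y+a*τ)^(p-1)*
    ((1+a)*(p*(1+K*(p-1)*(n τ - r τ)*n τ^(p-1))/(1+r τ)) - K*p*n τ^(p-1))
  let S : Set ℝ := {τ | 0 < x + τ ∧ 0 < Y + a*τ ∧ a^2*(x+τ) ≤ (1+2*a)*(Y+a*τ)}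
  have hS : Convex ℝ S := by
    intro u hu v hv c d hc hd hcd
    obtain ⟨h1, h2, h3⟩ := hu
    obtain ⟨h4, h5, h6⟩ := hv
    have : d = 1 - c := by linarith
    subst this
    simp only [S, Set.mem_ofPred_eq, smul_eq_mul] at *
    refine ⟨?_, ?_, ?_⟩
    · rcases eq_or_lt_of_le hc with rfl | hc'
      · linarith
      · nlinarith [mul_lt_mul_of_pos_left h1 hc', mul_le_mul_of_nonneg_left h4.le hd]
    · rcases eq_or_lt_of_le hc with rfl | hc'
      · linarith
      · nlinarith [mul_lt_mul_of_pos_left h2 hc', mul_le_mul_of_nonneg_left h5.le hd]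
    · have := mul_le_mul_of_nonneg_left h3 hc
      have := mul_le_mul_of_nonneg_left h6 hd
      linarith
  have hyd : ∀ τ, HasDerivAt (fun τ => Y + a*τ) a τ := fun τ => by
    simpa using ((hasDerivAt_id τ).const_mul a).const_add Y
  have hr : ∀ τ ∈ S, HasDerivAt r ((1 - a * r τ)/(Y+a*τ)) τ := by
    intro τ hτ
    have hy := hτ.2.1
    refine (((hasDerivAt_id τ).const_add x).div (hyd τ) hy.ne').congr_deriv ?_
    simp only [r, id]
    field_simp
  have hn : ∀ τ ∈ S, HasDerivAt n (e (1+r τ) * ((1 - a * r τ)/(Y+a*τ))) τ := fun τ hτ =>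
    (hη (1+r τ)).comp τ ((hr τ hτ).const_add 1)
  have hrpos : ∀ τ ∈ S, 0 < r τ := fun τ hτ => div_pos hτ.1 hτ.2.1
  have hg : ∀ τ ∈ S, HasDerivAt g (D τ) τ := by
    intro τ hτ
    have hr0 := hrpos τ hτ
    have hy := hτ.2.1
    have hs1 : 1 < 1 + r τ := by linarith
    have hn0 : 0 < n τ := hpos _ hs1
    have h1 := (hn τ hτ).rpow_const (p := p-1) (Or.inl hn0.ne')
    have h2 := ((hr τ hτ).const_mul p).sub ((hn τ hτ).const_mul (p-1))
    have h3 := ((h1.mul h2).const_mul K).const_sub 1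
    have h4 := ((hyd τ).rpow_const (p := p) (Or.inl hy.ne')).mul h3
    refine h4.congr_deriv ?_
    have e1 : n τ^(p-1) = n τ^(p-2) * n τ := by
      rw [← Real.rpow_add_one hn0.ne']; ring_nf
    have e2 : (Y+a*τ)^p = (Y+a*τ)^(p-1)*(Y+a*τ) := by
      rw [← Real.rpow_add_one hy.ne']; ring_nf
    have ho := hode _ hs1
    have ho : K*(p-1)*(n τ - r τ)*n τ^(p-2)*e (1+r τ)*(1+r τ) = 1 + K*(p-1)*(n τ - r τ)*(n τ^(p-2)*n τ) := by
      rw [← e1]; simpa [n] using ho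
    simp only [D, Pi.mul_apply, Pi.sub_apply, Pi.div_apply, show p-1-1 = p-2 by ring, e1, e2]
    exact sf_alg1 (by linarith) hy.ne' ho
  have hd : ∀ τ ∈ S, ∃ d ≤ 0, HasDerivAt D d τ := by
    intro τ hτ
    have hr0 := hrpos τ hτ
    have hy := hτ.2.1
    have hs1 : 1 < 1 + r τ := by linarith
    have hn0 : 0 < n τ := hpos _ hs1
    have hw0 := hw _ hs1
    have hw1 := hw2 _ hs1
    have hst := hstar _ hs1
    have h1 := (hn τ hτ).rpow_const (p := p-1) (Or.inl hn0.ne')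
    have h2 := ((((hn τ hτ).sub (hr τ hτ)).const_mul (K*(p-1))).mul h1).const_add 1
    have h3 := (h2.const_mul p).div ((hr τ hτ).const_add 1) (by linarith)
    have h4 := (h3.const_mul (1+a)).sub (h1.const_mul (K*p))
    have h5 := ((hyd τ).rpow_const (p := p-1) (Or.inl hy.ne')).mul h4
    refine ⟨_, ?_, h5⟩
    have e1 : n τ^(p-1) = n τ^(p-2) * n τ := by
      rw [← Real.rpow_add_one hn0.ne']; ring_nf
    have e2 : (Y+a*τ)^(p-1) = (Y+a*τ)^(p-2)*(Y+a*τ) := by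
      rw [← Real.rpow_add_one hy.ne']; ring_nf
    have ho := hode _ hs1
    have ho : K*(p-1)*(n τ - r τ)*n τ^(p-2)*e (1+r τ)*(1+r τ) = 1 + K*(p-1)*(n τ - r τ)*(n τ^(p-2)*n τ) := by
      rw [← e1]; simpa [n] using ho
    have hee := he0 (1 + r τ)
    have hA : 0 < n τ^(p-2) := Real.rpow_pos_of_pos hn0 _
    have hBp : 0 < (Y+a*τ)^(p-2) := Real.rpow_pos_of_pos hy _
    have hra : a^2 * r τ ≤ 1 + 2*a := by
      simp only [r]
      rw [← mul_div_assoc, div_le_iff₀ hy]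
      exact hτ.2.2
    simp only [Pi.mul_apply, Pi.sub_apply, Pi.div_apply, show p-1-1 = p-2 by ring, e1, e2]
    change 0 < n τ - (1 + r τ - 1) at hw0
    change n τ - (1 + r τ - 1) ≤ 1/p at hw1
    change (p-2)*(n τ - (1 + r τ - 1))*e (1+r τ) ≤ (1 - e (1+r τ))*n τ at hst
    rw [show 1 + r τ - 1 = r τ by ring] at hw0 hw1 hst
    exact sf_alg2 hp hK ha1 ha2 (by linarith) hy.ne' hA hBp hee hw1 hw0 hst hra ho
  have hDc : ContinuousOn D S := fun τ hτ => by
    obtain ⟨d, _, h⟩ := hd τ hτ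
    exact h.continuousAt.continuousWithinAt
  have h0 : (0:ℝ) ∈ S := ⟨by linarith, by linarith, by linarith⟩
  have ht : t ∈ S := ⟨hxt, hYt, hct⟩
  have := sf_super hS 0 hg hDc (fun s hs _ => hd s hs) h0 ht
  simpa [g, D, n, r] using this

lemma sf_alg3 {p C w A n e s : ℝ} (hC : C ≠ 0) (hw : w ≠ 0) (hA : A ≠ 0) (hn : n ≠ 0) (hs : s ≠ 0)
    (ho : C*w*A*e*s = 1 + C*w*(A*n)) :
    ((C*(e-1)*(A*n) + C*w*(e*(p-1)*A))*(C*w*A*s)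
      - (1+C*w*(A*n))*((C*(e-1)*A + C*w*(e*(p-2)*(A/n)))*s + C*w*A))/(C*w*A*s)^2
    = (e*s-n)/(w*s)*((1-e) - (p-2)*w*e/n) := by
  rw [← ho]
  field_simp
  ring

lemma sf_alg4 {p w n e s X C A : ℝ} (hp : 2 ≤ p) (hw : 0 < w) (hn : 0 < n) (he : 0 < e) (hs : 0 < s)
    (hC : 0 < C) (hA : 0 < A) (ho : C*w*A*e*s = 1 + C*w*(A*n))
    (h2 : 0 ≤ (e*s-n)/(w*s)*((1-e) - (p-2)*w*e/n)) :
    (p-2)*w*e ≤ (1-e)*n ∧ (n - X ≤ w →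
    ((p-2)*e^2/n + (e*s-n)/(w*s)*((1-e) - (p-2)*w*e/n))*(n-X) ≤ e - e^2) := by
  have hq : 0 < e*s - n := by
    have h1 : C*w*A*(e*s-n) = 1 := by linear_combination ho
    have : 0 < C*w*A := by positivity
    by_contra hcon
    push Not at hcon
    nlinarith
  have hq' : 0 < (e*s-n)/(w*s) := by positivity
  have hδ : 0 ≤ (1-e) - (p-2)*w*e/n := by
    by_contra hcon
    push Not at hcon
    nlinarith
  have hs' : (p-2)*w*e/n ≤ 1 - e := by linarith
  have hst := (div_le_iff₀ hn).1 hs'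
  refine ⟨hst, fun hX => ?_⟩
  have hp2 : 0 ≤ p - 2 := by linarith
  have hN : 0 ≤ (p-2)*e^2/n + (e*s-n)/(w*s)*((1-e) - (p-2)*w*e/n) := by positivity
  refine le_trans (mul_le_mul_of_nonneg_left hX hN) ?_
  have hqw : (e*s-n)/(w*s)*w ≤ e := by
    rw [div_mul_eq_mul_div, div_le_iff₀ (by positivity)]
    nlinarith [mul_pos hn hw]
  set q := (e*s-n)/(w*s)
  set δ := (1-e) - (p-2)*w*e/n with hd
  have h3 : (p-2)*e^2/n*w = e*((1-e) - δ) := by rw [hd]; field_simp; ring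
  nlinarith [mul_le_mul_of_nonneg_right hqw hδ]

lemma sf_exists {α p : ℝ} (hα0 : 0 < α) (hp : 2 ≤ p) {γ h : ℝ → ℝ}
    (hγlin : ∀ x : ℝ, 0 ≤ x → x < ((α+1)*p)⁻¹ → γ x = ((p-1)*(α+1)-1)*x + 1/p)
    (hγode : ∀ x : ℝ, ((α+1)*p)⁻¹ < x →
      HasDerivAt γ
        ((-1 + ((α+1)*p)^p * (p-1) * (1 - γ x) * γ x * x^(p-2)) /
          (1 + ((α+1)*p)^p * (p-1) * (1 - γ x) * x^(p-1))) x)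
    (hγinit : γ (((α+1)*p)⁻¹) = 1 - ((α+1)*p)⁻¹)
    (hγmono : MonotoneOn γ (Set.Ici (0:ℝ)))
    (hγconc : ConcaveOn ℝ (Set.Ici (0:ℝ)) γ)
    (hγlt : ∀ x : ℝ, 0 ≤ x → γ x < 1)
    (hh1 : ∀ x : ℝ, ((α+1)*p)⁻¹ ≤ x → h (x + γ x) = x)
    (hh2 : ∀ y : ℝ, 1 ≤ y → h y + γ (h y) = y)
    (hh3 : ∀ y : ℝ, 1 ≤ y → ((α+1)*p)⁻¹ ≤ h y) :
    ∃ η e : ℝ → ℝ,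
      (∀ s, HasDerivAt η (e s) s) ∧ (∀ s, 1/p < s → 0 < η s) ∧ Continuous e ∧ (∀ s, 0 < e s) ∧
      (∀ s, 1/p < s → s ≠ 1 → ∃ e2, HasDerivAt e e2 s ∧ ∀ X, 0 ≤ X → s - X ≤ 1 →
        ((p-2)*(e s)^2/η s + e2)*(η s - X) ≤ e s - e s^2) ∧
      (∀ s, 1 < s → 0 < η s - (s-1)) ∧ (∀ s, 1 < s → η s - (s-1) ≤ 1/p) ∧
      (∀ s, 1 < s → ((α+1)*p)^p*(p-1)*(η s - (s-1))*η s^(p-2)*e s * s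
        = 1 + ((α+1)*p)^p*(p-1)*(η s - (s-1))*η s^(p-1)) ∧
      (∀ s, 1 < s → (p-2)*(η s - (s-1))*e s ≤ (1 - e s)*η s) ∧
      (∀ s, 1 ≤ s → η s = h s) ∧ (∀ s, s ≤ 1 → η s = (p*s-1)/(p-1)*((α+1)*p)⁻¹) ∧
      (∀ x, 0 ≤ x → η (x + γ x) = x) := by
  have hκp : 0 < (α+1)*p := by positivity
  have hK : 0 < ((α+1)*p)^p := Real.rpow_pos_of_pos hκp p
  have hx0 : 0 < ((α+1)*p)⁻¹ := by positivity
  have hKx : ((α+1)*p)^p * (((α+1)*p)⁻¹)^p = 1 := by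
    rw [← Real.mul_rpow hκp.le hx0.le, mul_inv_cancel₀ hκp.ne', Real.one_rpow]
  have hx0p : ((α+1)*p)⁻¹ ≤ 1/p := by
    rw [one_div]; apply inv_anti₀ <;> nlinarith
  have hx0κ : ((α+1)*p)⁻¹ * ((α+1)*p) = 1 := inv_mul_cancel₀ hκp.ne'
  set K := ((α+1)*p)^p with hKdef
  set x0 := ((α+1)*p)⁻¹ with hx0def
  have hp1 : 0 < p - 1 := by linarith
  have hp0 : 0 < p := by linarith
  have hC : 0 < K*(p-1) := by positivity
  have hh10 : h 1 = x0 := by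
    have := hh1 x0 le_rfl
    rwa [hγinit, show x0 + (1 - x0) = 1 by ring] at this
  have hγh : ∀ s, 1 ≤ s → γ (h s) = s - h s := fun s hs => by have := hh2 s hs; linarith
  have hhpos : ∀ s, 1 ≤ s → 0 < h s := fun s hs => lt_of_lt_of_le hx0 (hh3 s hs)
  have hmono : ∀ s t, 1 ≤ s → s ≤ t → h s ≤ h t := by
    intro s t hs hst
    by_contra hcon
    push Not at hcon
    have := hγmono (hhpos t (by linarith)).le (hhpos s hs).le hcon.le
    rw [hγh s hs, hγh t (by linarith)] at this
    linarith
  have hlip : ∀ s t, 1 ≤ s → s ≤ t → h t - h s ≤ t - s := by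
    intro s t hs hst
    have := hγmono (hhpos s hs).le (hhpos t (by linarith)).le (hmono s t hs hst)
    rw [hγh s hs, hγh t (by linarith)] at this
    linarith
  have hhc : Continuous (fun s => h (max s 1)) := by
    have hl : LipschitzWith 1 (fun s => h (max s 1)) := by
      refine LipschitzWith.of_le_add ?_
      intro s t
      rcases le_total s t with hst | hst
      · have := hmono (max s 1) (max t 1) (le_max_right _ _) (max_le_max_right 1 hst)
        have := dist_nonneg (x := s) (y := t)
        linarith
      · have h1 := hlip (max t 1) (max s 1) (le_max_right _ _) (max_le_max_right 1 hst)
        have h2 : max s 1 - max t 1 ≤ s - t := by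
          rcases max_cases s 1 with h | h <;> rcases max_cases t 1 with h' | h' <;> linarith
        have h3 : s - t ≤ dist s t := by rw [Real.dist_eq]; exact le_abs_self _
        linarith
    exact hl.continuous
  have hw0 : ∀ s, 1 ≤ s → 0 < h s - (s-1) := fun s hs => by
    have := hγlt (h s) (hhpos s hs).le
    rw [hγh s hs] at this; linarith
  have hw1 : ∀ s, 1 ≤ s → h s - (s-1) ≤ x0 := fun s hs => by
    have := hγmono hx0.le (hhpos s hs).le (hh3 s hs)
    rw [hγh s hs, hγinit] at this; linarith
  let eh : ℝ → ℝ := fun s => (1 + K*(p-1)*(h s - (s-1))*h s^(p-1))/(K*(p-1)*(h s - (s-1))*h s^(p-2)*s)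
  let η : ℝ → ℝ := fun s => (p*min s 1 - 1)/(p-1)*x0 + h (max s 1) - x0
  let e : ℝ → ℝ := fun s => eh (max s 1)
  have hη1 : ∀ s, 1 ≤ s → η s = h s := by
    intro s hs
    simp only [η, min_eq_right hs, max_eq_left hs]
    field_simp
    ring
  have hη0 : ∀ s, s ≤ 1 → η s = (p*s-1)/(p-1)*x0 := by
    intro s hs
    simp only [η, min_eq_left hs, max_eq_right hs, hh10]
    ring
  have hηc : Continuous η := by
    have : Continuous fun s : ℝ => (p*min s 1 - 1)/(p-1)*x0 := by fun_prop
    exact (this.add hhc).sub continuous_const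
  have hA : ∀ s, 1 ≤ s → 0 < h s^(p-2) := fun s hs => Real.rpow_pos_of_pos (hhpos s hs) _
  have hA1 : ∀ s, 1 ≤ s → h s^(p-1) = h s^(p-2) * h s := fun s hs => by
    rw [← Real.rpow_add_one (hhpos s hs).ne']; ring_nf
  have hden : ∀ s, 1 ≤ s → 0 < K*(p-1)*(h s - (s-1))*h s^(p-2)*s := fun s hs => by
    have := hw0 s hs
    have := hA s hs
    have : 0 < s := by linarith
    positivity
  have hehpos : ∀ s, 1 ≤ s → 0 < eh s := fun s hs => by
    have h1 := hden s hs
    have h2 := hw0 s hs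
    have h3 : 0 < h s^(p-1) := Real.rpow_pos_of_pos (hhpos s hs) _
    simp only [eh]
    positivity
  have hepos : ∀ s, 0 < e s := fun s => hehpos _ (le_max_right _ _)
  have hec : Continuous e := by
    have c1 : Continuous fun s : ℝ => max s 1 := by fun_prop
    have hne : ∀ s, h (max s 1) ≠ 0 := fun s => (hhpos _ (le_max_right _ _)).ne'
    have c2 : Continuous fun s : ℝ => h (max s 1)^(p-1) := hhc.rpow_const (fun s => Or.inl (hne s))
    have c3 : Continuous fun s : ℝ => h (max s 1)^(p-2) := hhc.rpow_const (fun s => Or.inl (hne s))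
    have c4 : Continuous fun s : ℝ => h (max s 1) - (max s 1 - 1) := hhc.sub (c1.sub continuous_const)
    refine Continuous.div (f := fun s : ℝ => 1 + K*(p-1)*(h (max s 1) - (max s 1 - 1))*h (max s 1)^(p-1))
      (g := fun s : ℝ => K*(p-1)*(h (max s 1) - (max s 1 - 1))*h (max s 1)^(p-2)*max s 1) (by fun_prop) (by fun_prop) ?_
    intro s
    exact (hden _ (le_max_right _ _)).ne'
  have he1 : eh 1 = p/(p-1)*x0 := by
    have hB : 0 < x0^(p-2) := Real.rpow_pos_of_pos hx0 _
    have e1 : x0^(p-1) = x0^(p-2)*x0 := by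
      rw [← Real.rpow_add_one hx0.ne']; ring_nf
    have e2 : x0^p = x0^(p-2)*x0*x0 := by
      rw [← e1, ← Real.rpow_add_one hx0.ne']; ring_nf
    simp only [eh, hh10, e1]
    rw [e2] at hKx
    rw [div_eq_iff (by simp only [sub_self, sub_zero, mul_one]; positivity)]
    field_simp
    linear_combination (-(1:ℝ))*hKx
  have heL : ∀ s, s ≤ 1 → e s = p/(p-1)*x0 := fun s hs => by
    simp only [e, max_eq_right hs, he1]
  have heR : ∀ s, 1 ≤ s → e s = eh s := fun s hs => by
    simp only [e, max_eq_left hs]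
  have hode : ∀ s, 1 ≤ s → K*(p-1)*(h s - (s-1))*h s^(p-2)*eh s * s
        = 1 + K*(p-1)*(h s - (s-1))*h s^(p-1) := by
    intro s hs
    have := (hden s hs).ne'
    have h2 : eh s * (K*(p-1)*(h s - (s-1))*h s^(p-2)*s) = 1 + K*(p-1)*(h s - (s-1))*h s^(p-1) :=
      div_mul_cancel₀ _ this
    linear_combination h2
  have hlt : ∀ s, 1 < s → x0 < h s := by
    intro s hs
    refine lt_of_le_of_ne (hh3 s hs.le) ?_
    intro heq
    have := hh2 s hs.le
    rw [← heq, hγinit] at this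
    linarith
  have hγd : ∀ s, 1 < s → HasDerivAt γ ((eh s)⁻¹ - 1) (h s) := by
    intro s hs
    refine (hγode (h s) (hlt s hs)).congr_deriv ?_
    have h1 := hden s hs.le
    have h2 := hw0 s hs.le
    have h3 : 0 < h s^(p-1) := Real.rpow_pos_of_pos (hhpos s hs.le) _
    simp only [eh, hγh s hs.le]
    rw [inv_div, show 1 - (s - h s) = h s - (s-1) by ring, eq_sub_iff_add_eq,
      div_add_one (by positivity)]
    congr 1
    rw [hA1 s hs.le]; ring
  have hηR : ∀ s, 1 < s → HasDerivAt η (e s) s := by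
    intro s hs
    have hd : HasDerivAt (fun x => x + γ x) (eh s)⁻¹ (η s) := by
      rw [hη1 s hs.le]
      exact ((hasDerivAt_id _).add (hγd s hs)).congr_deriv (by ring)
    have := HasDerivAt.of_local_left_inverse hηc.continuousAt hd (inv_pos.2 (hehpos s hs.le)).ne'
      (by
        filter_upwards [eventually_gt_nhds hs] with t ht
        rw [hη1 t ht.le]
        exact hh2 t ht.le)
    rwa [inv_inv, ← heR s hs.le] at this
  have hηL : ∀ s, s < 1 → HasDerivAt η (e s) s := by
    intro s hs
    have : HasDerivAt (fun s => (p*s-1)/(p-1)*x0) (e s) s := by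
      refine (((((hasDerivAt_id s).const_mul p).sub_const 1).div_const (p-1)).mul_const x0).congr_deriv ?_
      rw [heL s hs.le]; ring
    refine this.congr_of_eventuallyEq ?_
    filter_upwards [eventually_lt_nhds hs] with t ht
    exact hη0 t ht.le
  have hη' : ∀ s, HasDerivAt η (e s) s := by
    intro s
    rcases lt_trichotomy s 1 with hs | hs | hs
    · exact hηL s hs
    · subst hs
      refine hasDerivAt_of_hasDerivAt_of_ne ?_ hηc.continuousAt hec.continuousAt
      intro t ht
      rcases lt_or_gt_of_ne ht with h | h
      · exact hηL t h
      · exact hηR t h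
    · exact hηR s hs
  have hηpos : ∀ s, 1/p < s → 0 < η s := by
    intro s hs
    rcases le_total s 1 with h1 | h1
    · rw [hη0 s h1]
      rw [div_lt_iff₀ hp0] at hs
      have : 0 < p*s-1 := by linarith
      positivity
    · rw [hη1 s h1]; exact hhpos s h1
  have hmonoe : ∀ s t, 1 < s → s ≤ t → eh s ≤ eh t := by
    intro s t hs hst
    have ht : 1 < t := by linarith
    have hanti : AntitoneOn (deriv γ) (Set.Ioi x0) := by
      refine (hγconc.subset ?_ (convex_Ioi x0)).antitoneOn_deriv ?_
      · intro v hv; exact (hx0.trans hv).le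
      · intro v hv; exact (hγode v hv).differentiableAt
    have := hanti (hlt s hs) (hlt t ht) (hmono s t hs.le hst)
    rw [(hγd s hs).deriv, (hγd t ht).deriv] at this
    exact (inv_le_inv₀ (hehpos t ht.le) (hehpos s hs.le)).1 (by linarith)
  have hmain : ∀ s, 1 < s → HasDerivAt e ((e s*s-η s)/((η s - (s-1))*s)*((1-e s) - (p-2)*(η s - (s-1))*e s/η s)) s
      ∧ 0 ≤ (e s*s-η s)/((η s - (s-1))*s)*((1-e s) - (p-2)*(η s - (s-1))*e s/η s) := by
    intro s hs
    have hn := hhpos s hs.le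
    have hdh : HasDerivAt h (e s) s := by
      refine (hηR s hs).congr_of_eventuallyEq ?_
      filter_upwards [eventually_gt_nhds hs] with t ht
      exact (hη1 t ht.le).symm
    have hd : HasDerivAt e ((e s*s-η s)/((η s - (s-1))*s)*((1-e s) - (p-2)*(η s - (s-1))*e s/η s)) s := by
      have h1 := hdh.sub ((hasDerivAt_id s).sub_const 1)
      have h2 := (((h1.const_mul (K*(p-1))).mul (hdh.rpow_const (p := p-1) (Or.inl hn.ne')))).const_add 1
      have h3 := ((h1.const_mul (K*(p-1))).mul (hdh.rpow_const (p := p-2) (Or.inl hn.ne'))).mul (hasDerivAt_id s)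
      have h4 := h2.div h3 (hden s hs.le).ne'
      have h5 := h4.congr_of_eventuallyEq (f₁ := e) (by
        filter_upwards [eventually_gt_nhds hs] with t ht
        rw [heR t ht.le]
        simp [eh])
      refine h5.congr_deriv ?_
      have ho := hode s hs.le
      rw [← heR s hs.le, hA1 s hs.le] at ho
      rw [hη1 s hs.le, ← sf_alg3 hC.ne' (hw0 s hs.le).ne' (hA s hs.le).ne' hn.ne' (by linarith) ho]
      have e1 : h s^(p-2-1) = h s^(p-2) / h s := by rw [Real.rpow_sub_one hn.ne']
      simp only [id, Pi.mul_apply, Pi.sub_apply, e1, show p-1-1 = p-2 by ring, hA1 s hs.le, mul_one]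
    refine ⟨hd, ?_⟩
    have hm : MonotoneOn e (Set.Ioi 1) := by
      intro u hu v hv huv
      rw [heR u (le_of_lt hu), heR v (le_of_lt hv)]
      exact hmonoe u v hu huv
    have h6 := hm.derivWithin_nonneg (x := s)
    rw [derivWithin_of_isOpen isOpen_Ioi hs, hd.deriv] at h6
    exact h6
  have hmain2 : ∀ s X, 1 < s → (p-2)*(η s - (s-1))*e s ≤ (1-e s)*η s ∧ (η s - X ≤ (η s - (s-1)) →
    ((p-2)*(e s)^2/η s + (e s*s-η s)/((η s - (s-1))*s)*((1-e s) - (p-2)*(η s - (s-1))*e s/η s))*(η s-X) ≤ e s - e s^2) := by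
    intro s X hs
    have h2 := (hmain s hs).2
    have ho := hode s hs.le
    rw [← heR s hs.le, hA1 s hs.le] at ho
    rw [hη1 s hs.le] at h2 ⊢
    exact sf_alg4 hp (hw0 s hs.le) (hhpos s hs.le) (hepos s) (by linarith) hC (hA s hs.le) ho h2
  refine ⟨η, e, hη', hηpos, hec, hepos, ?_, ?_, ?_, ?_, ?_, hη1, hη0, ?_⟩
  · intro s hs hne
    rcases lt_or_gt_of_ne hne with h1 | h1
    · refine ⟨0, ?_, ?_⟩
      · refine (hasDerivAt_const s (p/(p-1)*x0)).congr_of_eventuallyEq ?_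
        filter_upwards [eventually_lt_nhds h1] with t ht
        exact heL t ht.le
      · intro X hX _
        have hn := hηpos s hs
        have he := hepos s
        have hle : (p-1)*e s ≤ 1 := by
          rw [heL s h1.le]
          have : p*x0 ≤ 1 := by
            rw [le_div_iff₀ hp0] at hx0p; linarith
          field_simp
          linarith
        rw [add_zero]
        have hp2 : 0 ≤ (p-2)*e s^2 / η s := by
          have : 0 ≤ p - 2 := by linarith
          positivity
        refine le_trans (mul_le_mul_of_nonneg_left (show η s - X ≤ η s by linarith) hp2) ?_
        rw [div_mul_cancel₀ _ hn.ne']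
        nlinarith
    · refine ⟨_, (hmain s h1).1, ?_⟩
      intro X _ hX
      exact (hmain2 s X h1).2 (by linarith)
  · intro s hs; rw [hη1 s hs.le]; exact hw0 s hs.le
  · intro s hs; rw [hη1 s hs.le]; exact (hw1 s hs.le).trans hx0p
  · intro s hs; rw [hη1 s hs.le, heR s hs.le]; exact hode s hs.le
  · intro s hs; exact (hmain2 s 0 hs).1
  · intro x hx
    rcases lt_or_ge x x0 with h1 | h1
    · have hb : x + γ x = (p-1)*(α+1)*x + 1/p := by rw [hγlin x hx h1]; ring
      rw [hη0, hb]
      · field_simp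
        rw [hx0def]
        field_simp
        ring
      · have := hγmono hx hx0.le h1.le
        rw [hγinit] at this
        linarith
    · have := hγmono hx0.le hx h1
      rw [hγinit] at this
      rw [hη1 _ (by linarith), hh1 x h1]

lemma sf_core {p K : ℝ} (hp : 2 ≤ p) (hK : 0 < K) {γ η e : ℝ → ℝ} {u : ℝ → ℝ → ℝ}
    (hη : ∀ s, HasDerivAt η (e s) s) (hpos : ∀ s, 1/p < s → 0 < η s) (hec : Continuous e)
    (he0 : ∀ s, 0 < e s)
    (hB : ∀ s, 1/p < s → s ≠ 1 → ∃ e2, HasDerivAt e e2 s ∧ ∀ X, 0 ≤ X → s - X ≤ 1 →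
        ((p-2)*(e s)^2/η s + e2)*(η s - X) ≤ e s - e s^2)
    (hw : ∀ s, 1 < s → 0 < η s - (s-1)) (hw2 : ∀ s, 1 < s → η s - (s-1) ≤ 1/p)
    (hode : ∀ s, 1 < s → K*(p-1)*(η s - (s-1))*η s^(p-2)*e s * s
        = 1 + K*(p-1)*(η s - (s-1))*η s^(p-1))
    (hstar : ∀ s, 1 < s → (p-2)*(η s - (s-1))*e s ≤ (1 - e s)*η s)
    (hγη : ∀ x, 0 ≤ x → η (x + γ x) = x)
    (hγc : ∀ x, 0 < x → ContinuousAt γ x)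
    (hγp : ∀ x, 0 ≤ x → 1/p ≤ γ x) (hγlt : ∀ x, 0 ≤ x → γ x < 1)
    (hu0 : ∀ x y : ℝ, 0 ≤ x → |y| ≤ 1 → |y| ≤ γ x → u x y = 1 - K * x^p)
    (hu2 : ∀ x y : ℝ, 0 ≤ x → |y| ≤ 1 → γ x < |y| →
      u x y = 1 - K * (η (x+|y|)^(p-1) * (p*x - (p-1) * η (x+|y|))))
    {y a : ℝ} (hy : |y| ≤ 1) (ha1 : -1 ≤ a) (ha2 : a ≤ 1) :
    ConcaveOn ℝ (Set.Ici 0) (fun t : ℝ => (max |y+a*t| 1)^p *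
      u (t / max |y+a*t| 1) ((y+a*t) / max |y+a*t| 1)) := by
  have hp0 : 0 < p := by linarith
  have hηm : StrictMono η := strictMono_of_deriv_pos (fun s => by rw [(hη s).deriv]; exact he0 s)
  have hηc : Continuous η := continuous_iff_continuousAt.2 fun s => (hη s).continuousAt
  have hxx : ∀ x : ℝ, 0 ≤ x → x^(p-1)*(p*x-(p-1)*x) = x^p := by
    intro x hx
    rcases eq_or_lt_of_le hx with rfl | hx
    · rw [Real.zero_rpow (by linarith), Real.zero_rpow (by linarith)]; ring
    · rw [show x^p = x^(p-1)*x by rw [← Real.rpow_add_one hx.ne']; ring_nf]; ring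
  -- closed formulas for `u`
  have hueq : ∀ x y : ℝ, 0 ≤ x → |y| ≤ 1 → γ x ≤ |y| →
      u x y = 1 - K * (η (x+|y|)^(p-1) * (p*x - (p-1) * η (x+|y|))) := by
    intro x y hx hy hg
    rcases eq_or_lt_of_le hg with hg | hg
    · rw [hu0 x y hx hy hg.ge, ← hg, hγη x hx, hxx x hx]
    · exact hu2 x y hx hy hg
  have hule : ∀ x y : ℝ, 0 ≤ x → |y| ≤ 1 → 1/p < x + |y| →
      u x y ≤ 1 - K * (η (x+|y|)^(p-1) * (p*x - (p-1) * η (x+|y|))) := by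
    intro x y hx hy hs
    rcases le_total (γ x) |y| with hg | hg
    · rw [hueq x y hx hy hg]
    · rw [hu0 x y hx hy hg]
      have := sf_tangent (p := p) (by linarith) hx (hpos _ hs)
      have := mul_le_mul_of_nonneg_left this hK.le
      linarith
  have humax : ∀ x y : ℝ, 0 ≤ x → |y| ≤ 1 →
      u x y = 1 - K * ((max x (η (x+|y|)))^(p-1) * (p*x - (p-1) * (max x (η (x+|y|))))) := by
    intro x y hx hy
    rcases le_total (γ x) |y| with hg | hg
    · have : x ≤ η (x + |y|) := by
        conv_lhs => rw [← hγη x hx]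
        exact hηm.monotone (by linarith)
      rw [max_eq_right this, hueq x y hx hy hg]
    · have : η (x + |y|) ≤ x := by
        conv_rhs => rw [← hγη x hx]
        exact hηm.monotone (by linarith)
      rw [max_eq_left this, hu0 x y hx hy hg, hxx x hx]
  have hueven : ∀ x y : ℝ, 0 ≤ x → |y| ≤ 1 → u x (-y) = u x y := by
    intro x y hx hy
    rw [humax x y hx hy, humax x (-y) hx (by rwa [abs_neg]), abs_neg]
  let W : ℝ → ℝ → ℝ := fun x y => (max |y| 1)^p * u (x / max |y| 1) (y / max |y| 1)
  have hM : ∀ y : ℝ, 0 < max |y| 1 := fun y => lt_of_lt_of_le one_pos (le_max_right _ _)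
  have hyM : ∀ y : ℝ, |y / max |y| 1| ≤ 1 := by
    intro y
    rw [abs_div, abs_of_pos (hM y), div_le_one (hM y)]
    exact le_max_left _ _
  have hWeven : ∀ x y : ℝ, 0 ≤ x → W x (-y) = W x y := by
    intro x y hx
    simp only [W, abs_neg]
    rw [neg_div, hueven _ _ (div_nonneg hx (hM y).le) (hyM y)]
  have hWin : ∀ x y : ℝ, |y| ≤ 1 → W x y = u x y := by
    intro x y hy
    simp only [W, max_eq_right hy, Real.one_rpow, div_one, one_mul]
  have hWout : ∀ x y : ℝ, 0 ≤ x → 1 ≤ y → W x y =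
      y^p * (1 - K*(η (1+x/y)^(p-1)*(p*(x/y)-(p-1)*η (1+x/y)))) := by
    intro x y hx hy
    have hy0 : 0 < y := by linarith
    have hxy : 0 ≤ x / y := div_nonneg hx hy0.le
    simp only [W]
    rw [abs_of_pos hy0, max_eq_left hy, div_self hy0.ne', hueq _ _ hxy (by simp) (by
      rw [abs_one]; exact (hγlt _ hxy).le), abs_one, add_comm (x/y) 1]
  -- the local statement
  have hloc : ∀ x Y a : ℝ, 0 < x → 0 ≤ Y → -1 ≤ a → a ≤ 1 → |Y - a*x| ≤ 1 →
      ∃ m, ∀ᶠ t in nhds x, W t (Y + a*(t-x)) ≤ W x Y + m*(t-x) := by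
    intro x Y a hx hY ha1 ha2 hb
    have hcy : Continuous fun t : ℝ => Y + a*(t-x) := by fun_prop
    have hcy0 : Y + a*(x-x) = Y := by ring
    have ev0 : ∀ᶠ t in nhds x, 0 < t := eventually_gt_nhds hx
    have evlt : ∀ c, c < Y → ∀ᶠ t in nhds x, c < Y + a*(t-x) := fun c hc =>
      (hcy.tendsto' x Y hcy0).eventually (eventually_gt_nhds hc)
    have evgt : ∀ c, Y < c → ∀ᶠ t in nhds x, Y + a*(t-x) < c := fun c hc =>
      (hcy.tendsto' x Y hcy0).eventually (eventually_lt_nhds hc)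
    rcases lt_or_ge Y (γ x) with hg | hg
    · -- interior of the first region
      have hY1 : Y < 1 := hg.trans (hγlt x hx.le)
      refine ⟨-K*p*x^(p-1), ?_⟩
      have evγ : ∀ᶠ t in nhds x, |Y + a*(t-x)| < γ t := by
        have c1 : ContinuousAt (fun t => γ t - |Y + a*(t-x)|) x :=
          (hγc x hx).sub hcy.abs.continuousAt
        have c2 : 0 < γ x - |Y + a*(x-x)| := by rw [hcy0, abs_of_nonneg hY]; linarith
        filter_upwards [c1.eventually (eventually_gt_nhds c2)] with t ht
        linarith
      filter_upwards [ev0, evγ] with t ht htγ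
      have ht1 : |Y + a*(t-x)| ≤ 1 := (htγ.trans (hγlt t ht.le)).le
      have hYa : |Y| ≤ 1 := by rw [abs_of_nonneg hY]; exact hY1.le
      rw [hWin _ _ ht1, hWin _ _ hYa, hu0 _ _ ht.le ht1 htγ.le, hu0 _ _ hx.le hYa (by
        rw [abs_of_nonneg hY]; exact hg.le)]
      have h1 := sf_tangent (p := p) (by linarith) ht.le hx
      have h2 := mul_le_mul_of_nonneg_left h1 hK.le
      rw [← hxx x hx.le]
      linarith
    have hYp : 1/p ≤ Y := (hγp x hx.le).trans hg
    have hYpos : 0 < Y := lt_of_lt_of_le (by positivity) hYp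
    have hsp : 1/p < x + Y := by linarith
    have evs : ∀ᶠ t in nhds x, 1/p < x + (t-x) + (Y + a*(t-x)) := by
      have c1 : Continuous fun t : ℝ => x + (t-x) + (Y + a*(t-x)) := by fun_prop
      exact (c1.tendsto' x (x+Y) (by ring)).eventually (eventually_gt_nhds hsp)
    have inside : Y ≤ 1 → ∀ t, 0 < t → 0 < Y + a*(t-x) → Y + a*(t-x) ≤ 1 →
        1/p < x + (t-x) + (Y + a*(t-x)) → W t (Y + a*(t-x)) ≤ W x Y +
        (-K*(p*η (x+Y)^(p-1) + (1+a)*(p*(p-1)*(η (x+Y)^(p-2)*e (x+Y)))*(x-η (x+Y))))*(t-x) := by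
      intro hY1 t ht h1 h2 h3
      have hYa : |Y| ≤ 1 := by rwa [abs_of_pos hYpos]
      have hYt : |Y + a*(t-x)| ≤ 1 := by rwa [abs_of_pos h1]
      have key := sf_inside hp hK hη hpos hec he0 hB ha1 ha2 hx.le (show 0 ≤ x + (t-x) by linarith)
        hsp h3 hY1 h2
      rw [show x + (t-x) = t by ring] at key h3
      rw [hWin _ _ hYt, hWin _ _ hYa, hueq x Y hx.le hYa (by rwa [abs_of_pos hYpos])]
      have h4 := hule t _ ht.le hYt (by rwa [abs_of_pos h1])
      rw [abs_of_pos h1] at h4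
      rw [abs_of_pos hYpos]
      exact h4.trans key
    rcases lt_or_ge Y 1 with hY1 | hY1
    · refine ⟨-K*(p*η (x+Y)^(p-1) + (1+a)*(p*(p-1)*(η (x+Y)^(p-2)*e (x+Y)))*(x-η (x+Y))), ?_⟩
      filter_upwards [ev0, evlt 0 hYpos, evgt 1 hY1, evs] with t h1 h2 h3 h4
      exact inside hY1.le t h1 h2 h3.le h4
    have ha0 : 0 ≤ a := by
      have := (abs_le.1 hb).2
      by_contra hcon
      push Not at hcon
      nlinarith
    have hax : a*x ≤ Y + 1 := by have := (abs_le.1 hb).1; linarith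
    have hc : a^2*x < (1+2*a)*Y := by nlinarith [mul_le_mul_of_nonneg_left hax ha0]
    have evc : ∀ᶠ t in nhds x, a^2*(x+(t-x)) ≤ (1+2*a)*(Y+a*(t-x)) := by
      have c1 : Continuous fun t : ℝ => (1+2*a)*(Y+a*(t-x)) - a^2*(x+(t-x)) := by fun_prop
      have := (c1.tendsto' x ((1+2*a)*Y - a^2*x) (by ring)).eventually (eventually_gt_nhds (sub_pos.2 hc))
      filter_upwards [this] with t ht
      linarith
    have outside : ∀ t, 0 < t → 1 ≤ Y + a*(t-x) → a^2*(x+(t-x)) ≤ (1+2*a)*(Y+a*(t-x)) →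
        W t (Y + a*(t-x)) ≤ W x Y +
        (Y^(p-1)*((1+a)*(p*(1+K*(p-1)*(η (1+x/Y) - x/Y)*η (1+x/Y)^(p-1))/(1+x/Y))
        - K*p*η (1+x/Y)^(p-1)))*(t-x) := by
      intro t ht h1 h2
      have key := sf_outside hp hK hη (fun s hs => hpos s (by
          have : 1/p ≤ 1 := by rw [div_le_one hp0]; linarith
          linarith)) hw hw2 he0 hode hstar ha0 ha2 hx (show 0 < x + (t-x) by linarith) hYpos
          (by linarith) hc.le h2
      rw [show x + (t-x) = t by ring] at key
      rw [hWout t _ ht.le h1, hWout x Y hx.le hY1]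
      exact key
    rcases eq_or_lt_of_le hY1 with hY1 | hY1
    · subst hY1
      refine ⟨-K*(p*η (x+1)^(p-1) + (1+a)*(p*(p-1)*(η (x+1)^(p-2)*e (x+1)))*(x-η (x+1))), ?_⟩
      · filter_upwards [ev0, evlt 0 hYpos, evs, evc] with t h1 h2 h3 h4
        rcases le_total (1 + a*(t-x)) 1 with h5 | h5
        · exact inside le_rfl t h1 h2 h5 h3
        · refine (outside t h1 h5 h4).trans (le_of_eq ?_)
          congr 2
          have hs1 : 1 < x + 1 := by linarith
          have ho := hode _ hs1
          rw [show x + 1 - 1 = x by ring] at ho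
          rw [Real.one_rpow, div_one, add_comm 1 x, ← ho]
          field_simp
          ring
    · refine ⟨Y^(p-1)*((1+a)*(p*(1+K*(p-1)*(η (1+x/Y) - x/Y)*η (1+x/Y)^(p-1))/(1+x/Y))
        - K*p*η (1+x/Y)^(p-1)), ?_⟩
      filter_upwards [ev0, evlt 1 hY1, evc] with t h1 h2 h3
      exact outside t h1 h2.le h3
  refine sf_local_super ?_ ?_
  · have hMc : Continuous fun t : ℝ => max |y+a*t| 1 := by fun_prop
    have hMne : ∀ t : ℝ, max |y+a*t| 1 ≠ 0 := fun t => (hM _).ne'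
    have c1 : Continuous fun t : ℝ => t / max |y+a*t| 1 := continuous_id.div hMc hMne
    have c2 : Continuous fun t : ℝ => (y+a*t) / max |y+a*t| 1 :=
      Continuous.div (by fun_prop) hMc hMne
    have c3 : Continuous fun t : ℝ => max (t / max |y+a*t| 1)
        (η (t / max |y+a*t| 1 + |(y+a*t) / max |y+a*t| 1|)) :=
      c1.max (hηc.comp (c1.add c2.abs))
    have c4 := c3.rpow_const (p := p-1) (fun t => Or.inr (by linarith))
    have c5 := hMc.rpow_const (p := p) (fun t => Or.inr (by linarith))
    have c6 := c5.mul (continuous_const.sub (continuous_const.mul (c4.mul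
      ((continuous_const.mul c1).sub (continuous_const.mul c3)))) : Continuous fun t : ℝ =>
        1 - K * (_ * (p * _ - (p-1) * _)))
    refine c6.continuousOn.congr ?_
    intro t ht
    simp only
    rw [humax _ _ (div_nonneg ht (hM _).le) (hyM _)]
    rfl
  · intro x hx
    rcases le_total 0 (y + a*x) with hs | hs
    · obtain ⟨m, hm⟩ := hloc x (y+a*x) a hx hs ha1 ha2 (by rwa [show y + a*x - a*x = y by ring])
      refine ⟨m, ?_⟩
      filter_upwards [hm] with t ht
      rw [show y + a*x + a*(t-x) = y + a*t by ring] at ht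
      exact ht
    · obtain ⟨m, hm⟩ := hloc x (-(y+a*x)) (-a) hx (by linarith) (by linarith) (by linarith)
        (by rwa [show -(y + a*x) - (-a)*x = -y by ring, abs_neg])
      refine ⟨m, ?_⟩
      filter_upwards [hm, eventually_gt_nhds hx] with t ht ht0
      rw [show -(y + a*x) + (-a)*(t-x) = -(y + a*t) by ring, hWeven _ _ ht0.le, hWeven _ _ hx.le] at ht
      exact ht



/-- Concavity of the Burkholder-type special function along lines of slope in `[-1,1]`:
for `|y| ≤ z`, `z > 0`, `a ∈ [-1,1]`, the function `t ↦ U(t, y + a t, z)` is concave on `[0,∞)`. -/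
theorem special_function_concavity_along_lines
    {α p : ℝ} (hα0 : 0 < α) (hα1 : α ≤ 1) (hp : 2 ≤ p)
    {γ h : ℝ → ℝ} {u : ℝ → ℝ → ℝ} {U : ℝ → ℝ → ℝ → ℝ}
    (hγlin : ∀ x : ℝ, 0 ≤ x → x < ((α+1)*p)⁻¹ → γ x = ((p-1)*(α+1)-1)*x + 1/p)
    (hγode : ∀ x : ℝ, ((α+1)*p)⁻¹ < x →
      HasDerivAt γ
        ((-1 + ((α+1)*p)^p * (p-1) * (1 - γ x) * γ x * x^(p-2)) /
          (1 + ((α+1)*p)^p * (p-1) * (1 - γ x) * x^(p-1))) x)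
    (hγinit : γ (((α+1)*p)⁻¹) = 1 - ((α+1)*p)⁻¹)
    (hγdiff : DifferentiableOn ℝ γ (Set.Ici (0:ℝ)))
    (hγmono : MonotoneOn γ (Set.Ici (0:ℝ)))
    (hγconc : ConcaveOn ℝ (Set.Ici (0:ℝ)) γ)
    (hγlt : ∀ x : ℝ, 0 ≤ x → γ x < 1)
    (hh1 : ∀ x : ℝ, ((α+1)*p)⁻¹ ≤ x → h (x + γ x) = x)
    (hh2 : ∀ y : ℝ, 1 ≤ y → h y + γ (h y) = y)
    (hh3 : ∀ y : ℝ, 1 ≤ y → ((α+1)*p)⁻¹ ≤ h y)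
    (hu0 : ∀ x y : ℝ, 0 ≤ x → |y| ≤ 1 → |y| ≤ γ x →
      u x y = 1 - ((α+1)*p)^p * x^p)
    (hu1 : ∀ x y : ℝ, 0 ≤ x → |y| ≤ 1 → γ x < |y| → x + |y| ≤ 1 →
      u x y = 1 - ((p*x + p*|y| - 1)/(p-1))^(p-1) * (p*(p*(α+1)-1)*x - p*|y| + 1))
    (hu2 : ∀ x y : ℝ, 0 ≤ x → |y| ≤ 1 → γ x < |y| → 1 < x + |y| →
      u x y = 1 - ((α+1)*p)^p * (h (x+|y|))^(p-1) * (p*x - (p-1) * h (x+|y|)))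
    (hU : ∀ x y z : ℝ, 0 ≤ x → 0 < z →
      U x y z = (max |y| z)^p * u (x / max |y| z) (y / max |y| z))
    :
    ∀ y z a : ℝ, 0 < z → |y| ≤ z → -1 ≤ a → a ≤ 1 →
      ConcaveOn ℝ (Set.Ici (0:ℝ)) (fun t : ℝ => U t (y + a*t) z) := by
  have hp0 : 0 < p := by linarith
  have hp1 : 0 < p - 1 := by linarith
  have hκp : 0 < (α+1)*p := by positivity
  have hK : 0 < ((α+1)*p)^p := Real.rpow_pos_of_pos hκp p
  have hx0 : 0 < ((α+1)*p)⁻¹ := by positivity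
  obtain ⟨η, e, hη, hpos, hec, he0, hB, hw, hw2, hode, hstar, hη1, hη0, hγη⟩ :=
    sf_exists hα0 hp hγlin hγode hγinit hγmono hγconc hγlt hh1 hh2 hh3
  have hγ0 : γ 0 = 1/p := by rw [hγlin 0 le_rfl hx0]; ring
  have hγp : ∀ x, 0 ≤ x → 1/p ≤ γ x := fun x hx => by
    rw [← hγ0]; exact hγmono (Set.mem_Ici.2 le_rfl) hx hx
  intro y z a hz hyz ha1 ha2
  have hu2' : ∀ x y : ℝ, 0 ≤ x → |y| ≤ 1 → γ x < |y| →
      u x y = 1 - ((α+1)*p)^p * (η (x+|y|)^(p-1) * (p*x - (p-1) * η (x+|y|))) := by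
    intro x y hx hy hg
    rcases le_or_gt (x+|y|) 1 with hs | hs
    · rw [hu1 x y hx hy hg hs, hη0 _ hs]
      have hm : 0 ≤ (p*(x+|y|)-1)/(p-1) := by
        have h1 := hγp x hx
        rw [div_le_iff₀ hp0] at h1
        refine div_nonneg ?_ hp1.le
        nlinarith
      rw [Real.mul_rpow hm hx0.le, Real.inv_rpow hκp.le,
        show ((α+1)*p)^p = ((α+1)*p)^(p-1) * ((α+1)*p) by
          rw [← Real.rpow_add_one hκp.ne']; ring_nf,
        show p*x + p*|y| - 1 = p*(x+|y|) - 1 by ring]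
      have hk1 : ((α+1)*p)^(p-1) ≠ 0 := (Real.rpow_pos_of_pos hκp _).ne'
      have hα : α + 1 ≠ 0 := by linarith
      generalize ((p*(x+|y|)-1)/(p-1))^(p-1) = Q
      generalize ((α+1)*p)^(p-1) = R at *
      field_simp
      ring
    · rw [hu2 x y hx hy hg hs, hη1 _ hs.le]; ring
  have hγc : ∀ x, 0 < x → ContinuousAt γ x := fun x hx =>
    ((hγdiff x hx.le).differentiableAt (Ici_mem_nhds hx)).continuousAt
  have hy' : |y/z| ≤ 1 := by rw [abs_div, abs_of_pos hz, div_le_one hz]; exact hyz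
  have core := sf_core hp hK hη hpos hec he0 hB hw hw2 hode hstar hγη hγc hγp hγlt hu0 hu2'
    hy' ha1 ha2
  have core2 := core.comp_linearMap (LinearMap.lsmul ℝ ℝ z⁻¹)
  have hzp : 0 ≤ z^p := Real.rpow_nonneg hz.le p
  have core3 := core2.smul hzp
  have hsub : Set.Ici (0:ℝ) ⊆ (LinearMap.lsmul ℝ ℝ z⁻¹) ⁻¹' Set.Ici (0:ℝ) := by
    intro t ht
    have : (0:ℝ) ≤ t := ht
    simp only [Set.mem_preimage, LinearMap.lsmul_apply, smul_eq_mul, Set.mem_Ici]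
    positivity
  refine (core3.subset hsub (convex_Ici 0)).congr ?_
  intro t ht
  have ht0 : (0:ℝ) ≤ t := ht
  simp only [Function.comp, LinearMap.lsmul_apply, smul_eq_mul]
  rw [hU t _ z ht0 hz]
  have e1 : y/z + a*(z⁻¹*t) = (y+a*t)/z := by field_simp
  have e2 : max |(y+a*t)/z| 1 = max |y+a*t| z / z := by
    rw [abs_div, abs_of_pos hz, ← max_div_div_right hz.le, div_self hz.ne']
  have hM : 0 < max |y+a*t| z := lt_of_lt_of_le hz (le_max_right _ _)
  rw [e1, e2, ← mul_assoc, ← Real.mul_rpow hz.le (by positivity), show z * (max |y+a*t| z / z) = max |y+a*t| z by field_simp]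
  congr 2
  · field_simp
  · field_simp
end

section
/- Fix α ∈ (0,1] and p ≥ 2 and let U be the Burkholder-type special function. Then for all x, y, z, k_x, k_y with x ≥ 0, x + k_x ≥ 0, z > 0, |y| ≤ z and |k_y| ≤ |k_x|, one has U(x+k_x, y+k_y, z) ≤ U(x,y,z) + U_x(x,y,z)·k_x + U_y(x,y,z)·k_y (for x = 0, U_x(0,y,z) denotes the right-sided derivative). -/
namespace TangentIneq

open Set Filter Topology

/-- Antitonicity from a nonpositive derivative off a finite set. -/
lemma anti_finite (N : ℝ → ℝ) (S : Finset ℝ) : ∀ a b : ℝ, a ≤ b → ContinuousOn N (Icc a b) →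
    (∀ t ∈ Ioo a b, t ∉ S → ∃ D, D ≤ 0 ∧ HasDerivAt N D t) → N b ≤ N a := by
  induction S using Finset.induction_on with
  | empty =>
    intro a b hab hc hd
    have := antitoneOn_of_deriv_nonpos (convex_Icc a b) hc
      (by
        intro t ht
        rw [interior_Icc] at ht
        obtain ⟨D, _, h⟩ := hd t ht (by simp)
        exact h.differentiableAt.differentiableWithinAt)
      (by
        intro t ht
        rw [interior_Icc] at ht
        obtain ⟨D, h0, h⟩ := hd t ht (by simp)
        rw [h.deriv]; exact h0)
    exact this (left_mem_Icc.2 hab) (right_mem_Icc.2 hab) hab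
  | insert c S hc ih =>
    intro a b hab hcont hd
    by_cases hcI : c ∈ Ioo a b
    · have h1 : N c ≤ N a := ih a c hcI.1.le
        (hcont.mono (Icc_subset_Icc_right hcI.2.le)) (by
          intro t ht htS
          refine hd t ⟨ht.1, ht.2.trans hcI.2⟩ ?_
          simp only [Finset.mem_insert, not_or]
          exact ⟨ht.2.ne, htS⟩)
      have h2 : N b ≤ N c := ih c b hcI.2.le
        (hcont.mono (Icc_subset_Icc_left hcI.1.le)) (by
          intro t ht htS
          refine hd t ⟨hcI.1.trans ht.1, ht.2⟩ ?_
          simp only [Finset.mem_insert, not_or]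
          exact ⟨ht.1.ne', htS⟩)
      exact h2.trans h1
    · refine ih a b hab hcont ?_
      intro t ht htS
      refine hd t ht ?_
      simp only [Finset.mem_insert, not_or]
      exact ⟨fun h => hcI (h ▸ ht), htS⟩

/-- Antitonicity with an additional closed set on which the function is known to be antitone. -/
lemma anti_closed (N : ℝ → ℝ) (S : Finset ℝ) (A : Set ℝ) (hA : IsClosed A) (a b : ℝ) (hab : a ≤ b)
    (hc : ContinuousOn N (Icc a b))
    (hAN : ∀ s ∈ A ∩ Icc a b, ∀ t ∈ A ∩ Icc a b, s ≤ t → N t ≤ N s)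
    (hd : ∀ t ∈ Ioo a b, t ∉ S → t ∉ A → ∃ D, D ≤ 0 ∧ HasDerivAt N D t) : N b ≤ N a := by
  by_cases hne : (A ∩ Icc a b).Nonempty
  · have hcomp : IsCompact (A ∩ Icc a b) := isCompact_Icc.inter_left hA
    obtain ⟨s, hs, hs'⟩ := hcomp.exists_isLeast hne
    obtain ⟨t, ht, ht'⟩ := hcomp.exists_isGreatest hne
    have h1 : N s ≤ N a := anti_finite N S a s hs.2.1
      (hc.mono (Icc_subset_Icc_right hs.2.2)) (by
        intro r hr hrS
        refine hd r ⟨hr.1, hr.2.trans_le hs.2.2⟩ hrS ?_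
        intro hrA
        exact absurd (hs' ⟨hrA, hr.1.le, hr.2.le.trans hs.2.2⟩) (not_le.2 hr.2))
    have h2 : N b ≤ N t := anti_finite N S t b ht.2.2
      (hc.mono (Icc_subset_Icc_left ht.2.1)) (by
        intro r hr hrS
        refine hd r ⟨ht.2.1.trans_lt hr.1, hr.2⟩ hrS ?_
        intro hrA
        exact absurd (ht' ⟨hrA, ht.2.1.trans hr.1.le, hr.2.le⟩) (not_le.2 hr.1))
    exact h2.trans ((hAN s hs t ht (hs' ht)).trans h1)
  · refine anti_finite N S a b hab hc ?_
    intro t ht htS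
    refine hd t ht htS ?_
    intro htA
    exact hne ⟨t, htA, ht.1.le, ht.2.le⟩

/-- Gluing of derivatives. -/
lemma glue {F f g : ℝ → ℝ} {D t₀ : ℝ} {s : Set ℝ} (hf : HasDerivWithinAt f D s t₀)
    (hg : HasDerivWithinAt g D s t₀) (h1 : F t₀ = f t₀) (h2 : F t₀ = g t₀)
    (h : ∀ᶠ t in 𝓝[s] t₀, F t = f t ∨ F t = g t) : HasDerivWithinAt F D s t₀ := by
  rw [hasDerivWithinAt_iff_isLittleO] at *
  rw [Asymptotics.isLittleO_iff] at *
  intro c hc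
  filter_upwards [hf hc, hg hc, h] with t ht1 ht2 ht
  rcases ht with ht | ht
  · rw [ht, h1]; exact ht1
  · rw [ht, h2]; exact ht2

/-- The data of the problem in a normalised form. -/
structure Sys (p a : ℝ) (Γ g k : ℝ → ℝ) : Prop where
  hp : 2 ≤ p
  ha : p < a
  dΓ : ∀ x, HasDerivAt Γ (g x) x
  gc : Continuous g
  gnn : ∀ x, 0 ≤ g x
  gl : ∀ x, x ≤ 1/a → g x = (p-1)*a/p - 1
  Γl : ∀ x, x ≤ 1/a → Γ x = ((p-1)*a/p - 1)*x + 1/p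
  ode : ∀ x, 1/a ≤ x → g x * (1 + a^p*(p-1)*(1-Γ x)*x^(p-1)) =
    -1 + a^p*(p-1)*(1-Γ x)*Γ x*x^(p-2)
  Γ1 : ∀ x, Γ x < 1
  v : ∀ x, 1/a ≤ x → 1 - Γ x ≤ 1/a
  conc : ∀ x, 1/a < x → (p-2)*(1-Γ x) ≤ g x * x
  kl : ∀ x, k (x + Γ x) = x
  kr : ∀ s, k s + Γ (k s) = s

section
variable {p a : ℝ} {Γ g k : ℝ → ℝ}

lemma Sys.p0 (S : Sys p a Γ g k) : 0 < p := by linarith [S.hp]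
lemma Sys.a0 (S : Sys p a Γ g k) : 0 < a := by linarith [S.ha, S.p0]
lemma Sys.C0 (S : Sys p a Γ g k) : 0 < a^p*(p-1) :=
  mul_pos (Real.rpow_pos_of_pos S.a0 p) (by linarith [S.hp])

lemma Sys.Hmono (S : Sys p a Γ g k) : StrictMono (fun x => x + Γ x) := by
  refine strictMono_of_hasDerivAt_pos (f' := fun x => 1 + g x)
    (fun x => (hasDerivAt_id x).add (S.dΓ x)) ?_
  intro x
  have := S.gnn x
  linarith

lemma Sys.Γmono (S : Sys p a Γ g k) : Monotone Γ :=
  monotone_of_hasDerivAt_nonneg S.dΓ S.gnn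

lemma Sys.kle (S : Sys p a Γ g k) {s x : ℝ} : k s ≤ x ↔ s ≤ x + Γ x := by
  rw [← S.Hmono.le_iff_le]
  simp only [S.kr]

lemma Sys.ltk (S : Sys p a Γ g k) {s x : ℝ} : x < k s ↔ x + Γ x < s := by
  rw [← not_le, S.kle, not_le]

lemma Sys.lek (S : Sys p a Γ g k) {s x : ℝ} : x ≤ k s ↔ x + Γ x ≤ s := by
  rw [← S.Hmono.le_iff_le]
  simp only [S.kr]

lemma Sys.kcont (S : Sys p a Γ g k) : Continuous k :=
  (StrictMono.orderIsoOfRightInverse (fun x => x + Γ x) S.Hmono k S.kr).symm.continuous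

lemma Sys.dk (S : Sys p a Γ g k) (s : ℝ) : HasDerivAt k (1 + g (k s))⁻¹ s := by
  refine HasDerivAt.of_local_left_inverse (f := fun x => x + Γ x) S.kcont.continuousAt
    ((hasDerivAt_id _).add (S.dΓ _)) ?_ (Eventually.of_forall S.kr)
  have := S.gnn (k s)
  positivity

lemma Sys.H1 (S : Sys p a Γ g k) : 1/a + Γ (1/a) = 1 := by
  rw [S.Γl _ le_rfl]
  have := S.p0
  have := S.a0
  field_simp
  ring

lemma Sys.ak (S : Sys p a Γ g k) {s : ℝ} : 1/a ≤ k s ↔ 1 ≤ s := by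
  rw [S.lek, S.H1]
lemma Sys.ak' (S : Sys p a Γ g k) {s : ℝ} : 1/a < k s ↔ 1 < s := by
  rw [S.ltk, S.H1]
lemma Sys.ka (S : Sys p a Γ g k) {s : ℝ} : k s ≤ 1/a ↔ s ≤ 1 := by
  rw [S.kle, S.H1]

lemma Sys.vpos (S : Sys p a Γ g k) (s : ℝ) : 0 < k s - s + 1 := by
  have := S.kr s
  have := S.Γ1 (k s)
  linarith

lemma Sys.Γk (S : Sys p a Γ g k) (s : ℝ) : 1 - Γ (k s) = k s - s + 1 := by
  have := S.kr s
  linarith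

lemma rpow_split {x q : ℝ} (hx : 0 ≤ x) (hq : 2 ≤ q) : x^(q-1) = x^(q-2) * x := by
  rw [← Real.rpow_add_one' hx (by linarith)]
  congr 1; ring

lemma rpow_split' {x q : ℝ} (hx : 0 ≤ x) (hq : 2 ≤ q) : x^q = x^(q-1) * x := by
  rw [← Real.rpow_add_one' hx (by linarith)]
  congr 1; ring

/-- The ODE in terms of the inverse function. -/
lemma Sys.T (S : Sys p a Γ g k) {s : ℝ} (hs : 1 ≤ s) :
    a^p*(p-1) * (k s)^(p-2) * (1 + g (k s))⁻¹ * (k s - s + 1) * s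
      = 1 + a^p*(p-1)*(k s - s + 1) * (k s)^(p-1) := by
  have hk : 1/a ≤ k s := S.ak.2 hs
  have hk0 : 0 < k s := lt_of_lt_of_le (by have := S.a0; positivity) hk
  have h := S.ode _ hk
  rw [rpow_split hk0.le S.hp] at *
  have hg := S.gnn (k s)
  have hg' : 1 + g (k s) ≠ 0 := by positivity
  have e1 := S.Γk s
  have e2 : Γ (k s) = s - k s := by linarith
  rw [e1, e2] at h
  field_simp
  linarith

/-- derivative of the function `T`. -/
lemma Sys.dT (S : Sys p a Γ g k) {s : ℝ} (hs : 1 ≤ s) :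
    HasDerivAt (fun s => (1 + a^p*(p-1)*(k s - s + 1) * (k s)^(p-1)) / s)
      (-(a^p*(p-1) * (k s)^(p-2) * (1 + g (k s))⁻¹) *
        (g (k s) * k s - (p-2)*(k s - s + 1)) / s) s := by
  have hk : 1/a ≤ k s := S.ak.2 hs
  have hk0 : 0 < k s := lt_of_lt_of_le (by have := S.a0; positivity) hk
  have d := S.dk s
  have hg := S.gnn (k s)
  have hg' : 1 + g (k s) ≠ 0 := by positivity
  have d1 := ((((d.sub (hasDerivAt_id s)).add_const 1).const_mul (a^p*(p-1))).mul
    (d.rpow_const (p := p-1) (Or.inl hk0.ne'))).const_add 1 |>.div (hasDerivAt_id s)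
      (show id s ≠ 0 by simp; linarith)
  refine d1.congr_deriv ?_
  have hT := S.T hs
  simp only [id, Pi.sub_apply, Pi.mul_apply] at *
  rw [← hT]
  rw [show p - 1 - 1 = p - 2 by ring, rpow_split hk0.le S.hp]
  have hs0 : s ≠ 0 := by linarith
  set v := k s - s + 1
  field_simp
  ring

end

/-- the auxiliary maximum `K` -/
noncomputable def KK (k : ℝ → ℝ) (x Y : ℝ) : ℝ := max x (max Y 1 * k ((x+Y)/max Y 1))

/-- the `y`-derivative for positive `y` -/
noncomputable def FF (p a : ℝ) (g k : ℝ → ℝ) (x Y : ℝ) : ℝ :=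
  p * (a^p*(p-1)) * (KK k x Y)^(p-2) * (KK k x Y - x) * (1 + g (k ((x+Y)/max Y 1)))⁻¹

/-- `Q` -/
noncomputable def QQ (p x K : ℝ) : ℝ := p * K^(p-1) * x - (p-1)*K^p

/-- explicit formula for `U(.,.,1)` -/
noncomputable def VV (p a : ℝ) (k : ℝ → ℝ) (x y : ℝ) : ℝ :=
  (max |y| 1)^p - a^p * QQ p x (KK k x |y|)

/-- explicit `x`-derivative -/
noncomputable def Vx (p a : ℝ) (g k : ℝ → ℝ) (x y : ℝ) : ℝ :=
  FF p a g k x (max y 0) + FF p a g k x (max (-y) 0) - p * a^p * (KK k x |y|)^(p-1)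

/-- explicit `y`-derivative -/
noncomputable def Vy (p a : ℝ) (g k : ℝ → ℝ) (x y : ℝ) : ℝ :=
  FF p a g k x (max y 0) - FF p a g k x (max (-y) 0)

section
variable {p a : ℝ} {Γ g k : ℝ → ℝ}

lemma Q_self {x : ℝ} (hx : 0 ≤ x) (hp : 2 ≤ p) : QQ p x x = x^p := by
  unfold QQ
  rw [rpow_split' hx hp]; ring

lemma Sys.K_small (S : Sys p a Γ g k) {x Y : ℝ} (hx : 0 ≤ x) (hY : Y ≤ 1/p) : KK k x Y = x := by
  unfold KK
  have hp := S.hp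
  have h1 : Y ≤ 1 := hY.trans (by rw [div_le_one S.p0]; linarith)
  rw [max_eq_right h1, div_one, one_mul]
  apply max_eq_left
  rw [S.kle]
  have h2 := S.Γmono hx
  rw [S.Γl 0 (by have := S.a0; positivity)] at h2
  linarith

lemma F_self {x Y : ℝ} (h : KK k x Y = x) : FF p a g k x Y = 0 := by
  unfold FF
  rw [h]; ring

lemma Sys.F_zero (S : Sys p a Γ g k) {x : ℝ} (hx : 0 ≤ x) : FF p a g k x 0 = 0 :=
  F_self (S.K_small hx (by have := S.p0; positivity))

lemma dQ (hp : 2 ≤ p) {x c e' : ℝ} (hx : 0 ≤ x) {e : ℝ → ℝ} (he : HasDerivAt e e' 0) :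
    HasDerivWithinAt (fun t => QQ p (x+c*t) (max (x+c*t) (e t)))
      (p * (max x (e 0))^(p-1) * c - p*(p-1)*(max x (e 0))^(p-2)*(max x (e 0) - x)*e')
      {t | 0 ≤ x + c*t} 0 := by
  have hX : HasDerivAt (fun t => x + c*t) c 0 := by
    simpa using ((hasDerivAt_id (0:ℝ)).const_mul c).const_add x
  have hx1 : HasDerivAt (fun t => (x+c*t)^p) (p * x^(p-1) * c) 0 := by
    refine (hX.rpow_const (p := p) (Or.inr (by linarith))).congr_deriv ?_
    simp; ring
  have hx2 : HasDerivAt (fun t => QQ p (x+c*t) (e t))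
      (p * (e 0)^(p-1) * c + p*(p-1)*(e 0)^(p-2) * x * e' - p*(p-1)*(e 0)^(p-1)*e') 0 := by
    unfold QQ
    refine ((((he.rpow_const (p := p-1) (Or.inr (by linarith))).const_mul p).mul hX).sub
      ((he.rpow_const (p := p) (Or.inr (by linarith))).const_mul (p-1))).congr_deriv ?_
    rw [show p - 1 - 1 = p - 2 by ring]
    simp; ring
  rcases lt_trichotomy (e 0) x with h | h | h
  · rw [max_eq_left h.le]
    refine (hx1.hasDerivWithinAt.congr_of_eventuallyEq ?_ ?_).congr_deriv (by ring)
    · have : ∀ᶠ t in 𝓝 (0:ℝ), e t < x + c*t :=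
        he.continuousAt.eventually_lt hX.continuousAt (by simpa using h)
      filter_upwards [nhdsWithin_le_nhds this, self_mem_nhdsWithin] with t ht ht2
      rw [max_eq_left ht.le, Q_self ht2 hp]
    · simp only [mul_zero, add_zero]
      rw [max_eq_left h.le, Q_self hx hp]
  · rw [h, max_self]
    refine glue (f := fun t => (x+c*t)^p) (g := fun t => QQ p (x+c*t) (e t))
      (hx1.hasDerivWithinAt.congr_deriv (by ring))
      (hx2.hasDerivWithinAt.congr_deriv ?_) ?_ ?_ ?_
    · rw [h, rpow_split hx hp]; ring
    · simp only [mul_zero, add_zero, h, max_self]; rw [Q_self hx hp]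
    · simp only [mul_zero, add_zero, h, max_self]
    · filter_upwards [self_mem_nhdsWithin] with t ht
      rcases le_total (e t) (x+c*t) with h | h
      · left; rw [max_eq_left h, Q_self ht hp]
      · right; rw [max_eq_right h]
  · rw [max_eq_right h.le]
    refine (hx2.hasDerivWithinAt.congr_of_eventuallyEq ?_ ?_).congr_deriv ?_
    · have : ∀ᶠ t in 𝓝 (0:ℝ), x + c*t < e t :=
        hX.continuousAt.eventually_lt he.continuousAt (by simpa using h)
      filter_upwards [nhdsWithin_le_nhds this] with t ht
      rw [max_eq_right ht.le]
    · simp only [mul_zero, add_zero]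
      rw [max_eq_right h.le]
    · rw [rpow_split (hx.trans h.le) hp]; ring

/-- for a moving scale `Z`. -/
lemma Sys.dZ (S : Sys p a Γ g k) {x y c d Z' : ℝ} (hx : 0 ≤ x) {Z : ℝ → ℝ}
    (hZ : HasDerivAt Z Z' 0) (hZ0 : 0 < Z 0) :
    HasDerivWithinAt (fun t => (Z t)^p - a^p * QQ p (x+c*t)
        (max (x+c*t) (Z t * k ((x+c*t+(y+d*t))/Z t))))
      (p * (Z 0)^(p-1) * Z' - a^p * (p * (max x (Z 0 * k ((x+y)/Z 0)))^(p-1) * c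
        - p*(p-1)*(max x (Z 0 * k ((x+y)/Z 0)))^(p-2)*(max x (Z 0 * k ((x+y)/Z 0)) - x)
          * (Z' * k ((x+y)/Z 0) + (1 + g (k ((x+y)/Z 0)))⁻¹ * (c + d - (x+y)/Z 0 * Z'))))
      {t | 0 ≤ x + c*t} 0 := by
  have hs : HasDerivAt (fun t => (x+c*t+(y+d*t))) (c+d) 0 := by
    refine ((((hasDerivAt_id (0:ℝ)).const_mul c).const_add x).add
      (((hasDerivAt_id (0:ℝ)).const_mul d).const_add y)).congr_deriv ?_
    ring
  have hsz := hs.div hZ hZ0.ne'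
  have hk : HasDerivAt (fun t => k ((x+c*t+(y+d*t))/Z t)) _ 0 :=
    HasDerivAt.comp (h₂ := k) (h := fun t => (x+c*t+(y+d*t))/Z t) 0 (S.dk _) hsz
  have he := hZ.mul hk
  have := ((hZ.rpow_const (p := p) (Or.inl hZ0.ne')).hasDerivWithinAt
    (s := {t | 0 ≤ x + c*t})).sub ((dQ (c := c) S.hp hx he).const_mul (a^p))
  refine this.congr_deriv ?_
  simp only [mul_zero, add_zero, Pi.mul_apply]
  field_simp

lemma Sys.VxVy (S : Sys p a Γ g k) {x y : ℝ} (hx : 0 ≤ x) (hy : 0 ≤ y) (c d : ℝ) :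
    c * Vx p a g k x y + d * Vy p a g k x y = 
      (c+d) * FF p a g k x y - p * a^p * (KK k x y)^(p-1) * c := by
  unfold Vx Vy
  rw [max_eq_left hy, max_eq_right (by linarith : -y ≤ 0), abs_of_nonneg hy, S.F_zero hx]
  ring

lemma Sys.outer_gt (S : Sys p a Γ g k) {x y : ℝ} (hy : 1 ≤ y) : x < y * k ((x+y)/y) := by
  have hy0 : 0 < y := by linarith
  rw [← div_lt_iff₀' hy0, S.ltk, add_div, div_self hy0.ne']
  linarith [S.Γ1 (x/y)]

lemma Sys.dV_pos (S : Sys p a Γ g k) {x y : ℝ} (hx : 0 ≤ x) (hy : 0 ≤ y) (c d : ℝ) :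
    HasDerivWithinAt (fun t => VV p a k (x+c*t) (y+d*t))
      (c * Vx p a g k x y + d * Vy p a g k x y) {t | 0 ≤ x + c*t} 0 := by
  rw [S.VxVy hx hy]
  have hp := S.hp
  have hp0 := S.p0
  have hpc : ContinuousAt (fun t => y + d*t) 0 := by fun_prop
  rcases lt_or_ge y (1/p) with h | h
  · have hX : HasDerivAt (fun t => x + c*t) c 0 := by
      simpa using ((hasDerivAt_id (0:ℝ)).const_mul c).const_add x
    have hx1 : HasDerivAt (fun t => 1 - a^p * (x+c*t)^p) (-(a^p * (p * x^(p-1) * c))) 0 := by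
      refine (((hX.rpow_const (p := p) (Or.inr (by linarith))).const_mul (a^p)).const_sub 
        1).congr_deriv ?_
      simp only [mul_zero, add_zero]; ring
    have key : ∀ x' y', 0 ≤ x' → |y'| ≤ 1/p → VV p a k x' y' = 1 - a^p * x'^p := by
      intro x' y' h1 h2
      unfold VV
      rw [S.K_small h1 h2, Q_self h1 hp, max_eq_right, Real.one_rpow]
      exact h2.trans (by rw [div_le_one hp0]; linarith)
    refine (hx1.hasDerivWithinAt.congr_of_eventuallyEq ?_ ?_).congr_deriv ?_
    · have : ∀ᶠ t in 𝓝 (0:ℝ), |y + d*t| < 1/p :=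
        hpc.abs.eventually_lt continuousAt_const (by simpa [abs_of_nonneg hy] using h)
      filter_upwards [nhdsWithin_le_nhds this, self_mem_nhdsWithin] with t ht ht2
      exact key _ _ ht2 ht.le
    · simp only [mul_zero, add_zero]
      exact key _ _ hx (by rw [abs_of_nonneg hy]; exact h.le)
    · rw [F_self (S.K_small hx h.le), S.K_small hx h.le]; ring
  · have hy0 : 0 < y := lt_of_lt_of_le (by positivity) h
    have hpos : ∀ᶠ t in 𝓝 (0:ℝ), 0 < y + d*t :=
      continuousAt_const.eventually_lt hpc (by simpa using hy0)
    have hZ1 := S.dZ (y := y) (c := c) (d := d) hx (hasDerivAt_const (0:ℝ) (1:ℝ)) (by norm_num)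
    have hYd : HasDerivAt (fun t => y + d*t) d 0 := by
      simpa using ((hasDerivAt_id (0:ℝ)).const_mul d).const_add y
    have hZ2 := S.dZ (y := y) (c := c) (d := d) hx hYd (by simpa using hy0)
    have D1 : y ≤ 1 → HasDerivWithinAt _ ((c+d) * FF p a g k x y - p * a^p * (KK k x y)^(p-1) * c)
        {t | 0 ≤ x + c*t} 0 := fun hy1 => hZ1.congr_deriv (by
      unfold FF KK
      rw [max_eq_right hy1]
      simp only [div_one, one_mul]
      ring)
    have D2 : 1 ≤ y → HasDerivWithinAt _ ((c+d) * FF p a g k x y - p * a^p * (KK k x y)^(p-1) * c)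
        {t | 0 ≤ x + c*t} 0 := fun hy1 => hZ2.congr_deriv (by
      unfold FF KK
      rw [max_eq_left hy1]
      simp only [mul_zero, add_zero]
      have hgt := S.outer_gt (x := x) hy1
      rw [max_eq_right hgt.le]
      have hs : 1 ≤ (x+y)/y := by rw [le_div_iff₀ hy0]; linarith
      have hT := S.T hs
      have hk0 : 0 < k ((x+y)/y) := lt_of_lt_of_le (by have := S.a0; positivity) (S.ak.2 hs)
      rw [rpow_split hk0.le hp] at hT
      rw [Real.mul_rpow hy0.le hk0.le, Real.mul_rpow hy0.le hk0.le, rpow_split hy0.le hp,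
        rpow_split hk0.le hp]
      have e1 : y * k ((x+y)/y) - x = y * (k ((x+y)/y) - (x+y)/y + 1) := by
        field_simp; ring
      rw [e1]
      set σ := (x+y)/y
      generalize (1 + g (k σ))⁻¹ = η at *
      generalize k σ - σ + 1 = v at *
      generalize k σ ^ (p-2) = A at *
      generalize y ^ (p-2) = B at *
      linear_combination (-(p * d * y * B)) * hT)
    have hV : ∀ t, 0 < y + d*t → (y+d*t ≤ 1 → VV p a k (x+c*t) (y+d*t) =
        (fun _ => (1:ℝ)) t^p - a^p * QQ p (x+c*t)
        (max (x+c*t) ((fun _ => (1:ℝ)) t * k ((x+c*t+(y+d*t))/(fun _ => (1:ℝ)) t)))) ∧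
        (1 ≤ y+d*t → VV p a k (x+c*t) (y+d*t) =
        ((fun t => y+d*t) t)^p - a^p * QQ p (x+c*t)
        (max (x+c*t) ((fun t => y+d*t) t * k ((x+c*t+(y+d*t))/(fun t => y+d*t) t)))) := by
      intro t ht
      unfold VV KK
      rw [abs_of_pos ht]
      constructor
      · intro h; rw [max_eq_right h]
      · intro h; rw [max_eq_left h]
    have hV0 := hV 0 (by simpa using hy0)
    simp only [mul_zero, add_zero] at hV0
    rcases lt_trichotomy y 1 with h1 | h1 | h1
    · refine (D1 h1.le).congr_of_eventuallyEq ?_ (by simpa using hV0.1 h1.le)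
      have : ∀ᶠ t in 𝓝 (0:ℝ), y + d*t < 1 :=
        hpc.eventually_lt continuousAt_const (by simpa using h1)
      filter_upwards [nhdsWithin_le_nhds this, nhdsWithin_le_nhds hpos] with t ht ht2
      exact (hV t ht2).1 ht.le
    · refine glue (D1 h1.le) (D2 h1.ge) (by simpa using hV0.1 h1.le) (by simpa using hV0.2 h1.ge) ?_
      filter_upwards [nhdsWithin_le_nhds hpos] with t ht2
      rcases le_total (y+d*t) 1 with h | h
      · left; exact (hV t ht2).1 h
      · right; exact (hV t ht2).2 h
    · refine (D2 h1.le).congr_of_eventuallyEq ?_ (by simpa using hV0.2 h1.le)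
      have : ∀ᶠ t in 𝓝 (0:ℝ), 1 < y + d*t :=
        continuousAt_const.eventually_lt hpc (by simpa using h1)
      filter_upwards [nhdsWithin_le_nhds this, nhdsWithin_le_nhds hpos] with t ht ht2
      exact (hV t ht2).2 ht.le

lemma Sys.dV (S : Sys p a Γ g k) {x : ℝ} (hx : 0 ≤ x) (y c d : ℝ) :
    HasDerivWithinAt (fun t => VV p a k (x+c*t) (y+d*t))
      (c * Vx p a g k x y + d * Vy p a g k x y) {t | 0 ≤ x + c*t} 0 := by
  rcases le_total 0 y with h | h
  · exact S.dV_pos hx h c d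
  · have := S.dV_pos hx (neg_nonneg.2 h) c (-d)
    have e : ∀ x y, VV p a k x (-y) = VV p a k x y := by
      intro x y; unfold VV; rw [abs_neg]
    have e1 : Vx p a g k x (-y) = Vx p a g k x y := by
      unfold Vx; rw [abs_neg, neg_neg]; ring
    have e2 : Vy p a g k x (-y) = - Vy p a g k x y := by
      unfold Vy; rw [neg_neg]; ring
    rw [e1, e2] at this
    refine (this.congr_deriv (by ring)).congr_of_eventuallyEq ?_ ?_
    · refine Eventually.of_forall fun t => ?_
      simp only
      rw [← e]; congr 1; ring
    · rw [← e]; congr 1; ring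

end

section
variable {p a : ℝ} {Γ g k : ℝ → ℝ}

lemma Sys.core1 (S : Sys p a Γ g k) {X Y : ℝ → ℝ} {τ κ : ℝ} (hX : HasDerivAt X 1 τ)
    (hY : HasDerivAt Y κ τ) (hκ1 : -1 ≤ κ) (hκ2 : κ ≤ 1) (hx : 0 < X τ)
    (hy1 : Y τ < 1) (hs : X τ + Y τ < 1) (hK : X τ < k (X τ + Y τ)) :
    ∃ D, D ≤ 0 ∧ HasDerivAt (fun t => (1+κ) * FF p a g k (X t) (Y t)
      - p * a^p * (KK k (X t) (Y t))^(p-1)) D τ := by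
  have hp := S.hp
  have hp0 := S.p0
  have ha0 := S.a0
  have hsd : HasDerivAt (fun t => X t + Y t) (1+κ) τ := hX.add hY
  have hkd : HasDerivAt (fun t => k (X t + Y t)) ((1 + g (k (X τ + Y τ)))⁻¹ * (1+κ)) τ :=
    HasDerivAt.comp (h₂ := k) (h := fun t => X t + Y t) τ (S.dk _) hsd
  have hk0 : 0 < k (X τ + Y τ) := hx.trans hK
  have hg : ∀ s, s ≤ 1 → (1 + g (k s))⁻¹ = p/((p-1)*a) := by
    intro s hs
    rw [S.gl _ (S.ka.2 hs)]
    have : p - 1 ≠ 0 := by linarith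
    field_simp; ring
  rw [hg _ hs.le] at hkd
  set l := p/((p-1)*a) with hl
  have hl0 : 0 < l := div_pos hp0 (mul_pos (by linarith) ha0)
  have hl1 : (p-1)*l ≤ 1 := by
    rw [hl]
    have : p - 1 ≠ 0 := by linarith
    have e : (p-1)*(p/((p-1)*a)) = p/a := by field_simp
    rw [e, div_le_one ha0]; exact S.ha.le
  have hev : (fun t => (1+κ) * FF p a g k (X t) (Y t) - p * a^p * (KK k (X t) (Y t))^(p-1)) =ᶠ[𝓝 τ]
      (fun t => (1+κ) * (p * (a^p*(p-1)) * ((k (X t + Y t))^(p-2) * (k (X t + Y t) - X t)) * l)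
        - p * a^p * (k (X t + Y t))^(p-1)) := by
    have e1 : ∀ᶠ t in 𝓝 τ, Y t < 1 := hY.continuousAt.eventually_lt continuousAt_const hy1
    have e2 : ∀ᶠ t in 𝓝 τ, X t + Y t < 1 := hsd.continuousAt.eventually_lt continuousAt_const hs
    have e3 : ∀ᶠ t in 𝓝 τ, X t < k (X t + Y t) :=
      hX.continuousAt.eventually_lt hkd.continuousAt hK
    filter_upwards [e1, e2, e3] with t h1 h2 h3
    unfold FF KK
    rw [max_eq_right h1.le, div_one, one_mul, max_eq_right h3.le, hg _ h2.le]
    ring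
  have hd := ((((((hkd.rpow_const (p := p-2) (Or.inl hk0.ne')).mul (hkd.sub hX)).const_mul
    (p * (a^p*(p-1)))).mul_const l).const_mul (1+κ)).sub
      ((hkd.rpow_const (p := p-1) (Or.inl hk0.ne')).const_mul (p * a^p)))
  refine ⟨_, ?_, hd.congr_of_eventuallyEq hev⟩
  rw [show p - 1 - 1 = p - 2 by ring, Real.rpow_sub_one hk0.ne']
  simp only [Pi.sub_apply]
  have hA : 0 < (k (X τ + Y τ))^(p-2) := Real.rpow_pos_of_pos hk0 _
  have hC := S.C0
  have key : (p-2)*l*(1+κ)*((k (X τ + Y τ) - X τ)/k (X τ + Y τ)) + l*(1+κ) - 2 ≤ 0 := by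
    have h1 : (k (X τ + Y τ) - X τ)/k (X τ + Y τ) ≤ 1 := by
      rw [div_le_one hk0]; linarith
    have h2 : (p-2)*l*(1+κ)*((k (X τ + Y τ) - X τ)/k (X τ + Y τ)) ≤ (p-2)*l*(1+κ) * 1 :=
      mul_le_mul_of_nonneg_left h1
        (mul_nonneg (mul_nonneg (by linarith) hl0.le) (by linarith))
    nlinarith [mul_le_mul_of_nonneg_left hl1 (by linarith : (0:ℝ) ≤ 1+κ)]
  have h3 : 0 ≤ (1+κ) * p * (a^p*(p-1)) * l * (k (X τ + Y τ))^(p-2) := by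
    have : 0 ≤ 1+κ := by linarith
    positivity
  refine le_of_eq_of_le ?_ (mul_nonpos_of_nonneg_of_nonpos h3 key)
  field_simp
  ring

lemma Sys.core2 (S : Sys p a Γ g k) {X Y : ℝ → ℝ} {τ κ : ℝ} (hX : HasDerivAt X 1 τ)
    (hY : HasDerivAt Y κ τ) (hκ1 : -1 ≤ κ) (hκ2 : κ ≤ 1) (hx : 0 < X τ)
    (hy1 : Y τ < 1) (hs : 1 < X τ + Y τ) (hK : X τ < k (X τ + Y τ)) :
    ∃ D, D ≤ 0 ∧ HasDerivAt (fun t => (1+κ) * FF p a g k (X t) (Y t)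
      - p * a^p * (KK k (X t) (Y t))^(p-1)) D τ := by
  have hp := S.hp
  have hp0 := S.p0
  have ha0 := S.a0
  have hsd : HasDerivAt (fun t => X t + Y t) (1+κ) τ := hX.add hY
  have hkd : HasDerivAt (fun t => k (X t + Y t)) ((1 + g (k (X τ + Y τ)))⁻¹ * (1+κ)) τ :=
    HasDerivAt.comp (h₂ := k) (h := fun t => X t + Y t) τ (S.dk _) hsd
  have hTd : HasDerivAt (fun t => (1 + a^p*(p-1)*(k (X t + Y t) - (X t + Y t) + 1)
      * (k (X t + Y t))^(p-1)) / (X t + Y t)) _ τ :=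
    HasDerivAt.comp (h₂ := fun s => (1 + a^p*(p-1)*(k s - s + 1) * (k s)^(p-1)) / s)
      (h := fun t => X t + Y t) τ (S.dT hs.le) hsd
  have hk0 : 0 < k (X τ + Y τ) := hx.trans hK
  have hev : (fun t => (1+κ) * FF p a g k (X t) (Y t) - p * a^p * (KK k (X t) (Y t))^(p-1)) =ᶠ[𝓝 τ]
      (fun t => (1+κ) * (p * ((1 + a^p*(p-1)*(k (X t + Y t) - (X t + Y t) + 1)
      * (k (X t + Y t))^(p-1)) / (X t + Y t) * (k (X t + Y t) - X t) /
        (k (X t + Y t) - (X t + Y t) + 1)))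
        - p * a^p * (k (X t + Y t))^(p-1)) := by
    have e1 : ∀ᶠ t in 𝓝 τ, Y t < 1 := hY.continuousAt.eventually_lt continuousAt_const hy1
    have e2 : ∀ᶠ t in 𝓝 τ, 1 < X t + Y t := continuousAt_const.eventually_lt hsd.continuousAt hs
    have e3 : ∀ᶠ t in 𝓝 τ, X t < k (X t + Y t) :=
      hX.continuousAt.eventually_lt hkd.continuousAt hK
    filter_upwards [e1, e2, e3] with t h1 h2 h3
    unfold FF KK
    rw [max_eq_right h1.le, div_one, one_mul, max_eq_right h3.le, ← S.T h2.le]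
    have hv := S.vpos (X t + Y t)
    have : 0 < X t + Y t := by linarith
    have hg := S.gnn (k (X t + Y t))
    set σ := X t + Y t
    set v := k σ - σ + 1
    field_simp
  have hv := S.vpos (X τ + Y τ)
  have hd := ((((hTd.mul (hkd.sub hX)).div ((hkd.sub hsd).add_const 1) hv.ne').const_mul
    p).const_mul (1+κ)).sub ((hkd.rpow_const (p := p-1) (Or.inl hk0.ne')).const_mul (p * a^p))
  refine ⟨_, ?_, hd.congr_of_eventuallyEq hev⟩
  simp only [Pi.sub_apply, Pi.mul_apply]
  rw [show p - 1 - 1 = p - 2 by ring, ← S.T hs.le]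
  have hA : 0 < (k (X τ + Y τ))^(p-2) := Real.rpow_pos_of_pos hk0 _
  have hC := S.C0
  have hg := S.gnn (k (X τ + Y τ))
  have hco := S.conc _ (S.ak'.2 hs)
  rw [S.Γk] at hco
  have hxv : k (X τ + Y τ) - X τ ≤ k (X τ + Y τ) - (X τ + Y τ) + 1 := by linarith
  have hxv0 : 0 < k (X τ + Y τ) - X τ := by linarith
  set σ := X τ + Y τ
  set h := k σ
  set v := h - σ + 1
  set m := g h
  set x := X τ
  have hη1 : (1+m)⁻¹ ≤ 1 := inv_le_one_of_one_le₀ (by linarith)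
  have hη0 : 0 < (1+m)⁻¹ := by positivity
  have hη : 1 - (1+m)⁻¹ = m * (1+m)⁻¹ := by field_simp; ring
  have hσ : 0 < σ := by linarith
  have key : (1+κ)*((h - x)/v)*((1 - (1+m)⁻¹) - (m*h - (p-2)*v)/σ) + (1+κ)*(1+m)⁻¹ - 2 ≤ 0 := by
    have t1 : (h-x)/v ≤ 1 := (div_le_one hv).2 hxv
    have t0 : 0 < (h-x)/v := div_pos hxv0 hv
    have t2 : 0 ≤ (m*h - (p-2)*v)/σ := div_nonneg (by linarith) hσ.le
    have t3 : ((h - x)/v)*((1 - (1+m)⁻¹) - (m*h - (p-2)*v)/σ) ≤ 1 - (1+m)⁻¹ := by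
      nlinarith
    nlinarith [mul_le_mul_of_nonneg_left t3 (by linarith : (0:ℝ) ≤ 1+κ)]
  have h3 : 0 ≤ (1+κ) * p * (a^p*(p-1)) * (1+m)⁻¹ * h^(p-2) := by
    have : 0 ≤ 1+κ := by linarith
    positivity
  refine le_of_eq_of_le ?_ (mul_nonpos_of_nonneg_of_nonpos h3 key)
  generalize (1+m)⁻¹ = η at *
  generalize h^(p-2) = A at *
  field_simp
  ring

lemma Sys.core3 (S : Sys p a Γ g k) {X Y : ℝ → ℝ} {τ κ : ℝ} (hX : HasDerivAt X 1 τ)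
    (hY : HasDerivAt Y κ τ) (hκ1 : -1 ≤ κ) (hκ2 : κ ≤ 1) (hx : 0 < X τ)
    (hy1 : 1 < Y τ) :
    ∃ D, D ≤ 0 ∧ HasDerivAt (fun t => (1+κ) * FF p a g k (X t) (Y t)
      - p * a^p * (KK k (X t) (Y t))^(p-1)) D τ := by
  have hp := S.hp
  have hp0 := S.p0
  have ha0 := S.a0
  have hy0 : 0 < Y τ := by linarith
  have hsd : HasDerivAt (fun t => (X t + Y t)/Y t) (((1+κ)*Y τ - (X τ + Y τ)*κ)/(Y τ)^2) τ :=
    (hX.add hY).div hY hy0.ne'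
  have hs : 1 < (X τ + Y τ)/Y τ := by rw [lt_div_iff₀ hy0]; linarith
  have hkd : HasDerivAt (fun t => k ((X t + Y t)/Y t)) _ τ :=
    HasDerivAt.comp (h₂ := k) (h := fun t => (X t + Y t)/Y t) τ (S.dk _) hsd
  have hTd : HasDerivAt (fun t => (1 + a^p*(p-1)*(k ((X t + Y t)/Y t) - ((X t + Y t)/Y t) + 1)
      * (k ((X t + Y t)/Y t))^(p-1)) / ((X t + Y t)/Y t)) _ τ :=
    HasDerivAt.comp (h₂ := fun s => (1 + a^p*(p-1)*(k s - s + 1) * (k s)^(p-1)) / s)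
      (h := fun t => (X t + Y t)/Y t) τ (S.dT hs.le) hsd
  have hka := S.ak'.2 hs
  have hk0 : 0 < k ((X τ + Y τ)/Y τ) := lt_trans (by positivity) hka
  have hev : (fun t => (1+κ) * FF p a g k (X t) (Y t) - p * a^p * (KK k (X t) (Y t))^(p-1)) =ᶠ[𝓝 τ]
      (fun t => (1+κ) * (p * (((Y t)^(p-1)) *
        ((1 + a^p*(p-1)*(k ((X t + Y t)/Y t) - ((X t + Y t)/Y t) + 1)
      * (k ((X t + Y t)/Y t))^(p-1)) / ((X t + Y t)/Y t))))
        - p * a^p * ((Y t)^(p-1) * (k ((X t + Y t)/Y t))^(p-1))) := by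
    have e1 : ∀ᶠ t in 𝓝 τ, 1 < Y t := continuousAt_const.eventually_lt hY.continuousAt hy1
    have e2 : ∀ᶠ t in 𝓝 τ, 1 < (X t + Y t)/Y t :=
      continuousAt_const.eventually_lt hsd.continuousAt hs
    filter_upwards [e1, e2] with t h1 h2
    have hY0 : 0 < Y t := by linarith
    have hk0 : 0 < k ((X t + Y t)/Y t) := lt_trans (by positivity) (S.ak'.2 h2)
    unfold FF KK
    rw [max_eq_left h1.le, max_eq_right (S.outer_gt h1.le).le, ← S.T h2.le]
    have hv := S.vpos ((X t + Y t)/Y t)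
    have e1 : Y t * k ((X t + Y t)/Y t) - X t = 
        Y t * (k ((X t + Y t)/Y t) - (X t + Y t)/Y t + 1) := by
      field_simp; ring
    rw [e1, Real.mul_rpow hY0.le hk0.le, Real.mul_rpow hY0.le hk0.le, rpow_split hY0.le hp]
    have hg := S.gnn (k ((X t + Y t)/Y t))
    have hσ : (X t + Y t)/Y t ≠ 0 := by linarith
    generalize (X t + Y t)/Y t = σ at *
    generalize hvv : k σ - σ + 1 = v at *
    field_simp
  have hv := S.vpos ((X τ + Y τ)/Y τ)
  have hd := ((((hY.rpow_const (p := p-1) (Or.inl hy0.ne')).mul hTd).const_mul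
    p).const_mul (1+κ)).sub (((hY.rpow_const (p := p-1) (Or.inl hy0.ne')).mul
      (hkd.rpow_const (p := p-1) (Or.inl hk0.ne'))).const_mul (p * a^p))
  refine ⟨_, ?_, hd.congr_of_eventuallyEq hev⟩
  rw [← S.T hs.le]
  rw [show p - 1 - 1 = p - 2 by ring, rpow_split hy0.le hp, rpow_split hk0.le hp]
  have hA : 0 < (k ((X τ + Y τ)/Y τ))^(p-2) := Real.rpow_pos_of_pos hk0 _
  have hB : 0 < (Y τ)^(p-2) := Real.rpow_pos_of_pos hy0 _
  have hC := S.C0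
  have hg := S.gnn (k ((X τ + Y τ)/Y τ))
  have hco := S.conc _ hka
  have hode := S.ode _ hka.le
  have hva := S.v _ hka.le
  have hkr := S.kr ((X τ + Y τ)/Y τ)
  rw [S.Γk] at hco hva hode
  have es : ((1+κ)*Y τ - (X τ + Y τ)*κ)/(Y τ)^2 = (1 + κ - κ*((X τ + Y τ)/Y τ))/Y τ := by
    field_simp
  rw [es]
  generalize (X τ + Y τ)/Y τ = σ at *
  set h := k σ
  generalize hvv : h - σ + 1 = v at *
  generalize Γ h = G at *
  set m := g h
  generalize Y τ = y at *
  -- bounds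
  have hGm : m * h ≤ G := by
    have hAA : 0 < h^(p-1) := Real.rpow_pos_of_pos hk0 _
    rw [rpow_split hk0.le hp] at hode
    have h0 : 0 < 1 + a ^ p * (p - 1) * v * (h^(p-2) * h) := by positivity
    have : (G - m*h) * (1 + a ^ p * (p - 1) * v * (h^(p-2) * h)) = σ := by
      linear_combination (-h) * hode + hkr
    by_contra hcon
    have : (G - m*h) * (1 + a ^ p * (p - 1) * v * (h^(p-2) * h)) < 0 :=
      mul_neg_of_neg_of_pos (by linarith) h0
    linarith
  have hGv : G = 1 - v := by linarith
  have hσ : 0 < σ := by linarith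
  have hω : 0 ≤ 1 + κ := by linarith
  have key : (1+κ)*((p-1)*κ*v + (m*h - (p-2)*v)*(κ - (1+κ)/σ)) - (1+κ) + κ*(G - m*h) ≤ 0 := by
    generalize hM : m*h = M at *
    have hv1 : v*(p-1) ≤ 1 := by
      have : v * (p-1) ≤ 1/a * (p-1) := mul_le_mul_of_nonneg_right hva (by linarith)
      have h2 : 1/a*(p-1) ≤ 1 := by
        rw [one_div, inv_mul_le_iff₀ ha0]; linarith [S.ha]
      linarith
    have hκκ : κ^2 ≤ 1 := by nlinarith
    -- endpoint values
    have E1 : v*(p-1)*κ^2 - 1 ≤ 0 := by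
      nlinarith [mul_nonneg hv.le (by linarith : (0:ℝ) ≤ p-1)]
    have E2 : (1+κ)*(κ-1) ≤ 0 := by nlinarith
    have hr : 0 ≤ (1+κ)^2/σ := by positivity
    have e : (1+κ)/σ*(1+κ) = (1+κ)^2/σ := by ring
    rw [show (1+κ)*((p-1)*κ*v + (M - (p-2)*v)*(κ - (1+κ)/σ)) - (1+κ) + κ*(G - M)
      = (v*(p-1)*κ^2 - 1) + (M - (p-2)*v)*(κ^2 - (1+κ)^2/σ) by rw [hGv]; ring]
    rcases le_total (κ^2) ((1+κ)^2/σ) with hc | hc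
    · have := mul_nonneg (by linarith : 0 ≤ M - (p-2)*v) (by linarith : 0 ≤ (1+κ)^2/σ - κ^2)
      nlinarith
    · have := mul_nonneg (by linarith : 0 ≤ G - M) (by linarith : 0 ≤ κ^2 - (1+κ)^2/σ)
      have h5 := mul_nonneg (by linarith : 0 ≤ G - (p-2)*v) hr
      have h6 : (G - (p-2)*v)*κ^2 + (v*(p-1)*κ^2 - 1) = (1+κ)*(κ-1) := by rw [hGv]; ring
      nlinarith
  have h3 : 0 ≤ p * (a^p*(p-1)) * (1+m)⁻¹ * h^(p-2) * y^(p-2) := by positivity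
  refine le_of_eq_of_le ?_ (mul_nonpos_of_nonneg_of_nonpos h3 key)
  have hm : 0 < 1 + m := by linarith
  have hσ' : σ = h + 1 - v := by linarith
  rw [hGv]
  generalize h^(p-2) = A at *
  generalize y^(p-2) = B at *
  field_simp
  rw [hσ']
  ring

lemma Sys.core (S : Sys p a Γ g k) {X Y : ℝ → ℝ} {τ κ : ℝ} (hX : HasDerivAt X 1 τ)
    (hY : HasDerivAt Y κ τ) (hκ1 : -1 ≤ κ) (hκ2 : κ ≤ 1) (hx : 0 < X τ)
    (hy1 : Y τ ≠ 1) (hs : X τ + Y τ ≠ 1) (hK : KK k (X τ) (Y τ) ≠ X τ) :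
    ∃ D, D ≤ 0 ∧ HasDerivAt (fun t => (1+κ) * FF p a g k (X t) (Y t)
      - p * a^p * (KK k (X t) (Y t))^(p-1)) D τ := by
  rcases lt_or_gt_of_ne hy1 with h | h
  · have hK' : X τ < k (X τ + Y τ) := by
      unfold KK at hK
      rw [max_eq_right h.le, div_one, one_mul] at hK
      by_contra hc
      exact hK (max_eq_left (not_lt.1 hc))
    rcases lt_or_gt_of_ne hs with h' | h'
    · exact S.core1 hX hY hκ1 hκ2 hx h h' hK'
    · exact S.core2 hX hY hκ1 hκ2 hx h h' hK'
  · exact S.core3 hX hY hκ1 hκ2 hx h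

end

section
variable {p a : ℝ} {Γ g k : ℝ → ℝ}

lemma Sys.Kcont (S : Sys p a Γ g k) : Continuous (fun q : ℝ × ℝ => KK k q.1 q.2) := by
  unfold KK
  have h : Continuous (fun q : ℝ × ℝ => max q.2 1) := continuous_snd.max continuous_const
  refine continuous_fst.max (h.mul (S.kcont.comp ((continuous_fst.add continuous_snd).div h ?_)))
  intro q
  have : (0:ℝ) < max q.2 1 := lt_max_of_lt_right one_pos
  exact this.ne'

lemma Sys.Fcont (S : Sys p a Γ g k) : Continuous (fun q : ℝ × ℝ => FF p a g k q.1 q.2) := by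
  unfold FF
  have hp := S.hp
  have h : Continuous (fun q : ℝ × ℝ => max q.2 1) := continuous_snd.max continuous_const
  refine (((continuous_const.mul (S.Kcont.rpow_const ?_)).mul (S.Kcont.sub continuous_fst)).mul
    (Continuous.inv₀ (continuous_const.add (S.gc.comp
      (S.kcont.comp ((continuous_fst.add continuous_snd).div h ?_)))) ?_))
  · intro q; right; linarith
  · intro q
    have : (0:ℝ) < max q.2 1 := lt_max_of_lt_right one_pos
    exact this.ne'
  · intro q
    have := S.gnn (k ((q.1 + q.2)/max q.2 1))
    positivity

lemma Sys.anti (S : Sys p a Γ g k) {x y κ t₁ t₂ : ℝ} (hκ1 : -1 < κ) (hκ2 : κ < 1) (hκ : κ ≠ 0)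
    (h1 : 0 ≤ x + t₁) (h12 : t₁ ≤ t₂) :
    1 * Vx p a g k (x+t₂) (y+κ*t₂) + κ * Vy p a g k (x+t₂) (y+κ*t₂) ≤
      1 * Vx p a g k (x+t₁) (y+κ*t₁) + κ * Vy p a g k (x+t₁) (y+κ*t₁) := by
  have hp := S.hp
  have hp0 := S.p0
  have ha0 := S.a0
  set N : ℝ → ℝ := fun t => 1 * Vx p a g k (x+t) (y+κ*t) + κ * Vy p a g k (x+t) (y+κ*t) with hN
  have hpt : Continuous (fun t => (x + t, |y + κ*t|)) := by fun_prop
  have hNc : Continuous N := by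
    rw [hN]
    unfold Vx Vy
    have c1 : Continuous (fun t => FF p a g k (x+t) (max (y+κ*t) 0)) :=
      S.Fcont.comp (f := fun t => (x + t, max (y+κ*t) 0)) (by fun_prop)
    have c2 : Continuous (fun t => FF p a g k (x+t) (max (-(y+κ*t)) 0)) :=
      S.Fcont.comp (f := fun t => (x + t, max (-(y+κ*t)) 0)) (by fun_prop)
    have c3 : Continuous (fun t => (KK k (x+t) |y+κ*t|)^(p-1)) :=
      (S.Kcont.comp hpt).rpow_const (fun t => Or.inr (by linarith))
    fun_prop
  have hNp : ∀ t, 0 ≤ x + t → 0 ≤ y + κ*t → N t = (1+κ) * FF p a g k (x+t) (y+κ*t)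
      - p * a^p * (KK k (x+t) (y+κ*t))^(p-1) := by
    intro t ht hy
    rw [hN]
    simp only
    rw [S.VxVy ht hy]; ring
  have hNm : ∀ t, 0 ≤ x + t → y + κ*t ≤ 0 → N t = (1+(-κ)) * FF p a g k (x+t) (-(y+κ*t))
      - p * a^p * (KK k (x+t) (-(y+κ*t)))^(p-1) := by
    intro t ht hy
    rw [hN]
    simp only
    unfold Vx Vy
    rw [max_eq_right hy, max_eq_left (by linarith : 0 ≤ -(y+κ*t)), abs_of_nonpos hy, S.F_zero ht]
    ring
  let A : Set ℝ := {t | KK k (x+t) |y+κ*t| = x+t}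
  have hA : IsClosed A := isClosed_eq (S.Kcont.comp hpt) (by fun_prop)
  have hNA : ∀ t, 0 ≤ x + t → t ∈ A → N t = - (p * a^p * (x+t)^(p-1)) := by
    intro t ht hA
    have hA : KK k (x+t) |y+κ*t| = x+t := hA
    rcases le_total 0 (y+κ*t) with h | h
    · rw [abs_of_nonneg h] at hA
      rw [hNp t ht h, F_self hA, hA]; ring
    · rw [abs_of_nonpos h] at hA
      rw [hNm t ht h, F_self hA, hA]; ring
  refine anti_closed N {(1-y)/κ, (-1-y)/κ, (1-x-y)/(1+κ), (1-x+y)/(1-κ)} A hA t₁ t₂ h12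
    hNc.continuousOn ?_ ?_
  · intro s hs t ht hst
    have hs0 : 0 ≤ x + s := by linarith [hs.2.1]
    rw [hNA s hs0 hs.1, hNA t (by linarith) ht.1]
    have : (x+s)^(p-1) ≤ (x+t)^(p-1) :=
      Real.rpow_le_rpow hs0 (by linarith) (by linarith)
    have h2 : 0 ≤ p * a^p := by positivity
    have := mul_le_mul_of_nonneg_left this h2
    linarith
  · intro t ht htS htA
    simp only [Finset.mem_insert, Finset.mem_singleton, not_or] at htS
    obtain ⟨s1, s2, s3, s4⟩ := htS
    have htA : KK k (x+t) |y+κ*t| ≠ x+t := htA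
    have hx : 0 < x + t := by linarith [ht.1]
    have hX : HasDerivAt (fun t => x + t) 1 t := (hasDerivAt_id t).const_add x
    have hY : HasDerivAt (fun t => y + κ*t) κ t := by
      simpa using ((hasDerivAt_id t).const_mul κ).const_add y
    have hxe : ∀ᶠ r in 𝓝 t, 0 < x + r := continuousAt_const.eventually_lt hX.continuousAt hx
    rcases lt_trichotomy (y+κ*t) 0 with h | h | h
    · rw [abs_of_neg h] at htA
      obtain ⟨D, hD, hd⟩ := S.core hX hY.neg (by linarith) (by linarith) hx
        (by
          intro hc
          apply s2
          rw [eq_div_iff hκ]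
          simp only [Pi.neg_apply] at hc
          linarith)
        (by
          intro hc
          apply s4
          rw [eq_div_iff (by linarith)]
          simp only [Pi.neg_apply] at hc
          linarith) htA
      refine ⟨D, hD, hd.congr_of_eventuallyEq ?_⟩
      have hye : ∀ᶠ r in 𝓝 t, y + κ*r < 0 := hY.continuousAt.eventually_lt continuousAt_const h
      filter_upwards [hxe, hye] with r h1 h2
      rw [hNm r h1.le h2.le]; rfl
    · exfalso
      apply htA
      rw [h, abs_zero]
      exact S.K_small hx.le (by positivity)
    · rw [abs_of_pos h] at htA
      obtain ⟨D, hD, hd⟩ := S.core hX hY (by linarith) (by linarith) hx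
        (by
          intro hc
          apply s1
          rw [eq_div_iff hκ]
          linarith)
        (by
          intro hc
          apply s3
          rw [eq_div_iff (by linarith)]
          linarith) htA
      refine ⟨D, hD, hd.congr_of_eventuallyEq ?_⟩
      have hye : ∀ᶠ r in 𝓝 t, 0 < y + κ*r := continuousAt_const.eventually_lt hY.continuousAt h
      filter_upwards [hxe, hye] with r h1 h2
      rw [hNp r h1.le h2.le]

lemma Sys.Vcont (S : Sys p a Γ g k) : Continuous (fun q : ℝ × ℝ => VV p a k q.1 q.2) := by
  unfold VV QQ
  have hp := S.hp
  have hK : Continuous (fun q : ℝ × ℝ => KK k q.1 |q.2|) :=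
    S.Kcont.comp (f := fun q : ℝ × ℝ => (q.1, |q.2|)) (by fun_prop)
  have h1 : Continuous (fun q : ℝ × ℝ => (KK k q.1 |q.2|)^(p-1)) :=
    hK.rpow_const (fun _ => Or.inr (by linarith))
  have h2 : Continuous (fun q : ℝ × ℝ => (KK k q.1 |q.2|)^p) :=
    hK.rpow_const (fun _ => Or.inr (by linarith))
  have h3 : Continuous (fun q : ℝ × ℝ => (max |q.2| 1)^p) :=
    Continuous.rpow_const (by fun_prop) (fun _ => Or.inr (by linarith))
  fun_prop

lemma Sys.line (S : Sys p a Γ g k) {x y κ t : ℝ} (hx : 0 < x + t) :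
    HasDerivAt (fun t => VV p a k (x+t) (y+κ*t))
      (1 * Vx p a g k (x+t) (y+κ*t) + κ * Vy p a g k (x+t) (y+κ*t)) t := by
  have h := S.dV hx.le (y+κ*t) 1 κ
  have h' := h.hasDerivAt (by
    have : ContinuousAt (fun r => x + t + 1*r) 0 := by fun_prop
    have h2 : ∀ᶠ r in 𝓝 (0:ℝ), 0 < x + t + 1*r :=
      continuousAt_const.eventually_lt this (by simpa using hx)
    filter_upwards [h2] with r hr
    exact hr.le)
  have h3 : HasDerivAt (fun r => r - t) 1 t := (hasDerivAt_id t).sub_const t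
  have h4 := HasDerivAt.comp (h₂ := fun r => VV p a k (x+t+1*r) (y+κ*t+κ*r)) (h := fun r => r - t)
    (h₂' := (1 * Vx p a g k (x+t) (y+κ*t) + κ * Vy p a g k (x+t) (y+κ*t)))
    t (by simpa using h') h3
  refine (h4.congr_deriv (by ring)).congr_of_eventuallyEq (Eventually.of_forall fun r => ?_)
  simp only [Function.comp]
  congr 1 <;> ring

lemma Sys.tangent0 (S : Sys p a Γ g k) {x y kx ky : ℝ} (hx : 0 ≤ x) (hxk : 0 ≤ x + kx)
    (hk : |ky| < |kx|) (hky : ky ≠ 0) :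
    VV p a k (x+kx) (y+ky) ≤ VV p a k x y + Vx p a g k x y * kx + Vy p a g k x y * ky := by
  have hkx : kx ≠ 0 := by
    rintro rfl
    simp only [abs_zero] at hk
    exact absurd hk (not_lt.2 (abs_nonneg _))
  obtain ⟨κ, rfl⟩ : ∃ κ, ky = κ * kx := ⟨ky/kx, by field_simp⟩
  have hκ0 : κ ≠ 0 := by rintro rfl; simp at hky
  have hκ : |κ| < 1 := by
    rw [abs_mul] at hk
    have := abs_pos.2 hkx
    by_contra hc
    nlinarith
  obtain ⟨hκ1, hκ2⟩ := abs_lt.1 hκ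
  have hc : Continuous (fun t => VV p a k (x+t) (y+κ*t)) :=
    S.Vcont.comp (f := fun t => (x+t, y+κ*t)) (by fun_prop)
  rcases lt_or_gt_of_ne hkx with h | h
  · obtain ⟨c, hcI, hceq⟩ := exists_hasDerivAt_eq_slope _ _ h hc.continuousOn
      (fun t ht => S.line (x := x) (y := y) (κ := κ) (t := t) (by linarith [ht.1]))
    have := S.anti (x := x) (y := y) (t₁ := c) (t₂ := 0) hκ1 hκ2 hκ0 (by linarith [hcI.1]) hcI.2.le
    rw [hceq, le_div_iff₀ (by linarith)] at this
    simp only [mul_zero, add_zero] at this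
    nlinarith
  · obtain ⟨c, hcI, hceq⟩ := exists_hasDerivAt_eq_slope _ _ h hc.continuousOn
      (fun t ht => S.line (x := x) (y := y) (κ := κ) (t := t) (by linarith [ht.1]))
    have := S.anti (x := x) (y := y) (t₁ := 0) (t₂ := c) hκ1 hκ2 hκ0 (by linarith) hcI.1.le
    rw [hceq, div_le_iff₀ (by linarith)] at this
    simp only [mul_zero, add_zero] at this
    nlinarith

lemma Sys.tangent (S : Sys p a Γ g k) {x y kx ky : ℝ} (hx : 0 ≤ x) (hxk : 0 ≤ x + kx)
    (hk : |ky| ≤ |kx|) :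
    VV p a k (x+kx) (y+ky) ≤ VV p a k x y + Vx p a g k x y * kx + Vy p a g k x y * ky := by
  by_cases hkx : kx = 0
  · subst hkx
    have : ky = 0 := by simpa using hk
    subst this
    simp
  have hkp : 0 < |kx| := abs_pos.2 hkx
  let B : Set ℝ := {r | VV p a k (x+kx) (y+r) ≤
    VV p a k x y + Vx p a g k x y * kx + Vy p a g k x y * r}
  have hB : IsClosed B := isClosed_le
    (S.Vcont.comp (f := fun r => (x+kx, y+r)) (by fun_prop)) (by fun_prop)
  rw [abs_le] at hk
  rcases le_total 0 ky with h | h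
  · have : closure (Ioo 0 |kx|) ⊆ B := closure_minimal
      (fun r hr => S.tangent0 hx hxk (by rw [abs_of_pos hr.1]; exact hr.2) hr.1.ne') hB
    rw [closure_Ioo hkp.ne] at this
    exact this ⟨h, hk.2⟩
  · have : closure (Ioo (-|kx|) 0) ⊆ B := closure_minimal
      (fun r hr => S.tangent0 hx hxk (by rw [abs_of_neg hr.2]; linarith [hr.1]) hr.2.ne) hB
    rw [closure_Ioo (by linarith)] at this
    exact this ⟨hk.1, h⟩

end

/-- Construction of the normalised data. -/
lemma mkSys {α p : ℝ} (hα0 : 0 < α) (hp : 2 ≤ p)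
    {γ h : ℝ → ℝ}
    (hγlin : ∀ x : ℝ, 0 ≤ x → x < ((α+1)*p)⁻¹ → γ x = ((p-1)*(α+1)-1)*x + 1/p)
    (hγode : ∀ x : ℝ, ((α+1)*p)⁻¹ < x →
      HasDerivAt γ
        ((-1 + ((α+1)*p)^p * (p-1) * (1 - γ x) * γ x * x^(p-2)) /
          (1 + ((α+1)*p)^p * (p-1) * (1 - γ x) * x^(p-1))) x)
    (hγinit : γ (((α+1)*p)⁻¹) = 1 - ((α+1)*p)⁻¹)
    (hγdiff : DifferentiableOn ℝ γ (Set.Ici (0:ℝ)))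
    (hγmono : MonotoneOn γ (Set.Ici (0:ℝ)))
    (hγconc : ConcaveOn ℝ (Set.Ici (0:ℝ)) γ)
    (hγlt : ∀ x : ℝ, 0 ≤ x → γ x < 1)
    (hh1 : ∀ x : ℝ, ((α+1)*p)⁻¹ ≤ x → h (x + γ x) = x)
    (hh2 : ∀ y : ℝ, 1 ≤ y → h y + γ (h y) = y)
    (hh3 : ∀ y : ℝ, 1 ≤ y → ((α+1)*p)⁻¹ ≤ h y) :
    ∃ Γ g k : ℝ → ℝ, Sys p ((α+1)*p) Γ g k ∧ (∀ x, 0 ≤ x → Γ x = γ x) ∧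
      (∀ s, s ≤ 1 → k s = (p*s-1)/((p-1)*((α+1)*p))) ∧ (∀ s, 1 ≤ s → k s = h s) := by
  have hp0 : 0 < p := by linarith
  have hp1 : 0 < p - 1 := by linarith
  obtain ⟨a, ha⟩ : ∃ a, a = (α+1)*p := ⟨_, rfl⟩
  have hα : α + 1 = a/p := by rw [ha]; field_simp
  simp only [← ha] at hγlin hγode hγinit hh1 hh3 ⊢
  simp only [hα] at hγlin
  have hap : p < a := by rw [ha]; nlinarith
  have ha0 : 0 < a := by linarith
  have hx0 : 0 < a⁻¹ := by positivity
  have hCp : 0 < a^p*(p-1) := by positivity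
  set g₀ := (p-1)*(a/p) - 1 with hg₀
  have hg₀0 : 0 ≤ g₀ := by
    have : 1 ≤ a/p := by rw [le_div_iff₀ hp0]; linarith
    nlinarith
  have hlin0 : g₀ * a⁻¹ + 1/p = 1 - a⁻¹ := by rw [hg₀]; field_simp; ring
  let Γ : ℝ → ℝ := fun x => if x < a⁻¹ then g₀*x + 1/p else γ x
  let o : ℝ → ℝ := fun x => (-1 + a^p * (p-1) * (1 - Γ x) * Γ x * x^(p-2)) /
          (1 + a^p * (p-1) * (1 - Γ x) * x^(p-1))
  let g : ℝ → ℝ := fun x => o (max x a⁻¹)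
  let k : ℝ → ℝ := fun s => if s < 1 then (p*s-1)/((p-1)*a) else h s
  have Γlt : ∀ x, x < a⁻¹ → Γ x = g₀*x+1/p := fun x hx => if_pos hx
  have Γge : ∀ x, a⁻¹ ≤ x → Γ x = γ x := fun x hx => if_neg (not_lt.2 hx)
  have Γle : ∀ x, x ≤ a⁻¹ → Γ x = g₀*x+1/p := by
    intro x hx
    rcases hx.lt_or_eq with h | h
    · exact Γlt x h
    · rw [Γge x h.ge, h, hγinit, hlin0]
  have Γγ : ∀ x, 0 ≤ x → Γ x = γ x := by
    intro x hx
    rcases lt_or_ge x a⁻¹ with h | h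
    · rw [Γlt x h, hγlin x hx h]
    · exact Γge x h
  have Γ1 : ∀ x, Γ x < 1 := by
    intro x
    rcases le_total 0 x with h | h
    · rw [Γγ x h]; exact hγlt x h
    · rw [Γlt x (by linarith)]
      have : 1/p < 1 := by rw [div_lt_one hp0]; linarith
      nlinarith
  have hpow1 : a^p * (a⁻¹)^(p-1) = a := by
    rw [Real.inv_rpow ha0.le, Real.rpow_sub_one ha0.ne']
    have : a^p ≠ 0 := (Real.rpow_pos_of_pos ha0 p).ne'
    field_simp
  have hpow2 : a^p * (a⁻¹)^(p-2) = a^2 := by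
    have := rpow_split (q := p) hx0.le hp
    rw [this] at hpow1
    field_simp at hpow1
    rw [← hpow1]
    field_simp
  have o0 : o a⁻¹ = g₀ := by
    simp only [o]
    rw [Γle _ le_rfl, hlin0]
    have e1 : a^p * (p-1) * (1 - (1 - a⁻¹)) * (1 - a⁻¹) * (a⁻¹)^(p-2) = (p-1)*(a-1) := by
      rw [show a^p * (p-1) * (1 - (1 - a⁻¹)) * (1 - a⁻¹) * (a⁻¹)^(p-2)
        = (a^p * (a⁻¹)^(p-2)) * (p-1) * a⁻¹ * (1-a⁻¹) by ring, hpow2]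
      field_simp
    have e2 : a^p * (p-1) * (1 - (1 - a⁻¹)) * (a⁻¹)^(p-1) = p-1 := by
      rw [show a^p * (p-1) * (1 - (1 - a⁻¹)) * (a⁻¹)^(p-1)
        = (a^p * (a⁻¹)^(p-1)) * (p-1) * a⁻¹ by ring, hpow1]
      field_simp
    rw [e1, e2, hg₀]
    field_simp
    ring
  have gle : ∀ x, x ≤ a⁻¹ → g x = g₀ := by
    intro x hx
    simp only [g]
    rw [max_eq_right hx, o0]
  have gge : ∀ x, a⁻¹ ≤ x → g x = o x := by
    intro x hx
    simp only [g]
    rw [max_eq_left hx]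
  have hlinD : ∀ x, HasDerivAt (fun x => g₀*x+1/p) g₀ x := by
    intro x
    simpa using ((hasDerivAt_id x).const_mul g₀).add_const (1/p)
  have dΓ : ∀ x, HasDerivAt Γ (g x) x := by
    intro x
    rcases lt_trichotomy x a⁻¹ with hx | hx | hx
    · rw [gle x hx.le]
      refine (hlinD x).congr_of_eventuallyEq ?_
      filter_upwards [Iio_mem_nhds hx] with t ht
      exact Γlt t ht
    · rw [gle x hx.le]
      have hx0' : 0 < x := by rw [hx]; exact hx0
      have hd : HasDerivAt γ (deriv γ x) x :=
        ((hγdiff x hx0'.le).differentiableAt (Ici_mem_nhds hx0')).hasDerivAt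
      have hd' : HasDerivAt Γ (deriv γ x) x := by
        refine hd.congr_of_eventuallyEq ?_
        filter_upwards [Ioi_mem_nhds hx0'] with t ht
        exact Γγ t (le_of_lt ht)
      have hl : HasDerivWithinAt Γ g₀ (Iic x) x :=
        (hlinD x).hasDerivWithinAt.congr (fun t ht => Γle t (by rw [← hx]; exact ht)) (Γle x hx.le)
      have := (uniqueDiffWithinAt_Iic x).eq_deriv _ hd'.hasDerivWithinAt hl
      rw [← this]; exact hd'
    · rw [gge x hx.le]
      have hd := hγode x hx
      simp only [o]
      rw [Γge x hx.le]
      refine hd.congr_of_eventuallyEq ?_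
      filter_upwards [Ioi_mem_nhds hx] with t ht
      exact Γge t (le_of_lt ht)
  have Γc : Continuous Γ := continuous_iff_continuousAt.2 fun x => (dΓ x).continuousAt
  have hden : ∀ x, 0 < x → 0 < 1 + a^p * (p-1) * (1 - Γ x) * x^(p-1) := by
    intro x hx
    have := Γ1 x
    have h1 : 0 < 1 - Γ x := by linarith
    have h2 : 0 < x^(p-1) := Real.rpow_pos_of_pos hx _
    positivity
  have gc : Continuous g := by
    simp only [g, o]
    have hm : Continuous (fun x : ℝ => max x a⁻¹) := by fun_prop
    have hm0 : ∀ x : ℝ, 0 < max x a⁻¹ := fun x => lt_max_of_lt_right hx0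
    have c1 : Continuous (fun x : ℝ => (max x a⁻¹)^(p-2)) :=
      hm.rpow_const (fun _ => Or.inr (by linarith))
    have c2 : Continuous (fun x : ℝ => (max x a⁻¹)^(p-1)) :=
      hm.rpow_const (fun _ => Or.inr (by linarith))
    have c3 : Continuous (fun x : ℝ => Γ (max x a⁻¹)) := Γc.comp hm
    refine Continuous.div ?_ ?_ (fun x => (hden _ (hm0 x)).ne')
    · fun_prop
    · fun_prop
  have gnn : ∀ x, 0 ≤ g x := by
    intro x
    rcases le_or_gt x a⁻¹ with hx | hx
    · rw [gle x hx]; exact hg₀0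
    · have hd := dΓ x
      have hx' : 0 < x := by linarith
      have hm : MonotoneOn Γ (Ici 0) := by
        intro s hs t ht hst
        rw [Γγ s hs, Γγ t ht]; exact hγmono hs ht hst
      have := hm.derivWithin_nonneg (x := x)
      rwa [derivWithin_of_mem_nhds (Ici_mem_nhds hx'), hd.deriv] at this
  have ganti : AntitoneOn g (Ioi 0) := by
    have hc : ConcaveOn ℝ (Ioi 0) Γ := by
      refine (hγconc.subset Ioi_subset_Ici_self (convex_Ioi 0)).congr ?_
      intro t ht
      exact (Γγ t (le_of_lt ht)).symm
    have := hc.antitoneOn_deriv (fun x _ => (dΓ x).differentiableAt)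
    intro s hs t ht hst
    have := this hs ht hst
    rwa [(dΓ s).deriv, (dΓ t).deriv] at this
  have ode : ∀ x, a⁻¹ ≤ x → g x * (1 + a^p*(p-1)*(1-Γ x)*x^(p-1)) =
      -1 + a^p*(p-1)*(1-Γ x)*Γ x*x^(p-2) := by
    intro x hx
    rw [gge x hx]
    simp only [o]
    exact div_mul_cancel₀ _ (hden x (by linarith)).ne'
  have conc : ∀ x, a⁻¹ < x → (p-2)*(1-Γ x) ≤ g x * x := by
    intro x hx
    have hx' : 0 < x := by linarith
    have d1 := (((dΓ x).const_sub 1).const_mul (a^p*(p-1)))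
    have dn := ((d1.mul (dΓ x)).mul ((hasDerivAt_id x).rpow_const (p := p-2)
      (Or.inl (show id x ≠ 0 from hx'.ne')))).const_add (-1)
    have dd := (d1.mul ((hasDerivAt_id x).rpow_const (p := p-1)
      (Or.inl (show id x ≠ 0 from hx'.ne')))).const_add 1
    have dq := dn.div dd (hden x hx').ne'
    have dg := dq.congr_of_eventuallyEq (f₁ := g) (by
      filter_upwards [Ioi_mem_nhds hx] with t ht
      exact gge t (le_of_lt ht))
    have hle := ganti.derivWithin_nonpos (x := x)
    rw [derivWithin_of_mem_nhds (Ioi_mem_nhds hx'), dg.deriv] at hle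
    have hD := hden x hx'
    have ho := ode x hx.le
    simp only [Pi.mul_apply, id] at hle
    have hle2 := (div_nonpos_iff.1 hle).resolve_left (by
      intro hh
      have := hh.2
      exact absurd this (not_le.2 (pow_pos hD 2)))
    have hle3 := hle2.1
    rw [← ho] at hle3
    rw [show p - 1 - 1 = p - 2 by ring, Real.rpow_sub_one hx'.ne'] at hle3
    rw [rpow_split hx'.le hp] at hle3 ho hD
    have hA : 0 < x^(p-2) := Real.rpow_pos_of_pos hx' _
    have hv : 0 < 1 - Γ x := by linarith [Γ1 x]
    have hG : 0 < Γ x := by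
      have : Γ a⁻¹ ≤ Γ x := by
        rw [Γγ _ hx0.le, Γγ _ hx'.le]; exact hγmono hx0.le hx'.le hx.le
      rw [Γle _ le_rfl, hlin0] at this
      have : a⁻¹ < 1 := inv_lt_one_of_one_lt₀ (by linarith)
      linarith
    generalize x^(p-2) = A at *
    generalize Γ x = G at *
    generalize g x = m at *
    have hGm : 0 < G - m*x := by
      have : (G - m*x) * (1 + a ^ p * (p - 1) * (1-G) * (A * x)) = G + x := by
        linear_combination (-x) * ho
      by_contra hcon
      have : (G - m*x) * (1 + a ^ p * (p - 1) * (1-G) * (A * x)) ≤ 0 :=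
        mul_nonpos_of_nonpos_of_nonneg (by linarith) hD.le
      linarith
    by_contra hcon
    have hcon : 0 < (p-2)*(1-G) - m*x := by linarith
    have hpos : 0 < (a^p*(p-1)) * (A/x) * (1 + a ^ p * (p - 1) * (1-G) * (A * x)) *
        ((G - m*x) * ((p-2)*(1-G) - m*x)) := by positivity
    refine absurd hle3 (not_le.2 (lt_of_lt_of_eq hpos ?_))
    field_simp
    ring
  have hk1 : (p-1)*a ≠ 0 := (mul_pos hp1 ha0).ne'
  have eH : ∀ x, x + (g₀*x+1/p) = ((p-1)*a*x + 1)/p := by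
    intro x; rw [hg₀]; field_simp; ring
  refine ⟨Γ, g, k, ⟨hp, hap, dΓ, gc, gnn, ?_, ?_, ?_, Γ1, ?_, ?_, ?_, ?_⟩, Γγ, ?_, ?_⟩
  · intro x hx; rw [gle x (by rwa [one_div] at hx), hg₀]; ring
  · intro x hx; rw [Γle x (by rwa [one_div] at hx), hg₀]; ring
  · intro x hx; exact ode x (by rwa [one_div] at hx)
  · intro x hx
    rw [one_div] at *
    have : Γ a⁻¹ ≤ Γ x := by
      rw [Γγ _ hx0.le, Γγ _ (by linarith)]; exact hγmono hx0.le (hx0.le.trans hx) hx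
    rw [Γle _ le_rfl, hlin0] at this
    linarith
  · intro x hx; exact conc x (by rwa [one_div] at hx)
  · intro x
    rcases lt_or_ge x a⁻¹ with hx | hx
    · rw [Γlt x hx, eH]
      have h1 : ((p-1)*a*x + 1)/p < 1 := by
        rw [div_lt_one hp0]
        have : a*x < 1 := by rwa [← lt_div_iff₀' ha0, one_div]
        nlinarith
      simp only [k]
      rw [if_pos h1]
      field_simp
      ring
    · have h1 : 1 ≤ x + Γ x := by
        have : Γ a⁻¹ ≤ Γ x := by
          rw [Γγ _ hx0.le, Γγ _ (by linarith)]; exact hγmono hx0.le (hx0.le.trans hx) hx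
        rw [Γle _ le_rfl, hlin0] at this
        linarith
      simp only [k]
      rw [if_neg (not_lt.2 h1), Γge x hx]
      exact hh1 x hx
  · intro s
    simp only [k]
    split_ifs with hs
    · rw [Γlt, eH]
      · field_simp; ring
      · rw [div_lt_iff₀ (mul_pos hp1 ha0)]
        field_simp
        nlinarith
    · have hs := not_lt.1 hs
      rw [Γge _ (hh3 s hs)]; exact hh2 s hs
  · intro s hs
    rcases hs.lt_or_eq with h' | h'
    · exact if_pos h'
    · have e : k s = h s := if_neg (by linarith)
      have h2 := hh1 a⁻¹ le_rfl
      rw [hγinit] at h2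
      rw [show a⁻¹ + (1 - a⁻¹) = 1 by ring] at h2
      rw [e, h', h2]
      field_simp
  · intro s hs
    exact if_neg (not_lt.2 hs)

end TangentIneq


/-- The key pointwise concavity-type inequality for the Burkholder-type special function:
`U(x+kₓ, y+k_y, z) ≤ U(x,y,z) + Uₓ(x,y,z) kₓ + U_y(x,y,z) k_y` whenever
`x, x+kₓ ≥ 0`, `z > 0`, `|y| ≤ z` and `|k_y| ≤ |kₓ|` (with the right-sided
derivative in the first variable at `x = 0`). -/
theorem special_function_tangent_inequality
    {α p : ℝ} (hα0 : 0 < α) (hα1 : α ≤ 1) (hp : 2 ≤ p)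
    {γ h : ℝ → ℝ} {u : ℝ → ℝ → ℝ} {U : ℝ → ℝ → ℝ → ℝ}
    (hγlin : ∀ x : ℝ, 0 ≤ x → x < ((α+1)*p)⁻¹ → γ x = ((p-1)*(α+1)-1)*x + 1/p)
    (hγode : ∀ x : ℝ, ((α+1)*p)⁻¹ < x →
      HasDerivAt γ
        ((-1 + ((α+1)*p)^p * (p-1) * (1 - γ x) * γ x * x^(p-2)) /
          (1 + ((α+1)*p)^p * (p-1) * (1 - γ x) * x^(p-1))) x)
    (hγinit : γ (((α+1)*p)⁻¹) = 1 - ((α+1)*p)⁻¹)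
    (hγdiff : DifferentiableOn ℝ γ (Set.Ici (0:ℝ)))
    (hγmono : MonotoneOn γ (Set.Ici (0:ℝ)))
    (hγconc : ConcaveOn ℝ (Set.Ici (0:ℝ)) γ)
    (hγlt : ∀ x : ℝ, 0 ≤ x → γ x < 1)
    (hh1 : ∀ x : ℝ, ((α+1)*p)⁻¹ ≤ x → h (x + γ x) = x)
    (hh2 : ∀ y : ℝ, 1 ≤ y → h y + γ (h y) = y)
    (hh3 : ∀ y : ℝ, 1 ≤ y → ((α+1)*p)⁻¹ ≤ h y)
    (hu0 : ∀ x y : ℝ, 0 ≤ x → |y| ≤ 1 → |y| ≤ γ x →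
      u x y = 1 - ((α+1)*p)^p * x^p)
    (hu1 : ∀ x y : ℝ, 0 ≤ x → |y| ≤ 1 → γ x < |y| → x + |y| ≤ 1 →
      u x y = 1 - ((p*x + p*|y| - 1)/(p-1))^(p-1) * (p*(p*(α+1)-1)*x - p*|y| + 1))
    (hu2 : ∀ x y : ℝ, 0 ≤ x → |y| ≤ 1 → γ x < |y| → 1 < x + |y| →
      u x y = 1 - ((α+1)*p)^p * (h (x+|y|))^(p-1) * (p*x - (p-1) * h (x+|y|)))
    (hU : ∀ x y z : ℝ, 0 ≤ x → 0 < z →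
      U x y z = (max |y| z)^p * u (x / max |y| z) (y / max |y| z))
    :
    ∀ x y z kx ky : ℝ, 0 ≤ x → 0 ≤ x + kx → 0 < z → |y| ≤ z → |ky| ≤ |kx| →
      U (x+kx) (y+ky) z ≤ U x y z
        + derivWithin (fun t => U t y z) (Set.Ici (0:ℝ)) x * kx
        + deriv (fun t => U x t z) y * ky := by
  obtain ⟨Γ, g, k, S, hΓ, hk1, hk2⟩ := TangentIneq.mkSys hα0 hp hγlin hγode hγinit hγdiff hγmono
    hγconc hγlt hh1 hh2 hh3
  have hp0 : 0 < p := by linarith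
  have hp1 : 0 < p - 1 := by linarith
  have ha0 : 0 < (α+1)*p := by positivity
  have hu : ∀ x y : ℝ, 0 ≤ x → |y| ≤ 1 →
      u x y = 1 - ((α+1)*p)^p * TangentIneq.QQ p x (max x (k (x+|y|))) := by
    intro x y hx hy
    rcases le_or_gt |y| (γ x) with h1 | h1
    · have : k (x+|y|) ≤ x := by
        rw [S.kle, hΓ x hx]; linarith
      rw [max_eq_left this, TangentIneq.Q_self hx hp, hu0 x y hx hy h1]
    · have hlt : x < k (x+|y|) := by
        rw [S.ltk, hΓ x hx]; linarith
      have hk0 : 0 ≤ k (x+|y|) := by linarith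
      rw [max_eq_right hlt.le]
      unfold TangentIneq.QQ
      rw [TangentIneq.rpow_split' hk0 hp]
      rcases le_or_gt (x+|y|) 1 with h2 | h2
      · rw [hu1 x y hx hy h1 h2]
        have e := hk1 _ h2
        have e1 : (p*x + p*|y| - 1)/(p-1) = (α+1)*p*k (x+|y|) := by
          rw [e]; field_simp
        have e2 : p*(p*(α+1)-1)*x - p*|y| + 1 = p*((α+1)*p)*x - (p-1)*((α+1)*p*k (x+|y|)) := by
          rw [e]; field_simp; ring
        rw [e1, e2, Real.mul_rpow ha0.le hk0, TangentIneq.rpow_split' ha0.le hp]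
        ring
      · rw [hu2 x y hx hy h1 h2, hk2 _ h2.le]
        ring
  have hV : ∀ x y z : ℝ, 0 ≤ x → 0 < z →
      U x y z = z^p * TangentIneq.VV p ((α+1)*p) k (x/z) (y/z) := by
    intro x y z hx hz
    obtain ⟨Z, hZ⟩ : ∃ Z, Z = max |y/z| 1 := ⟨_, rfl⟩
    have hZ0 : 0 < Z := by rw [hZ]; exact lt_max_of_lt_right one_pos
    have hM : max |y| z = z * Z := by
      rw [hZ, mul_max_of_nonneg _ _ hz.le, abs_div, abs_of_pos hz, mul_one]
      congr 1
      field_simp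
    have hyZ : |y/z| ≤ Z := by rw [hZ]; exact le_max_left _ _
    have ey : |y/(z*Z)| = |y/z|/Z := by
      rw [← div_div, abs_div _ Z, abs_of_pos hZ0]
    have hy1 : |y/(z*Z)| ≤ 1 := by
      rw [ey, div_le_one hZ0]; exact hyZ
    have hX : 0 ≤ x/z := by positivity
    rw [hU x y z hx hz, hM, hu _ _ (by positivity) hy1, ey, Real.mul_rpow hz.le hZ0.le]
    unfold TangentIneq.VV TangentIneq.KK
    rw [← hZ, show x/(z*Z) = x/z/Z by rw [div_div]]
    generalize x/z = X at *
    generalize |y/z| = Y at *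
    rw [← add_div]
    have eK : max (X/Z) (k ((X+Y)/Z)) = max X (Z * k ((X+Y)/Z)) / Z := by
      rw [max_div_div_right hZ0.le X (Z * k ((X+Y)/Z)) |>.symm, mul_div_cancel_left₀ _ hZ0.ne']
    rw [eK]
    have hK : 0 ≤ max X (Z * k ((X+Y)/Z)) := le_max_of_le_left hX
    generalize max X (Z * k ((X+Y)/Z)) = K at *
    unfold TangentIneq.QQ
    rw [Real.div_rpow hK hZ0.le, Real.div_rpow hK hZ0.le, TangentIneq.rpow_split' hZ0.le hp]
    have := (Real.rpow_pos_of_pos hZ0 (p-1)).ne'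
    field_simp
  intro x y z kx ky hx hxk hz _ hky
  have hX : 0 ≤ x/z := by positivity
  have dx : HasDerivWithinAt (fun t => U t y z)
      (z^p * (TangentIneq.Vx p ((α+1)*p) g k (x/z) (y/z) * (1/z))) (Set.Ici 0) x := by
    have h1 := S.dV hX (y/z) 1 0
    have h2 : HasDerivWithinAt (fun t : ℝ => (t - x)/z) (1/z) (Set.Ici 0) x :=
      (((hasDerivAt_id x).sub_const x).div_const z).hasDerivWithinAt
    rw [show (0:ℝ) = (x - x)/z by simp] at h1
    have h3 := (HasDerivWithinAt.scomp x h1 h2 (by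
      intro t ht
      simp only [Set.mem_ofPred_eq]
      have : x/z + 1*((t-x)/z) = t/z := by ring
      rw [sub_self, zero_div, this]
      exact div_nonneg ht hz.le)).const_mul (z^p)
    refine (h3.congr_deriv ?_).congr ?_ ?_
    · rw [smul_eq_mul, sub_self, zero_div]; ring
    · intro t ht
      rw [hV t y z ht hz]
      simp only [Function.comp]
      congr 2 <;> ring
    · rw [hV x y z hx hz]
      simp
  have dy : HasDerivAt (fun t => U x t z)
      (z^p * (TangentIneq.Vy p ((α+1)*p) g k (x/z) (y/z) * (1/z))) y := by
    have h1 := S.dV hX (y/z) 0 1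
    have hs : {t : ℝ | 0 ≤ x/z + 0*t} = Set.univ := by
      ext t; simpa using hX
    rw [hs, hasDerivWithinAt_univ] at h1
    have h2 : HasDerivAt (fun t : ℝ => (t - y)/z) (1/z) y :=
      (((hasDerivAt_id y).sub_const y).div_const z)
    rw [show (0:ℝ) = (y - y)/z by simp] at h1
    have h3 := (HasDerivAt.scomp y h1 h2).const_mul (z^p)
    refine (h3.congr_deriv ?_).congr_of_eventuallyEq ?_
    · rw [smul_eq_mul, sub_self, zero_div]; ring
    · refine Filter.Eventually.of_forall fun t => ?_
      change U x t z = _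
      rw [hV x t z hx hz]
      simp only [Function.comp]
      congr 2 <;> ring
  rw [dx.derivWithin (uniqueDiffOn_Ici 0 x hx), dy.deriv, hV _ _ z hxk hz, hV _ _ z hx hz,
    add_div, add_div]
  have ht := S.tangent (x := x/z) (y := y/z) (kx := kx/z) (ky := ky/z) hX
    (by rw [← add_div]; positivity)
    (by rw [abs_div, abs_div]; gcongr)
  have := mul_le_mul_of_nonneg_left ht (Real.rpow_nonneg hz.le p)
  refine this.trans (le_of_eq ?_)
  ring
end

section
/- Fix α ∈ (0,1] and p ≥ 2 and let U be the Burkholder-type special function. Then U(x,1,1) ≤ 0 for every x ≥ 1. -/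
/-- Non-positivity of the Burkholder-type special function on the diagonal:
`U(x,1,1) ≤ 0` for `x ≥ 1`. -/
theorem special_function_initial_nonpos
    {α p : ℝ} (hα0 : 0 < α) (hα1 : α ≤ 1) (hp : 2 ≤ p)
    {γ h : ℝ → ℝ} {u : ℝ → ℝ → ℝ} {U : ℝ → ℝ → ℝ → ℝ}
    (hγlin : ∀ x : ℝ, 0 ≤ x → x < ((α+1)*p)⁻¹ → γ x = ((p-1)*(α+1)-1)*x + 1/p)
    (hγode : ∀ x : ℝ, ((α+1)*p)⁻¹ < x →
      HasDerivAt γ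
        ((-1 + ((α+1)*p)^p * (p-1) * (1 - γ x) * γ x * x^(p-2)) /
          (1 + ((α+1)*p)^p * (p-1) * (1 - γ x) * x^(p-1))) x)
    (hγinit : γ (((α+1)*p)⁻¹) = 1 - ((α+1)*p)⁻¹)
    (hγdiff : DifferentiableOn ℝ γ (Set.Ici (0:ℝ)))
    (hγmono : MonotoneOn γ (Set.Ici (0:ℝ)))
    (hγconc : ConcaveOn ℝ (Set.Ici (0:ℝ)) γ)
    (hγlt : ∀ x : ℝ, 0 ≤ x → γ x < 1)
    (hh1 : ∀ x : ℝ, ((α+1)*p)⁻¹ ≤ x → h (x + γ x) = x)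
    (hh2 : ∀ y : ℝ, 1 ≤ y → h y + γ (h y) = y)
    (hh3 : ∀ y : ℝ, 1 ≤ y → ((α+1)*p)⁻¹ ≤ h y)
    (hu0 : ∀ x y : ℝ, 0 ≤ x → |y| ≤ 1 → |y| ≤ γ x →
      u x y = 1 - ((α+1)*p)^p * x^p)
    (hu1 : ∀ x y : ℝ, 0 ≤ x → |y| ≤ 1 → γ x < |y| → x + |y| ≤ 1 →
      u x y = 1 - ((p*x + p*|y| - 1)/(p-1))^(p-1) * (p*(p*(α+1)-1)*x - p*|y| + 1))
    (hu2 : ∀ x y : ℝ, 0 ≤ x → |y| ≤ 1 → γ x < |y| → 1 < x + |y| →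
      u x y = 1 - ((α+1)*p)^p * (h (x+|y|))^(p-1) * (p*x - (p-1) * h (x+|y|)))
    (hU : ∀ x y z : ℝ, 0 ≤ x → 0 < z →
      U x y z = (max |y| z)^p * u (x / max |y| z) (y / max |y| z))
    :
    ∀ x : ℝ, 1 ≤ x → U x 1 1 ≤ 0 := by
  intro x hx
  have hK : p ≤ (α+1)*p := by nlinarith
  have hp0 : 0 < p := by linarith
  have hK0 : 0 < (α+1)*p := by linarith
  have hKi : ((α+1)*p)⁻¹ ≤ p⁻¹ := inv_anti₀ hp0 hK
  have hKi0 : 0 < ((α+1)*p)⁻¹ := inv_pos.mpr hK0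
  have hγx := hγlt x (by linarith)
  have e1 : U x 1 1 = u x 1 := by
    rw [hU x 1 1 (by linarith) one_pos]; simp
  have e2 := hu2 x 1 (by linarith) (by simp) (by simpa using hγx) (by simp; linarith)
  rw [abs_one] at e2
  rw [e1, e2]
  have a1 := hh2 (x+1) (by linarith)
  have a2 := hh3 (x+1) (by linarith)
  generalize h (x+1) = H at *
  have a3 := hγlt H (by linarith)
  have a4 := hγmono (Set.mem_Ici.mpr hKi0.le) (Set.mem_Ici.mpr (by linarith)) a2
  rw [hγinit] at a4
  have hH : 1 ≤ H := by linarith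
  have ht : H - x ≤ p⁻¹ := by linarith
  have hpi : p * p⁻¹ = 1 := mul_inv_cancel₀ hp0.ne'
  have hlow : p⁻¹ ≤ p*x - (p-1)*H := by nlinarith
  have hKp : p ≤ ((α+1)*p)^p := by
    calc p ≤ (α+1)*p := hK
      _ = ((α+1)*p)^(1:ℝ) := (Real.rpow_one _).symm
      _ ≤ _ := Real.rpow_le_rpow_of_exponent_le (by linarith) (by linarith)
  have hHp : 1 ≤ H^(p-1) := Real.one_le_rpow hH (by linarith)
  have hm : p * 1 ≤ ((α+1)*p)^p * H^(p-1) :=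
    mul_le_mul hKp hHp zero_le_one (by linarith)
  have hfin : p * 1 * p⁻¹ ≤ ((α+1)*p)^p * H^(p-1) * (p*x - (p-1)*H) :=
    mul_le_mul hm hlow (inv_pos.mpr hp0).le (by linarith)
  rw [mul_one, hpi] at hfin
  linarith
end
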